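/- Let φ be an injective endomorphism of the free group F_n of rank n ≥ 1, and let φ₀, …, φ_k be endomorphisms representing the same outer endomorphism as φ (i.e., each φ_i = i_{m_i} ∘ φ for some m_i ∈ F_n) and lying in pairwise distinct isogrediency classes. Define ind(φ_i) = rank(Fix φ_i) + a(φ_i)/2 − 1, where a(φ_i) is the number of Fix(φ_i)-orbits of attracting fixed points of the boundary extension ∂φ_i. Then Σ_{i=0}^{k} max{0, ind(φ_i)} ≤ n − 1. -/

import Mathlib

/-- The Gromov boundary `∂F_n` of the free group `F_n`, realized as the space of infinite
reduced words: no two consecutive letters are inverse to each other. -/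
def InfRedWord (n : ℕ) : Type :=
  {w : ℕ → Fin n × Bool // ∀ i : ℕ, w (i + 1) ≠ ((w i).1, !(w i).2)}

/-- A sequence `u` of elements of `F_n` converges to the boundary point `W` if the reduced
words of the `u k` converge letterwise to the infinite reduced word `W`. -/
def TendsToBoundary {n : ℕ} (u : ℕ → FreeGroup (Fin n)) (W : InfRedWord n) : Prop :=
  ∀ m : ℕ, ∃ K : ℕ, ∀ k : ℕ, K ≤ k → ∀ j : ℕ, j < m → ((u k).toWord)[j]? = some (W.1 j)

/-- The fixed subgroup `Fix φ = {g | φ g = g}` of a group endomorphism. -/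
def fixSubgroup {G : Type*} [Group G] (φ : Monoid.End G) : Subgroup G where
  carrier := {g | φ g = g}
  one_mem' := by simp
  mul_mem' := by
    intro a b ha hb
    simp only [Set.mem_setOf_eq, map_mul] at *
    rw [ha, hb]
  inv_mem' := by
    intro a ha
    simp only [Set.mem_setOf_eq, map_inv] at *
    rw [ha]

/-- `W ∈ ∂F_n` is an attracting fixed point of the injective endomorphism `φ`:
`W` is not in the boundary `∂ Fix φ` of the fixed subgroup, and some orbit `φ^k u`
converges to `W` (in particular `W` is fixed by `∂φ`). -/
def IsAttractingFixPt {n : ℕ} (φ : Monoid.End (FreeGroup (Fin n))) (W : InfRedWord n) :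
    Prop :=
  (¬ ∃ u : ℕ → FreeGroup (Fin n), (∀ k, u k ∈ fixSubgroup φ) ∧ TendsToBoundary u W) ∧
    ∃ u : FreeGroup (Fin n), TendsToBoundary (fun k => (φ ^ k) u) W

/-- Two boundary points are in the same `Fix φ`-orbit: `W = g • V` for some `g ∈ Fix φ`,
expressed via convergence of sequences. -/
def SameFixOrbit {n : ℕ} (φ : Monoid.End (FreeGroup (Fin n))) (W V : InfRedWord n) :
    Prop :=
  ∃ g ∈ fixSubgroup φ, ∃ u : ℕ → FreeGroup (Fin n),
    TendsToBoundary u V ∧ TendsToBoundary (fun k => g * u k) W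

/-- `a(φ)`: the number of orbits of the action of `Fix φ` on the set of attracting fixed
points of `∂φ`. -/
noncomputable def aCount {n : ℕ} (φ : Monoid.End (FreeGroup (Fin n))) : ℕ :=
  Nat.card (Quot (fun W V : {W : InfRedWord n // IsAttractingFixPt φ W} =>
    SameFixOrbit φ W.1 V.1))

/-- The index `ind φ = rank (Fix φ) + a(φ)/2 − 1` of an endomorphism of `F_n`. -/
noncomputable def indEnd {n : ℕ} (φ : Monoid.End (FreeGroup (Fin n)))
    [Group.FG (fixSubgroup φ)] : ℚ :=
  (Group.rank (fixSubgroup φ) : ℚ) + (aCount φ : ℚ) / 2 - 1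

/-- Isogredience of endomorphisms: `φ₂ = i_c ∘ φ₁ ∘ i_c⁻¹` for some `c`. -/
def Isogredient {G : Type*} [Group G] (φ₁ φ₂ : Monoid.End G) : Prop :=
  ∃ c : G, ∀ g : G, φ₂ g = c * φ₁ (c⁻¹ * g * c) * c⁻¹

namespace IdxSum
open FreeGroup

variable {n : ℕ}

/-- inverse letter -/
def lb (d : Fin n × Bool) : Fin n × Bool := (d.1, !d.2)
/-- letter as a group element -/
def ofL (d : Fin n × Bool) : FreeGroup (Fin n) := FreeGroup.mk [d]
/-- first letter of a group element -/
def hd (g : FreeGroup (Fin n)) : Option (Fin n × Bool) := g.toWord.head?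
/-- direction from `z` to `y` -/
def P (y z : FreeGroup (Fin n)) : Option (Fin n × Bool) := hd (z⁻¹ * y)

@[simp] theorem lb_lb (d : Fin n × Bool) : lb (lb d) = d := by simp [lb]
theorem lb_ne (d : Fin n × Bool) : lb d ≠ d := by
  rcases d with ⟨a, b⟩; simp [lb]
theorem lb_inj {d e : Fin n × Bool} (h : lb d = lb e) : d = e := by
  rw [← lb_lb d, h, lb_lb]
theorem ofL_inv (d : Fin n × Bool) : (ofL d)⁻¹ = ofL (lb d) := by
  simp [ofL, lb, FreeGroup.inv_mk, FreeGroup.invRev]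
@[simp] theorem ofL_mul_lb (d : Fin n × Bool) : ofL d * ofL (lb d) = 1 := by
  rw [← ofL_inv, mul_inv_cancel]
@[simp] theorem ofL_lb_mul (d : Fin n × Bool) : ofL (lb d) * ofL d = 1 := by
  rw [← ofL_inv, inv_mul_cancel]
@[simp] theorem mul_ofL_lb (z : FreeGroup (Fin n)) (d : Fin n × Bool) : z * ofL d * ofL (lb d) = z := by
  rw [mul_assoc, ofL_mul_lb, mul_one]
@[simp] theorem mul_lb_ofL (z : FreeGroup (Fin n)) (d : Fin n × Bool) : z * ofL (lb d) * ofL d = z := by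
  rw [mul_assoc, ofL_lb_mul, mul_one]

theorem toWord_ofL_mul (e : Fin n × Bool) (g : FreeGroup (Fin n)) :
    (ofL e * g).toWord = if g.toWord.head? = some (lb e) then g.toWord.tail else e :: g.toWord := by
  have h1 : ofL e * g = FreeGroup.mk (e :: g.toWord) := by
    conv_lhs => rw [← FreeGroup.mk_toWord (x := g)]
    rw [ofL, FreeGroup.mul_mk]; rfl
  rw [h1, FreeGroup.toWord_mk, FreeGroup.reduce.cons, FreeGroup.reduce_toWord]
  rcases hg : g.toWord with _ | ⟨a, t⟩
  · simp
  · simp only [List.head?_cons, Option.some.injEq, List.tail_cons]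
    rcases e with ⟨e1, e2⟩; rcases a with ⟨a1, a2⟩
    simp only [lb, Prod.mk.injEq]
    by_cases h : e1 = a1 <;> cases e2 <;> cases a2 <;> simp [h, eq_comm]

theorem hd_eq_none {g : FreeGroup (Fin n)} : hd g = none ↔ g = 1 := by
  simp [hd, List.head?_eq_none_iff, FreeGroup.toWord_eq_nil_iff]

theorem tail_head_ne (g : FreeGroup (Fin n)) (d : Fin n × Bool) (h : hd g = some d) :
    g.toWord.tail.head? ≠ some (lb d) := by
  have hr := FreeGroup.isReduced_toWord (x := g)
  rcases hg : g.toWord with _ | ⟨a, _ | ⟨b, t⟩⟩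
  · simp
  · simp
  · rw [hg] at hr
    simp only [hd, hg, List.head?_cons, Option.some.injEq] at h
    subst h
    have := (List.isChain_cons_cons.1 hr).1
    intro hb
    simp only [List.tail_cons, List.head?_cons, Option.some.injEq] at hb
    subst hb
    simp [lb] at this

theorem hd_lb_mul (d : Fin n × Bool) (g : FreeGroup (Fin n)) :
    hd (ofL (lb d) * g) = some (lb d) ↔ hd g ≠ some d := by
  have := toWord_ofL_mul (lb d) g
  rw [lb_lb] at this
  unfold hd
  rw [this]
  by_cases h : g.toWord.head? = some d
  · rw [if_pos h]
    simp only [h, ne_eq, not_true_eq_false, iff_false]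
    exact tail_head_ne g d h
  · simp [h]

theorem norm_lb_mul_of (d : Fin n × Bool) (g : FreeGroup (Fin n)) (h : hd g = some d) :
    (ofL (lb d) * g).norm + 1 = g.norm := by
  unfold FreeGroup.norm
  unfold hd at h
  rw [toWord_ofL_mul, lb_lb, if_pos h]
  rcases hg : g.toWord with _ | ⟨a, t⟩
  · simp [hg] at h
  · simp

theorem norm_lb_mul_of_not (d : Fin n × Bool) (g : FreeGroup (Fin n)) (h : hd g ≠ some d) :
    (ofL (lb d) * g).norm = g.norm + 1 := by
  unfold FreeGroup.norm
  unfold hd at h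
  rw [toWord_ofL_mul, lb_lb, if_neg h]
  simp

/-! ### tree rules -/
theorem P_none {y z : FreeGroup (Fin n)} : P y z = none ↔ y = z := by
  rw [P, hd_eq_none, inv_mul_eq_one, eq_comm]

theorem P_self (y : FreeGroup (Fin n)) : P y y = none := P_none.2 rfl

theorem P_ex {y z : FreeGroup (Fin n)} (h : y ≠ z) : ∃ d, P y z = some d := by
  rcases hP : P y z with _ | d
  · exact absurd (P_none.1 hP) h
  · exact ⟨d, rfl⟩

theorem P_ax (y z : FreeGroup (Fin n)) (d : Fin n × Bool) :
    P y (z * ofL d) = some (lb d) ↔ P y z ≠ some d := by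
  unfold P
  rw [mul_inv_rev, ofL_inv, mul_assoc, hd_lb_mul]

theorem P_smul (g y z : FreeGroup (Fin n)) : P (g * y) (g * z) = P y z := by
  unfold P; congr 1; group

theorem P_smul' (g y z : FreeGroup (Fin n)) : P (g * y) z = P y (g⁻¹ * z) := by
  rw [← P_smul g y]; simp

theorem P_nb (z : FreeGroup (Fin n)) (d : Fin n × Bool) : P (z * ofL d) z = some d := by
  by_contra h
  have := (P_ax (z * ofL d) z d).2 h
  rw [P_self] at this; cases this

/-- tree distance -/
def td (y z : FreeGroup (Fin n)) : ℕ := (z⁻¹ * y).norm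

theorem td_eq_zero {y z : FreeGroup (Fin n)} : td y z = 0 ↔ y = z := by
  rw [td, FreeGroup.norm_eq_zero, inv_mul_eq_one, eq_comm]

theorem td_comm (y z : FreeGroup (Fin n)) : td y z = td z y := by
  unfold td; rw [← FreeGroup.norm_inv_eq]; congr 1; group

theorem td_smul (g y z : FreeGroup (Fin n)) : td (g * y) (g * z) = td y z := by
  unfold td; congr 1; group

theorem td_step {y z : FreeGroup (Fin n)} {d : Fin n × Bool} (h : P y z = some d) :
    td y (z * ofL d) + 1 = td y z := by
  unfold td; rw [mul_inv_rev, ofL_inv, mul_assoc]; exact norm_lb_mul_of d _ h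

theorem td_step' {y z : FreeGroup (Fin n)} {d : Fin n × Bool} (h : P y z ≠ some d) :
    td y (z * ofL d) = td y z + 1 := by
  unfold td; rw [mul_inv_rev, ofL_inv, mul_assoc]; exact norm_lb_mul_of_not d _ h

theorem td_triangle (x y z : FreeGroup (Fin n)) : td x z ≤ td x y + td y z := by
  unfold td
  have := FreeGroup.norm_mul_le (z⁻¹ * y) (y⁻¹ * x)
  rw [show z⁻¹ * y * (y⁻¹ * x) = z⁻¹ * x by group] at this
  omega

/-- induction along the path from `z` to `y` -/
theorem path_ind (y : FreeGroup (Fin n)) {p : FreeGroup (Fin n) → Prop} (h0 : p y)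
    (h1 : ∀ z d, P y z = some d → p (z * ofL d) → p z) (z : FreeGroup (Fin n)) : p z := by
  induction hm : td y z using Nat.strong_induction_on generalizing z with
  | _ m ih =>
    by_cases hyz : y = z
    · exact hyz ▸ h0
    · obtain ⟨d, hd⟩ := P_ex hyz
      have := td_step hd
      exact h1 z d hd (ih _ (by omega) _ rfl)

/-- neighbours are seen in the same direction -/
theorem P_nbr {y z : FreeGroup (Fin n)} {d : Fin n × Bool} (h1 : z ≠ y) (h2 : z * ofL d ≠ y) :
    P (z * ofL d) y = P z y := by
  revert h1 h2
  refine path_ind z (p := fun y => z ≠ y → z * ofL d ≠ y → P (z * ofL d) y = P z y) ?_ ?_ y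
  · intro h; exact absurd rfl h
  · intro w e hw ih _ h2
    rw [hw]
    by_contra hc
    have ha : P (z * ofL d) (w * ofL e) = some (lb e) := (P_ax _ _ _).2 hc
    have hb : P z (w * ofL e) ≠ some (lb e) := fun hh => (P_ax _ _ _).1 hh hw
    by_cases h3 : z = w * ofL e
    · rw [← h3, P_nb] at ha
      have : d = lb e := by simpa using ha
      apply h2
      rw [h3, this]; simp
    · by_cases h4 : z * ofL d = w * ofL e
      · rw [h4, P_self] at ha; cases ha
      · rw [ih h3 h4] at ha; exact hb ha

/-- (L1) if `y1` and `y'` lie in different directions from `y`, then from `y'`, `y1` and `y`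
are in the same direction -/
theorem L1 {y y' y1 : FreeGroup (Fin n)} (hne : y ≠ y') (h : P y1 y ≠ P y' y) : P y1 y' = P y y' := by
  revert hne h
  refine path_ind y' (p := fun y => y ≠ y' → P y1 y ≠ P y' y → P y1 y' = P y y') ?_ ?_ y
  · intro h; exact absurd rfl h
  · intro z d hz ih hzn h
    rw [hz] at h
    have ha : P y1 (z * ofL d) = some (lb d) := (P_ax _ _ _).2 h
    by_cases hzy : z * ofL d = y'
    · subst hzy
      rw [ha]; symm
      apply (P_ax _ _ _).2; rw [P_self]; simp
    · have hb : P y' (z * ofL d) ≠ some (lb d) := by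
        intro hh; exact (P_ax _ _ _).1 hh hz
      have h3 := ih hzy (by rw [ha]; exact fun e => hb e.symm)
      rw [h3]
      exact P_nbr hzn hzy
end IdxSum

namespace IdxSum
open FreeGroup Finset

variable {n : ℕ}

theorem td_add {y y' y1 : FreeGroup (Fin n)} (h : P y1 y ≠ P y' y) :
    td y1 y' = td y1 y + td y' y := by
  revert h
  refine path_ind y' (p := fun y => P y1 y ≠ P y' y → td y1 y' = td y1 y + td y' y) ?_ ?_ y
  · intro _
    rw [td_eq_zero.2 (rfl : y' = y'), add_zero]
  · intro z d hz ih h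
    rw [hz] at h
    have ha : P y1 (z * ofL d) = some (lb d) := (P_ax _ _ _).2 h
    have hb : P y' (z * ofL d) ≠ some (lb d) := fun hh => (P_ax _ _ _).1 hh hz
    have h3 := ih (by rw [ha]; exact fun e => hb e.symm)
    have h4 := td_step hz
    have h5 := td_step' h
    omega

theorem ball_finite (R : ℕ) : {g : FreeGroup (Fin n) | g.norm ≤ R}.Finite :=
  Set.Finite.of_finite_image (f := FreeGroup.toWord)
    ((List.finite_length_le (Fin n × Bool) R).subset (by
      rintro _ ⟨g, hg, rfl⟩; exact hg)) (FreeGroup.toWord_injective.injOn)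

/-- ball of radius `R` -/
noncomputable def ball (n R : ℕ) : Finset (FreeGroup (Fin n)) := (ball_finite R).toFinset

@[simp] theorem mem_ball {R : ℕ} {g : FreeGroup (Fin n)} : g ∈ ball n R ↔ g.norm ≤ R := by
  simp [ball]

/-- convex sets -/
def Conv (K : Set (FreeGroup (Fin n))) : Prop :=
  ∀ y ∈ K, ∀ z ∈ K, ∀ d, P z y = some d → y * ofL d ∈ K

theorem Conv.inter {K L : Set (FreeGroup (Fin n))} (hK : Conv K) (hL : Conv L) : Conv (K ∩ L) :=
  fun y hy z hz d h => ⟨hK y hy.1 z hz.1 d h, hL y hy.2 z hz.2 d h⟩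

theorem Conv.translate {K : Set (FreeGroup (Fin n))} (hK : Conv K) (g : FreeGroup (Fin n)) :
    Conv {y | g * y ∈ K} := by
  intro y hy z hz d h
  have := hK _ hy _ hz d (by rw [P_smul]; exact h)
  rwa [mul_assoc] at this

/-- convex hull -/
def hull (Y : Set (FreeGroup (Fin n))) : Set (FreeGroup (Fin n)) :=
  {y | ∀ o : Option (Fin n × Bool), o ≠ none → ∃ z ∈ Y, P z y ≠ o}

theorem subset_hull (Y : Set (FreeGroup (Fin n))) : Y ⊆ hull Y :=
  fun y hy o ho => ⟨y, hy, by rw [P_self]; exact ho.symm⟩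

theorem hull_conv (Y : Set (FreeGroup (Fin n))) : Conv (hull Y) := by
  intro y hy z hz d h o ho
  by_cases he : o = some (lb d)
  · have hne : z ≠ y := by rintro rfl; rw [P_self] at h; cases h
    obtain ⟨w, hw, hw'⟩ := hz (P y z) (by rw [Ne, P_none]; exact hne.symm)
    refine ⟨w, hw, ?_⟩
    rw [he]
    have := L1 hne hw'
    intro hh
    exact (P_ax _ _ _).1 hh (this.trans h)
  · obtain ⟨w, hw, hw'⟩ := hy (some d) (by simp)
    exact ⟨w, hw, by rw [(P_ax _ _ _).2 hw']; exact fun e => he e.symm⟩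

theorem hull_finite {Y : Set (FreeGroup (Fin n))} (hY : Y.Finite) (hne : Y.Nonempty) :
    (hull Y).Finite := by
  obtain ⟨R, hR⟩ : ∃ R, ∀ y ∈ Y, y.norm ≤ R := by
    obtain ⟨R, hR⟩ := (hY.image FreeGroup.norm).bddAbove
    exact ⟨R, fun y hy => hR ⟨y, hy, rfl⟩⟩
  refine (ball_finite R).subset ?_
  intro y hy
  by_cases h1 : y = 1
  · subst h1; simp
  · obtain ⟨w, hw, hw'⟩ := hy (P 1 y) (by rw [Ne, P_none]; exact fun h => h1 h.symm)
    have := td_add hw'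
    have h2 : td w 1 = w.norm := by simp [td]
    have h3 : td 1 y = y.norm := by simp [td, FreeGroup.norm_inv_eq]
    have := hR w hw
    simp only [Set.mem_setOf_eq]; omega

/-- valence of `y` in `K` -/
def val (K : Finset (FreeGroup (Fin n))) (y : FreeGroup (Fin n)) : ℕ :=
  #{d : Fin n × Bool | y * ofL d ∈ K}

theorem val_sum {K : Finset (FreeGroup (Fin n))} (hK : Conv (K : Set (FreeGroup (Fin n))))
    (hne : K.Nonempty) : ∑ y ∈ K, val K y + 2 = 2 * #K := by
  obtain ⟨z, hz⟩ := hne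
  have e0 : ∑ y ∈ K, val K y =
      #((K ×ˢ (univ : Finset (Fin n × Bool))).filter (fun p => p.1 * ofL p.2 ∈ K)) := by
    rw [card_filter, sum_product]
    refine sum_congr rfl fun y _ => ?_
    rw [val, card_filter]
  have e1 : #((K ×ˢ (univ : Finset (Fin n × Bool))).filter
      (fun p => P z p.1 = some p.2)) = #(K.erase z) := by
    refine card_bij (fun p _ => p.1) ?_ ?_ ?_
    · rintro ⟨y, d⟩ h
      simp only [mem_filter, mem_product, mem_univ, and_true] at h
      refine mem_erase.2 ⟨?_, h.1⟩
      rintro rfl; rw [P_self] at h; exact absurd h.2 (by simp)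
    · rintro ⟨y, d⟩ h ⟨y', d'⟩ h' (e : y = y')
      subst e
      simp only [mem_filter] at h h'
      have := h.2.symm.trans h'.2
      simp at this
      rw [this]
    · intro y hy
      rw [mem_erase] at hy
      obtain ⟨d, hd⟩ := P_ex hy.1.symm
      exact ⟨(y, d), by simp [hy.2, hd], rfl⟩
  have e2 : #((K ×ˢ (univ : Finset (Fin n × Bool))).filter
      (fun p => p.1 * ofL p.2 ∈ K ∧ P z p.1 ≠ some p.2)) =
      #((K ×ˢ (univ : Finset (Fin n × Bool))).filter (fun p => P z p.1 = some p.2)) := by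
    refine card_bij (fun p _ => (p.1 * ofL p.2, lb p.2)) ?_ ?_ ?_
    · rintro ⟨y, d⟩ h
      simp only [mem_filter, mem_product, mem_univ, and_true] at h ⊢
      exact ⟨h.2.1, (P_ax _ _ _).2 h.2.2⟩
    · rintro ⟨y, d⟩ h ⟨y', d'⟩ h' e
      simp only [Prod.mk.injEq] at e
      have := lb_inj e.2
      subst this
      simpa using e.1
    · rintro ⟨y, d⟩ h
      simp only [mem_filter, mem_product, mem_univ, and_true] at h
      have hm : y * ofL d ∈ K := hK y h.1 z hz d h.2
      refine ⟨(y * ofL d, lb d), ?_, by simp⟩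
      simp only [mem_filter, mem_product, mem_univ, and_true, mul_ofL_lb]
      refine ⟨hm, h.1, fun hh => (P_ax _ _ _).1 hh h.2⟩
  have e3 : (K ×ˢ (univ : Finset (Fin n × Bool))).filter (fun p => P z p.1 = some p.2) =
      (K ×ˢ (univ : Finset (Fin n × Bool))).filter
        (fun p => p.1 * ofL p.2 ∈ K ∧ P z p.1 = some p.2) := by
    apply filter_congr
    rintro ⟨y, d⟩ h
    simp only [mem_product] at h
    exact ⟨fun h' => ⟨hK y h.1 z hz d h', h'⟩, fun h' => h'.2⟩
  have e4 := card_filter_add_card_filter_not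
    (s := (K ×ˢ (univ : Finset (Fin n × Bool))).filter (fun p => p.1 * ofL p.2 ∈ K))
    (fun p => P z p.1 = some p.2)
  rw [filter_filter, filter_filter, ← e3, e2, e1] at e4
  have := card_erase_add_one hz
  omega

theorem leaves_le {K : Finset (FreeGroup (Fin n))} (hK : Conv (K : Set (FreeGroup (Fin n))))
    {Y : Finset (FreeGroup (Fin n))} (hKY : (K : Set (FreeGroup (Fin n))) ⊆ hull Y)
    (hY : Y.Nonempty) :
    #{y ∈ K | val K y ≤ 1} ≤ #Y := by
  have key : ∀ y, ∃ w ∈ Y, y ∈ K → val K y ≤ 1 → ∀ y' ∈ K, y' ≠ y → P w y ≠ P y' y := by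
    intro y
    by_cases h : y ∈ K ∧ val K y ≤ 1 ∧ ∃ y0 ∈ K, y0 ≠ y
    · obtain ⟨hy, hv, y0, hy0, hne⟩ := h
      obtain ⟨w, hw, hw'⟩ := hKY hy (P y0 y) (by rw [Ne, P_none]; exact hne)
      refine ⟨w, hw, fun _ _ y' hy' hne' => ?_⟩
      obtain ⟨d, hd⟩ := P_ex hne
      obtain ⟨d', hd'⟩ := P_ex hne'
      have : d = d' := by
        refine card_le_one.1 hv d ?_ d' ?_
        · simpa using hK y hy y0 hy0 d hd
        · simpa using hK y hy y' hy' d' hd'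
      rw [hd', ← this, ← hd]; exact hw'
    · obtain ⟨w, hw⟩ := hY
      refine ⟨w, hw, fun hy hv y' hy' hne => absurd ⟨hy, hv, y', hy', hne⟩ h⟩
  choose w hw hw' using key
  refine card_le_card_of_injOn w (fun y _ => hw y) ?_
  intro y hy y' hy' e
  simp only [coe_filter, Set.mem_setOf_eq] at hy hy'
  by_contra hne
  have h1 := hw' y hy.1 hy.2 y' hy'.1 (Ne.symm hne)
  have h2 := hw' y' hy'.1 hy'.2 y hy.1 hne
  have e' : w y = w y' := e
  rw [← e'] at h2
  exact h2 (L1 hne h1)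

theorem branch_le {K : Finset (FreeGroup (Fin n))} (hK : Conv (K : Set (FreeGroup (Fin n))))
    (hne : K.Nonempty)
    {Y : Finset (FreeGroup (Fin n))} (hKY : (K : Set (FreeGroup (Fin n))) ⊆ hull Y)
    (hY : Y.Nonempty) :
    #{y ∈ K | val K y ≠ 2} ≤ 3 * #Y := by
  have h1 := leaves_le hK hKY hY
  have h2 := val_sum hK hne
  have h3 : ∀ y ∈ K, 2 + (if val K y ≠ 2 then 1 else 0) ≤ val K y + 3 * (if val K y ≤ 1 then 1 else 0) := by
    intro y _
    split_ifs <;> omega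
  have h4 := sum_le_sum h3
  rw [sum_add_distrib, sum_add_distrib, ← card_filter, ← mul_sum, ← card_filter] at h4
  simp only [sum_const, smul_eq_mul] at h4
  omega
end IdxSum

namespace IdxSum
open Finset

variable {n : ℕ}

theorem exists_coord (θ : FreeGroup (Fin n) →* FreeGroup (Fin n)) (hθ : Function.Injective θ) :
    ∃ h : FreeGroup (Fin n) → FreeGroup (Fin n), (∀ g y, h (θ g * y) = g * h y) ∧ h 1 = 1 := by
  let r : FreeGroup (Fin n) → FreeGroup (Fin n) := fun y =>
    (Quotient.mk (QuotientGroup.rightRel θ.range) y).out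
  have hr : ∀ g y, r (θ g * y) = r y := by
    intro g y
    have : (Quotient.mk (QuotientGroup.rightRel θ.range) (θ g * y)) =
        Quotient.mk (QuotientGroup.rightRel θ.range) y := by
      apply Quotient.sound
      change QuotientGroup.rightRel θ.range _ _
      rw [QuotientGroup.rightRel_apply]
      exact ⟨g⁻¹, by rw [map_inv]; group⟩
    simp only [r, this]
  have hk : ∀ y, ∃ k, θ k = y * (r y)⁻¹ := by
    intro y
    have : QuotientGroup.rightRel θ.range (r y) y := Quotient.exact (Quotient.out_eq _)
    rw [QuotientGroup.rightRel_apply] at this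
    exact this
  choose k hk using hk
  have h1 : ∀ g y, k (θ g * y) = g * k y := by
    intro g y
    apply hθ
    rw [hk, hr, map_mul, hk, mul_assoc]
  exact ⟨fun y => k y * (k 1)⁻¹, fun g y => by simp only [h1, mul_assoc], by simp⟩

theorem val_ge_two {K : Finset (FreeGroup (Fin n))} {y : FreeGroup (Fin n)} {d d' : Fin n × Bool}
    (h : y * ofL d ∈ K) (h' : y * ofL d' ∈ K) (hne : d ≠ d') : 2 ≤ val K y := by
  by_contra hc
  exact hne (card_le_one.1 (show val K y ≤ 1 by omega) d (by simpa using h) d' (by simpa using h'))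

theorem A0 (hn : 1 ≤ n) (θ : FreeGroup (Fin n) →* FreeGroup (Fin n)) (hθ : Function.Injective θ)
    (R : ℕ) (hR : 1 ≤ R)
    (hbase : ∀ d, ∃ k ∈ ball n R, k ≠ 1 ∧ hd (θ k) ≠ some d)
    {ι : Type*} (V : Finset ι) (c : ι → FreeGroup (Fin n)) (D : ι → Finset (Fin n × Bool))
    (hD2 : ∀ v ∈ V, 2 ≤ #(D v))
    (hw : ∀ v ∈ V, ∀ d ∈ D v, ∃ h ∈ ball n R, P (θ h) (c v) = some d)
    (hcol : ∀ u ∈ V, ∀ v ∈ V, u ≠ v → ∀ b : FreeGroup (Fin n),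
      b.norm ≤ 2 * (6 * n * #(ball n R)) → c u ≠ θ b * c v) :
    ∑ v ∈ V, ((#(D v) : ℤ) - 2) ≤ 2 * n - 2 := by
  classical
  obtain ⟨h, hh, h1⟩ := exists_coord θ hθ
  have hθh : ∀ g, h (θ g) = g := fun g => by simpa [h1] using hh g 1
  set Y : Finset (FreeGroup (Fin n)) := (ball n R).image θ with hYdef
  have hY1 : (1 : FreeGroup (Fin n)) ∈ Y := mem_image.2 ⟨1, by simp, by simp⟩
  have hYne : Y.Nonempty := ⟨1, hY1⟩
  have hYc : #Y ≤ #(ball n R) := card_image_le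
  set K : Finset (FreeGroup (Fin n)) := (hull_finite Y.finite_toSet hYne).toFinset with hKdef
  have hKh : ∀ y, y ∈ K ↔ y ∈ hull (Y : Set (FreeGroup (Fin n))) := fun y => by
    rw [hKdef, Set.Finite.mem_toFinset]
  have hKc : (K : Set (FreeGroup (Fin n))) = hull (Y : Set (FreeGroup (Fin n))) := by
    ext y; exact hKh y
  have hKconv : Conv (K : Set (FreeGroup (Fin n))) := by rw [hKc]; exact hull_conv _
  have hYK : ∀ y ∈ Y, y ∈ K := fun y hy => (hKh y).2 (subset_hull _ hy)
  -- translates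
  set Kx : Fin n × Bool → Finset (FreeGroup (Fin n)) :=
    fun x => K.filter (fun y => θ (ofL x) * y ∈ K) with hKxdef
  have hKxconv : ∀ x, Conv (Kx x : Set (FreeGroup (Fin n))) := by
    intro x
    have := hKconv.inter (hKconv.translate (θ (ofL x)))
    convert this using 1
    ext y; simp [hKxdef]
  have hnormL : ∀ x : Fin n × Bool, (ofL x).norm = 1 := by
    intro x; simp [FreeGroup.norm, ofL, FreeGroup.toWord_mk]
  have hKxne : ∀ x, (Kx x).Nonempty := by
    intro x
    refine ⟨1, mem_filter.2 ⟨hYK _ hY1, hYK _ (mem_image.2 ⟨ofL x, ?_, by simp⟩)⟩⟩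
    rw [mem_ball, hnormL]; exact hR
  have hKxsub : ∀ x, (Kx x : Set (FreeGroup (Fin n))) ⊆ hull Y := by
    intro x y hy
    exact (hKh y).1 (mem_filter.1 hy).1
  -- edges
  set T : Finset (FreeGroup (Fin n) × (Fin n × Bool)) :=
    (K ×ˢ univ).filter (fun p => θ (ofL (lb p.2)) * p.1 ∈ K) with hT
  set ev : FreeGroup (Fin n) × (Fin n × Bool) → ℤ := fun p => (val (Kx (lb p.2)) p.1 : ℤ) - 2 with hev
  have hTsum : ∑ p ∈ T, ev p = - 4 * n := by
    have : ∑ p ∈ T, ev p = ∑ x : Fin n × Bool, ∑ y ∈ Kx (lb x), ((val (Kx (lb x)) y : ℤ) - 2) := by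
      rw [hT, sum_filter, sum_product_right]
      refine sum_congr rfl fun x _ => ?_
      rw [hKxdef, sum_filter]
    rw [this]
    have : ∀ x : Fin n × Bool, ∑ y ∈ Kx (lb x), ((val (Kx (lb x)) y : ℤ) - 2) = -2 := by
      intro x
      have := val_sum (hKxconv (lb x)) (hKxne (lb x))
      rw [sum_sub_distrib, sum_const, ← Nat.cast_sum]
      simp only [nsmul_eq_mul]
      omega
    simp only [this, sum_const, card_univ, Fintype.card_prod, Fintype.card_fin, Fintype.card_bool]
    simp; ring
  set E := T.filter (fun p => hd (h p.1) = some p.2) with hE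
  have hEsum : ∑ p ∈ E, ev p = - 2 * n := by
    have e1 := sum_filter_add_sum_filter_not T (fun p => hd (h p.1) = some p.2) ev
    have e2 : ∑ p ∈ T.filter (fun p => ¬ hd (h p.1) = some p.2), ev p = ∑ p ∈ E, ev p := by
      refine sum_nbij' (fun p => (θ (ofL (lb p.2)) * p.1, lb p.2))
        (fun p => (θ (ofL (lb p.2)) * p.1, lb p.2)) ?_ ?_ ?_ ?_ ?_
      · rintro ⟨y, x⟩ hp
        simp only [hE, hT, mem_filter, mem_product, mem_univ, and_true] at hp ⊢
        refine ⟨⟨hp.1.2, ?_⟩, ?_⟩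
        · rw [← mul_assoc, ← map_mul, lb_lb, ofL_mul_lb, map_one, one_mul]; exact hp.1.1
        · rw [hh]; exact (hd_lb_mul _ _).2 hp.2
      · rintro ⟨y, x⟩ hp
        simp only [hE, hT, mem_filter, mem_product, mem_univ, and_true] at hp ⊢
        refine ⟨⟨hp.1.2, ?_⟩, ?_⟩
        · rw [← mul_assoc, ← map_mul, lb_lb, ofL_mul_lb, map_one, one_mul]; exact hp.1.1
        · rw [hh]; exact fun e => (hd_lb_mul _ _).1 e hp.2
      · rintro ⟨y, x⟩ hp
        simp [← mul_assoc, ← map_mul]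
      · rintro ⟨y, x⟩ hp
        simp [← mul_assoc, ← map_mul]
      · rintro ⟨y, x⟩ hp
        simp only [hev, lb_lb, val, hKxdef, mem_filter]
        congr 2
        congr 1
        ext d
        simp only [mem_filter, mem_univ, true_and, ← mul_assoc, ← map_mul, ofL_mul_lb, map_one, one_mul]
        tauto
    rw [e2, hTsum] at e1
    linarith
  set E2 := E.filter (fun p => ev p ≠ 0) with hE2
  have hE2sum : ∑ p ∈ E2, ev p = - 2 * n := by
    rw [hE2, sum_filter_ne_zero]; exact hEsum
  have hE2card : #E2 ≤ 6 * n * #(ball n R) := by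
    have e1 : #E2 ≤ #(T.filter (fun p => ev p ≠ 0)) :=
      card_le_card (filter_subset_filter _ (filter_subset _ _))
    have e2 : #(T.filter (fun p => ev p ≠ 0)) =
        ∑ x : Fin n × Bool, #{y ∈ Kx (lb x) | val (Kx (lb x)) y ≠ 2} := by
      rw [hT, filter_filter, card_filter, sum_product_right]
      refine sum_congr rfl fun x _ => ?_
      rw [hKxdef, filter_filter, card_filter]
      refine sum_congr rfl fun y _ => ?_
      congr 1
      simp only [hev, eq_iff_iff]
      refine and_congr Iff.rfl (not_congr ?_)
      rw [sub_eq_zero]; norm_cast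
    have e3 : ∀ x ∈ (univ : Finset (Fin n × Bool)),
        #{y ∈ Kx (lb x) | val (Kx (lb x)) y ≠ 2} ≤ 3 * #(ball n R) := fun x _ =>
      (branch_le (hKxconv _) (hKxne _) (hKxsub _) hYne).trans (by omega)
    have e4 := sum_le_card_nsmul _ _ _ e3
    simp only [card_univ, Fintype.card_prod, Fintype.card_fin, Fintype.card_bool, smul_eq_mul] at e4
    calc #E2 ≤ n * 2 * (3 * #(ball n R)) := by omega
      _ = _ := by ring
  have hEmem : ∀ p ∈ E2, p.1 ∈ K ∧ θ (ofL (lb p.2)) * p.1 ∈ K ∧ hd (h p.1) = some p.2 := by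
    intro p hp
    simp only [hE2, hE, hT, mem_filter, mem_product, mem_univ, and_true] at hp
    exact ⟨hp.1.1.1, hp.1.1.2, hp.1.2⟩
  -- parent map
  obtain ⟨pm, hpm1, hpm2⟩ : ∃ pm : FreeGroup (Fin n) → FreeGroup (Fin n),
      (∀ p ∈ E2, pm p.1 = θ (ofL (lb p.2)) * p.1) ∧
      (∀ y, (∀ x, (y, x) ∉ E2) → pm y = y) := by
    refine ⟨fun y => if hy : ∃ x, (y, x) ∈ E2 then θ (ofL (lb hy.choose)) * y else y, ?_, ?_⟩
    · rintro ⟨y, x⟩ hp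
      have hy : ∃ x, (y, x) ∈ E2 := ⟨x, hp⟩
      have hx : hy.choose = x := by
        have := (hEmem _ hy.choose_spec).2.2
        have h2 := (hEmem _ hp).2.2
        simpa using this.symm.trans h2
      simp only
      rw [dif_pos hy, hx]
    · intro y hy
      have : ¬ ∃ x, (y, x) ∈ E2 := by push Not; exact hy
      simp only [this, dite_false]
  have hnp : ∀ p ∈ E2, (h (pm p.1)).norm + 1 = (h p.1).norm := by
    intro p hp
    rw [hpm1 p hp, hh]
    exact norm_lb_mul_of _ _ (hEmem p hp).2.2
  let root : FreeGroup (Fin n) → FreeGroup (Fin n) := fun y => pm^[(h y).norm] y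
  have hroot1 : ∀ p ∈ E2, root (pm p.1) = root p.1 := by
    intro p hp
    change pm^[_] _ = pm^[_] _
    rw [← hnp p hp, Function.iterate_succ_apply]
  have hroot2 : ∀ y, (∀ x, (y, x) ∉ E2) → root y = y := by
    intro y hy
    exact Function.iterate_fixed (hpm2 y hy) _
  have hind : ∀ {q : FreeGroup (Fin n) → Prop}, (∀ y, (∀ x, (y, x) ∉ E2) → q y) →
      (∀ p ∈ E2, q (pm p.1) → q p.1) → ∀ y, q y := by
    intro q q1 q2 y
    induction hm : (h y).norm using Nat.strong_induction_on generalizing y with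
    | _ m ih =>
      by_cases hy : ∃ x, (y, x) ∈ E2
      · obtain ⟨x, hx⟩ := hy
        exact q2 (y, x) hx (ih (h (pm y)).norm (by have := hnp _ hx; simp only at this; omega) _ rfl)
      · push Not at hy; exact q1 y hy
  have hrootK : ∀ y, y ∈ K → root y ∈ K ∧ (∀ x, (root y, x) ∉ E2) := by
    refine hind ?_ ?_
    · intro y hy hyK; rw [hroot2 y hy]; exact ⟨hyK, hy⟩
    · intro p hp ih _
      rw [← hroot1 p hp]
      exact ih (by rw [hpm1 p hp]; exact (hEmem p hp).2.1)
  have hrootb : ∀ y, ∃ b : FreeGroup (Fin n), root y = θ b * y ∧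
      b.norm ≤ #(E2.filter (fun p => (h p.1).norm ≤ (h y).norm)) := by
    refine hind ?_ ?_
    · intro y hy; exact ⟨1, by rw [hroot2 y hy]; simp, by simp⟩
    · rintro p hp ⟨b, hb, hb'⟩
      refine ⟨b * ofL (lb p.2), ?_, ?_⟩
      · rw [← hroot1 p hp, hb, hpm1 p hp, map_mul, mul_assoc]
      · have e1 := FreeGroup.norm_mul_le b (ofL (lb p.2))
        rw [hnormL] at e1
        have e2 : #(E2.filter (fun q => (h q.1).norm ≤ (h (pm p.1)).norm)) <
            #(E2.filter (fun q => (h q.1).norm ≤ (h p.1).norm)) := by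
          apply card_lt_card
          have := hnp p hp
          refine ⟨fun q hq => ?_, fun hs => ?_⟩
          · rw [mem_filter] at hq ⊢; exact ⟨hq.1, by omega⟩
          · have := (mem_filter.1 (hs (mem_filter.2 ⟨hp, le_rfl⟩))).2
            omega
        omega
  -- letters of classes
  let Rt := K.filter (fun y => ∀ x, (y, x) ∉ E2)
  let Lt : FreeGroup (Fin n) → Finset (Fin n × Bool) :=
    fun r => univ.filter (fun d => ∃ y ∈ K, root y = r ∧ y * ofL d ∈ K)
  have hLtval : ∀ y ∈ K, val K y ≤ #(Lt (root y)) := by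
    intro y hy
    refine card_le_card fun d hd => ?_
    simp only [mem_filter, mem_univ, true_and, Lt] at hd ⊢
    exact ⟨y, hy, rfl, hd⟩
  have hRt : #Rt + #E2 = #K := by
    have : #E2 = #(K.filter (fun y => ¬ ∀ x, (y, x) ∉ E2)) := by
      refine card_bij (fun p _ => p.1) ?_ ?_ ?_
      · intro p hp
        rw [mem_filter]; push Not
        exact ⟨(hEmem p hp).1, p.2, hp⟩
      · rintro ⟨y, x⟩ hp ⟨y', x'⟩ hp' (rfl : y = y')
        have := (hEmem _ hp).2.2.symm.trans (hEmem _ hp').2.2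
        simp at this; rw [this]
      · intro y hy
        rw [mem_filter] at hy; push Not at hy
        obtain ⟨x, hx⟩ := hy.2
        exact ⟨(y, x), hx, rfl⟩
    rw [this]
    exact card_filter_add_card_filter_not _
  have hLtsum : ∑ r ∈ Rt, #(Lt r) + ∑ p ∈ E2, val (Kx (lb p.2)) p.1 ≤ ∑ y ∈ K, val K y := by
    have e0 : ∑ y ∈ K, val K y =
        #((K ×ˢ (univ : Finset (Fin n × Bool))).filter (fun p => p.1 * ofL p.2 ∈ K)) := by
      rw [card_filter, sum_product]
      refine sum_congr rfl fun y _ => ?_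
      rw [val, card_filter]
    let bad : FreeGroup (Fin n) × (Fin n × Bool) → Prop := fun q =>
      ∃ x, (q.1, x) ∈ E2 ∧ θ (ofL (lb x)) * (q.1 * ofL q.2) ∈ K
    have e1 : ∑ p ∈ E2, val (Kx (lb p.2)) p.1 = #(((K ×ˢ (univ : Finset (Fin n × Bool))).filter
        (fun p => p.1 * ofL p.2 ∈ K)).filter bad) := by
      have : ∑ p ∈ E2, val (Kx (lb p.2)) p.1 =
          #((E2 ×ˢ (univ : Finset (Fin n × Bool))).filter
            (fun q => q.1.1 * ofL q.2 ∈ Kx (lb q.1.2))) := by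
        rw [card_filter, sum_product]
        refine sum_congr rfl fun y _ => ?_
        rw [val, card_filter]
      rw [this]
      refine card_bij (fun q _ => (q.1.1, q.2)) ?_ ?_ ?_
      · rintro ⟨⟨y, x⟩, d⟩ hq
        simp only [mem_filter, mem_product, mem_univ, and_true, hKxdef, true_and] at hq ⊢
        exact ⟨⟨(hEmem _ hq.1).1, hq.2.1⟩, x, hq.1, hq.2.2⟩
      · rintro ⟨⟨y, x⟩, d⟩ hq ⟨⟨y', x'⟩, d'⟩ hq' e
        simp only [mem_filter, mem_product, mem_univ, and_true, Prod.mk.injEq] at hq hq' e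
        obtain ⟨rfl, rfl⟩ := e
        have := (hEmem _ hq.1).2.2.symm.trans (hEmem _ hq'.1).2.2
        simp at this; rw [this]
      · rintro ⟨y, d⟩ hq
        simp only [mem_filter, mem_product, mem_univ, and_true] at hq
        obtain ⟨⟨hy, hyd⟩, x, hx, hx'⟩ := hq
        exact ⟨((y, x), d), by simp [hKxdef, hx, hyd, hx'], rfl⟩
    have e2 : ∑ r ∈ Rt, #(Lt r) ≤ #(((K ×ˢ (univ : Finset (Fin n × Bool))).filter
        (fun p => p.1 * ofL p.2 ∈ K)).filter (fun q => ¬ bad q)) := by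
      have : ∑ r ∈ Rt, #(Lt r) = #((Rt ×ˢ (univ : Finset (Fin n × Bool))).filter
            (fun q => q.2 ∈ Lt q.1)) := by
        rw [card_filter, sum_product]
        refine sum_congr rfl fun y _ => ?_
        rw [← card_filter]
        congr 1; ext d; simp
      rw [this]
      have hex : ∀ q : FreeGroup (Fin n) × (Fin n × Bool), q.2 ∈ Lt q.1 →
          ∃ y ∈ K, root y = q.1 ∧ y * ofL q.2 ∈ K ∧ ¬ bad (y, q.2) := by
        rintro ⟨r, d⟩ hq
        simp only [Lt, mem_filter, mem_univ, true_and] at hq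
        obtain ⟨y, hy⟩ := hq
        revert y
        refine hind ?_ ?_
        · rintro y hy ⟨hyK, hr, hyd⟩
          exact ⟨y, hyK, hr, hyd, fun ⟨x, hx, _⟩ => hy x hx⟩
        · rintro ⟨y, x⟩ hp ih ⟨hyK, hr, hyd⟩
          by_cases hb : bad (y, d)
          · apply ih
            rw [hroot1 _ hp, hpm1 _ hp]
            obtain ⟨x', hx', hx''⟩ := hb
            have := (hEmem _ hp).2.2.symm.trans (hEmem _ hx').2.2
            simp only [Option.some.injEq] at this
            refine ⟨(hEmem _ hp).2.1, hr, ?_⟩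
            simp only [this, mul_assoc]
            exact hx''
          · exact ⟨y, hyK, hr, hyd, hb⟩
      choose! yy hyy using hex
      refine card_le_card_of_injOn (fun q => (yy q, q.2)) ?_ ?_
      · rintro q hq
        simp only [coe_filter, mem_product, mem_univ, and_true, Set.mem_setOf_eq] at hq
        have := hyy q hq.2
        simp only [coe_filter, mem_filter, mem_product, mem_univ, and_true, Set.mem_setOf_eq]
        exact ⟨⟨this.1, this.2.2.1⟩, this.2.2.2⟩
      · rintro q hq q' hq' e
        simp only [coe_filter, mem_product, mem_univ, and_true, Set.mem_setOf_eq] at hq hq'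
        simp only [Prod.mk.injEq] at e
        have a1 := (hyy q hq.2).2.1
        have a2 := (hyy q' hq'.2).2.1
        exact Prod.ext (by rw [← a1, e.1, a2]) e.2
    have e3 := card_filter_add_card_filter_not
      (s := (K ×ˢ (univ : Finset (Fin n × Bool))).filter (fun p => p.1 * ofL p.2 ∈ K)) bad
    omega
  -- every class has at least two letters
  have hbig : ∀ k : FreeGroup (Fin n), k.norm ≤ R → 2 ≤ #(Lt (root (θ k))) := by
    intro k
    induction hm : k.norm using Nat.strong_induction_on generalizing k with
    | _ m ih =>
      intro hk
      have hkK : θ k ∈ K := hYK _ (mem_image.2 ⟨k, by rw [mem_ball]; omega, rfl⟩)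
      by_cases hv : 2 ≤ val K (θ k)
      · exact hv.trans (hLtval _ hkK)
      by_cases hk1 : k = 1
      · exfalso
        apply hv
        rw [hk1, map_one]
        have hdir : ∀ g ∈ ball n R, g ≠ 1 → ∃ d, hd (θ g) = some d ∧ 1 * ofL d ∈ K := by
          intro g hg hg1
          rcases hd0 : hd (θ g) with _ | d
          · rw [hd_eq_none] at hd0
            exact absurd (hθ (by rw [hd0, map_one])) hg1
          · exact ⟨d, rfl, hKconv 1 (hYK _ hY1) (θ g) (hYK _ (mem_image.2 ⟨g, hg, rfl⟩)) d
              (by simpa [P] using hd0)⟩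
        obtain ⟨k0, hk0, hk01, _⟩ := hbase (⟨0, hn⟩, true)
        obtain ⟨d, hd, hdK⟩ := hdir k0 hk0 hk01
        obtain ⟨k1, hk1, hk11, hne⟩ := hbase d
        obtain ⟨d', hd', hdK'⟩ := hdir k1 hk1 hk11
        refine val_ge_two hdK hdK' ?_
        rintro rfl; exact hne hd'
      · rcases hx : hd k with _ | x
        · exact absurd (hd_eq_none.1 hx) hk1
        have hnk := norm_lb_mul_of x k hx
        have hmem : θ (ofL (lb x)) * θ k ∈ K := by
          rw [← map_mul]
          exact hYK _ (mem_image.2 ⟨_, by rw [mem_ball]; omega, rfl⟩)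
        have hvle : val (Kx (lb x)) (θ k) ≤ val K (θ k) := by
          refine card_le_card fun d hd => ?_
          simp only [mem_filter, mem_univ, true_and, hKxdef] at hd ⊢
          exact hd.1
        have hE2m : (θ k, x) ∈ E2 := by
          simp only [hE2, hE, hT, mem_filter, mem_product, mem_univ, and_true]
          refine ⟨⟨⟨hkK, hmem⟩, by rw [hθh]; exact hx⟩, ?_⟩
          simp only [hev]; omega
        rw [← hroot1 _ hE2m, hpm1 _ hE2m]
        simp only
        rw [← map_mul]
        exact ih _ (by omega) _ rfl (by omega)
  have hLt2 : ∀ r ∈ Rt, 2 ≤ #(Lt r) := by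
    intro r hr
    rw [mem_filter] at hr
    rw [← hroot2 r hr.2]
    by_cases hv : 2 ≤ val K r
    · exact hv.trans (hLtval _ hr.1)
    have : r ∈ Y := by
      by_contra hrY
      apply hv
      have hne : ∀ z ∈ Y, z ≠ r := fun z hz e => hrY (e ▸ hz)
      obtain ⟨d, hd⟩ := P_ex (hne 1 hY1)
      obtain ⟨z, hz, hz'⟩ := (hKh r).1 hr.1 (some d) (by simp)
      obtain ⟨d', hd'⟩ := P_ex (hne z hz)
      refine val_ge_two (hKconv r hr.1 1 (hYK _ hY1) d hd) (hKconv r hr.1 z (hYK _ hz) d' hd') ?_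
      rintro rfl; exact hz' hd'
    obtain ⟨k, hk, rfl⟩ := mem_image.1 this
    exact hbig k (mem_ball.1 hk)
  -- the centres
  have hcK : ∀ v ∈ V, c v ∈ K := by
    intro v hv
    rw [hKh]
    rintro (_ | d) ho
    · exact absurd rfl ho
    obtain ⟨d', hd', hne⟩ := exists_mem_ne (show 1 < #(D v) by have := hD2 v hv; omega) d
    obtain ⟨g, hg, hg'⟩ := hw v hv d' hd'
    refine ⟨θ g, mem_coe.2 (mem_image.2 ⟨g, hg, rfl⟩), ?_⟩
    rw [hg']; simpa using hne
  have hcD : ∀ v ∈ V, #(D v) ≤ #(Lt (root (c v))) := by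
    intro v hv
    refine le_trans (card_le_card fun d hd => ?_) (hLtval _ (hcK v hv))
    obtain ⟨g, hg, hg'⟩ := hw v hv d hd
    simp only [mem_filter, mem_univ, true_and]
    exact hKconv _ (hcK v hv) _ (hYK _ (mem_image.2 ⟨g, hg, rfl⟩)) d hg'
  have hcinj : Set.InjOn (fun v => root (c v)) (V : Set ι) := by
    intro u hu v hv e
    by_contra hne
    obtain ⟨a, ha, ha'⟩ := hrootb (c u)
    obtain ⟨b, hb, hb'⟩ := hrootb (c v)
    have e' : root (c u) = root (c v) := e
    rw [ha, hb] at e'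
    refine hcol u hu v hv hne (a⁻¹ * b) ?_ ?_
    · have e1 := FreeGroup.norm_mul_le a⁻¹ b
      rw [FreeGroup.norm_inv_eq] at e1
      have e3 := ha'.trans (card_filter_le _ _)
      have e4 := hb'.trans (card_filter_le _ _)
      omega
    · rw [map_mul, map_inv, mul_assoc, ← e']; group
  have f1 : ∑ v ∈ V, ((#(D v) : ℤ) - 2) ≤ ∑ r ∈ Rt, ((#(Lt r) : ℤ) - 2) := by
    calc ∑ v ∈ V, ((#(D v) : ℤ) - 2) ≤ ∑ v ∈ V, ((#(Lt (root (c v))) : ℤ) - 2) :=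
          sum_le_sum fun v hv => by have := hcD v hv; omega
      _ = ∑ r ∈ V.image (fun v => root (c v)), ((#(Lt r) : ℤ) - 2) := by
          rw [sum_image hcinj]
      _ ≤ _ := by
          refine sum_le_sum_of_subset_of_nonneg ?_ ?_
          · intro r hr
            obtain ⟨v, hv, rfl⟩ := mem_image.1 hr
            exact mem_filter.2 (hrootK _ (hcK v hv))
          · intro r hr _
            have := hLt2 r hr; omega
  have f2 := val_sum hKconv ⟨1, hYK _ hY1⟩
  have f3 : ∑ p ∈ E2, ev p = ((∑ p ∈ E2, val (Kx (lb p.2)) p.1 : ℕ) : ℤ) - 2 * #E2 := by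
    simp only [hev]; rw [sum_sub_distrib, sum_const]; simp; ring
  have f4 : ∑ r ∈ Rt, ((#(Lt r) : ℤ) - 2) = ((∑ r ∈ Rt, #(Lt r) : ℕ) : ℤ) - 2 * #Rt := by
    rw [sum_sub_distrib, sum_const]; simp; ring
  have := hLtsum
  omega
end IdxSum

namespace IdxSum
open Finset

variable {n : ℕ}

/-- the cocycle `u φ(u) ⋯ φ^{p-1}(u)` -/
def uu {G : Type*} [Group G] (φ : Monoid.End G) (u : G) : ℕ → G
  | 0 => 1
  | p + 1 => u * φ (uu φ u p)

section uu
variable {G : Type*} [Group G] (φ : Monoid.End G)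

theorem End_pow_succ' (p : ℕ) (x : G) : (φ ^ (p + 1)) x = φ ((φ ^ p) x) := by
  rw [pow_succ']; rfl

theorem End_pow_add (p q : ℕ) (x : G) : (φ ^ (p + q)) x = (φ ^ p) ((φ ^ q) x) := by
  rw [pow_add]; rfl

theorem End_pow_zero (x : G) : (φ ^ 0) x = x := rfl

theorem End_pow_one (x : G) : (φ ^ 1) x = φ x := by rw [pow_one]

theorem End_pow_inj (hφ : Function.Injective φ) (p : ℕ) : Function.Injective (φ ^ p : Monoid.End G) := by
  induction p with
  | zero => intro x y h; simpa [End_pow_zero] using h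
  | succ p ih => intro x y h; rw [End_pow_succ', End_pow_succ'] at h; exact ih (hφ h)

theorem uu_one (u : G) : uu φ u 1 = u := by simp [uu]

theorem uu_add (u : G) (p q : ℕ) : uu φ u (p + q) = uu φ u p * (φ ^ p) (uu φ u q) := by
  induction p with
  | zero => simp [uu]
  | succ p ih =>
    rw [show p + 1 + q = (p + q) + 1 by ring, uu, uu, ih, map_mul, End_pow_succ', mul_assoc]

theorem uu_mul_eq {u v : G} {r : ℕ} (h : uu φ u r = uu φ v r) (k : ℕ) :
    uu φ u (r * k) = uu φ v (r * k) := by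
  induction k with
  | zero => simp [uu]
  | succ k ih => rw [Nat.mul_succ, uu_add, uu_add, ih, h]

theorem uu_dvd_eq {u v : G} {r p : ℕ} (h : uu φ u r = uu φ v r) (hd : r ∣ p) :
    uu φ u p = uu φ v p := by
  obtain ⟨k, rfl⟩ := hd; exact uu_mul_eq φ h k

theorem uu_conj (u g : G) (p : ℕ) :
    uu φ (g⁻¹ * u * φ g) p = g⁻¹ * uu φ u p * (φ ^ p) g := by
  induction p with
  | zero => simp [uu]
  | succ p ih =>
    rw [uu, uu, ih, End_pow_succ', map_mul, map_mul, map_inv]; group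

theorem nocol (hφ : Function.Injective φ) {u v : G} (huv : ∀ p, 1 ≤ p → uu φ u p ≠ uu φ v p)
    (b : G) : ∃ q p0 : ℕ, 1 ≤ q ∧ ∀ p, p0 < p → q ∣ p → uu φ u p * (φ ^ p) b ≠ uu φ v p := by
  set v' := b * v * (φ b)⁻¹ with hv'
  have hv : ∀ p, uu φ v' p = b * uu φ v p * ((φ ^ p) b)⁻¹ := by
    intro p
    have := uu_conj φ v b⁻¹ p
    simpa [hv', map_inv] using this
  by_cases hr : ∃ r, 1 ≤ r ∧ uu φ u r = uu φ v' r
  · obtain ⟨r, hr1, hr⟩ := hr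
    refine ⟨r, 0, hr1, fun p hp hd e => ?_⟩
    have h1 := uu_dvd_eq φ hr hd
    rw [hv, ← e] at h1
    have h2 : b = 1 := by
      have : uu φ u p = b * uu φ u p := by simpa [mul_assoc] using h1
      simpa using this
    rw [h2, map_one, mul_one] at e
    exact huv p hp e
  · push Not at hr
    by_cases hp0 : ∃ p0, 1 ≤ p0 ∧ uu φ u p0 * (φ ^ p0) b = uu φ v p0
    · obtain ⟨p0, h1, h2⟩ := hp0
      refine ⟨1, p0, le_rfl, fun p hp _ e => ?_⟩
      obtain ⟨r, rfl⟩ := Nat.exists_eq_add_of_lt hp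
      have e1 : b * uu φ u p0 = uu φ v' p0 := by rw [hv, ← h2]; group
      have e2 : b * uu φ u (p0 + (r + 1)) = uu φ v' (p0 + (r + 1)) := by
        rw [show p0 + (r + 1) = p0 + r + 1 by ring, hv, ← e]; group
      rw [uu_add φ u p0, uu_add φ v' p0, ← mul_assoc, e1] at e2
      exact hr (r + 1) (by omega) (End_pow_inj φ hφ p0 (mul_left_cancel e2))
    · push Not at hp0
      exact ⟨1, 0, le_rfl, fun p hp _ => hp0 p hp⟩
end uu

theorem hd_mul_ofL {a : FreeGroup (Fin n)} {d : Fin n × Bool} (h1 : a ≠ 1) (h2 : a * ofL d ≠ 1) :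
    hd (a * ofL d) = hd a := by
  have := P_nbr h1 h2
  simpa [P] using this

theorem A1 (hn : 1 ≤ n) (φ : Monoid.End (FreeGroup (Fin n))) (hφ : Function.Injective φ)
    {ι : Type*} (V : Finset ι) (u : ι → FreeGroup (Fin n))
    (hV : ∀ i ∈ V, ∀ j ∈ V, i ≠ j → ∀ p, 1 ≤ p → uu φ (u i) p ≠ uu φ (u j) p)
    (D : ι → Finset (Fin n × Bool)) (hD2 : ∀ v ∈ V, 2 ≤ #(D v))
    (hgood : ∀ i ∈ V, ∀ d ∈ D i, ∃ m, 1 ≤ m ∧ ∃ L : Finset (FreeGroup (Fin n)),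
      ∀ p, 1 ≤ p → m ∣ p → ∃ h1 ∈ L, ∃ h2 ∈ L, h1 ≠ h2 ∧
        hd (uu φ (u i) p * (φ ^ p) h1) = some d ∧ hd (uu φ (u i) p * (φ ^ p) h2) = some d) :
    ∑ v ∈ V, ((#(D v) : ℤ) - 2) ≤ 2 * n - 2 := by
  classical
  choose! m hm1 L hL using hgood
  set M := ∏ i ∈ V, ∏ d ∈ D i, m i d with hM
  have hMpos : 1 ≤ M := Nat.one_le_iff_ne_zero.2
    (prod_ne_zero_iff.2 fun i hi => prod_ne_zero_iff.2 fun d hd => by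
      have := hm1 i hi d hd; omega)
  have hMd : ∀ i ∈ V, ∀ d ∈ D i, m i d ∣ M := fun i hi d hd =>
    (dvd_prod_of_mem (m i) hd).trans (dvd_prod_of_mem (fun i => ∏ d ∈ D i, m i d) hi)
  obtain ⟨R, hR⟩ : ∃ R, ∀ i ∈ V, ∀ d ∈ D i, ∀ h ∈ L i d, h.norm ≤ R := by
    refine ⟨∑ i ∈ V, ∑ d ∈ D i, ∑ h ∈ L i d, h.norm, fun i hi d hd h hh => ?_⟩
    calc h.norm ≤ ∑ h ∈ L i d, h.norm := single_le_sum (f := FreeGroup.norm) (fun _ _ => Nat.zero_le _) hh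
      _ ≤ ∑ d ∈ D i, ∑ h ∈ L i d, h.norm :=
          single_le_sum (f := fun d => ∑ h ∈ L i d, h.norm) (fun _ _ => Nat.zero_le _) hd
      _ ≤ _ := single_le_sum (f := fun i => ∑ d ∈ D i, ∑ h ∈ L i d, h.norm)
          (fun _ _ => Nat.zero_le _) hi
  set N := 2 * (6 * n * #(ball n (2 * R + 1))) with hN
  have hnc : ∀ t : ι × ι × FreeGroup (Fin n), ∃ q p0 : ℕ, 1 ≤ q ∧
      (t.1 ∈ V → t.2.1 ∈ V → t.1 ≠ t.2.1 → ∀ p, p0 < p → q ∣ p →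
        uu φ (u t.1) p * (φ ^ p) t.2.2 ≠ uu φ (u t.2.1) p) := by
    rintro ⟨i, j, b⟩
    by_cases h : i ∈ V ∧ j ∈ V ∧ i ≠ j
    · obtain ⟨q, p0, hq, hp⟩ := nocol φ hφ (hV i h.1 j h.2.1 h.2.2) b
      exact ⟨q, p0, hq, fun _ _ _ => hp⟩
    · exact ⟨1, 0, le_rfl, fun h1 h2 h3 => absurd ⟨h1, h2, h3⟩ h⟩
  choose q p0 hq hp0 using hnc
  set B := V ×ˢ V ×ˢ ball n N with hB
  set p := M * (∏ t ∈ B, q t) * (∑ t ∈ B, p0 t + 1) with hp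
  have hQpos : 1 ≤ ∏ t ∈ B, q t := Nat.one_le_iff_ne_zero.2
    (prod_ne_zero_iff.2 fun t _ => by have := hq t; omega)
  have hpbig : ∑ t ∈ B, p0 t + 1 ≤ p := Nat.le_mul_of_pos_left _ (Nat.mul_pos hMpos hQpos)
  have hcolp : ∀ i ∈ V, ∀ j ∈ V, i ≠ j → ∀ b : FreeGroup (Fin n), b.norm ≤ N →
      uu φ (u i) p * (φ ^ p) b ≠ uu φ (u j) p := by
    intro i hi j hj hne b hb
    have hmem : (i, j, b) ∈ B := by simp [hB, hi, hj, hb]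
    refine hp0 (i, j, b) hi hj hne p ?_ ?_
    · have := single_le_sum (f := p0) (fun _ _ => Nat.zero_le _) hmem
      omega
    · exact (dvd_prod_of_mem q hmem).trans ((Dvd.intro_left _ rfl).trans (Dvd.intro _ rfl))
  have hMp : M ∣ p := by rw [hp, mul_assoc]; exact Dvd.intro _ rfl
  have hφp := End_pow_inj φ hφ p
  -- choice of the base point
  let W : FreeGroup (Fin n) → Prop := fun g => ∀ i ∈ V, ∀ d ∈ D i, ∃ h1 h2 : FreeGroup (Fin n),
    h1.norm ≤ R ∧ h2.norm ≤ R ∧ h1 ≠ h2 ∧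
    hd (uu φ (u i) p * (φ ^ p) h1 * g) = some d ∧ hd (uu φ (u i) p * (φ ^ p) h2 * g) = some d
  have hW1 : W 1 := by
    intro i hi d hd
    obtain ⟨h1, hh1, h2, hh2, hne, e1, e2⟩ := hL i hi d hd p (by omega) ((hMd i hi d hd).trans hMp)
    exact ⟨h1, h2, hR i hi d hd _ hh1, hR i hi d hd _ hh2, hne, by simpa using e1, by simpa using e2⟩
  have hnormL : ∀ x : Fin n × Bool, (ofL x).norm = 1 := by
    intro x; simp [FreeGroup.norm, ofL, FreeGroup.toWord_mk]
  let ms : FreeGroup (Fin n) → ℕ := fun g => ∑ x : Fin n × Bool, (g⁻¹ * (φ ^ p) (ofL x) * g).norm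
  have hbase : ∀ s g, W g → ms g = s → ∃ g, W g ∧
      ∀ d, ∃ k ∈ ball n (2 * R + 1), k ≠ 1 ∧ hd (g⁻¹ * (φ ^ p) k * g) ≠ some d := by
    intro s
    induction s using Nat.strong_induction_on with
    | _ s ih =>
      intro g hg hs
      by_cases hb : ∀ d, ∃ k ∈ ball n (2 * R + 1), k ≠ 1 ∧ hd (g⁻¹ * (φ ^ p) k * g) ≠ some d
      · exact ⟨g, hg, hb⟩
      push Not at hb
      obtain ⟨d0, hd0⟩ := hb
      refine ih (ms (g * ofL d0)) ?_ (g * ofL d0) ?_ rfl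
      · rw [← hs]
        have : Nonempty (Fin n) := ⟨⟨0, hn⟩⟩
        refine sum_lt_sum_of_nonempty univ_nonempty fun x _ => ?_
        have hx1 : ∀ x : Fin n × Bool, hd (g⁻¹ * (φ ^ p) (ofL x) * g) = some d0 := by
          intro x
          refine hd0 _ (by rw [mem_ball, hnormL]; omega) ?_
          intro h; have := hnormL x; rw [h] at this; simp at this
        set a := g⁻¹ * (φ ^ p) (ofL x) * g with ha
        have h1 : hd a = some d0 := hx1 x
        have h2 : hd a⁻¹ = some d0 := by
          rw [← hx1 (lb x), ha, ← ofL_inv, map_inv]; congr 1; group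
        have h3 : a ≠ 1 := by intro h; rw [h, hd_eq_none.2 rfl] at h1; cases h1
        have h4 : a⁻¹ * ofL d0 ≠ 1 := by
          intro h
          have h5 : a⁻¹ = ofL (lb d0) := by rw [← ofL_inv]; exact eq_inv_of_mul_eq_one_left h
          rw [h5] at h2
          have : hd (ofL (lb d0)) = some (lb d0) := by simp [hd, ofL, FreeGroup.toWord_mk]
          rw [this] at h2
          exact lb_ne d0 (by simpa using h2)
        have h5 := hd_mul_ofL (inv_ne_one.2 h3) h4
        rw [h2] at h5
        have h6 := norm_lb_mul_of _ _ h5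
        have h7 := norm_lb_mul_of _ _ h1
        have h8 : (a⁻¹ * ofL d0).norm = (ofL (lb d0) * a).norm := by
          rw [← FreeGroup.norm_inv_eq, ← ofL_inv]; congr 1; group
        have h9 : ((g * ofL d0)⁻¹ * (φ ^ p) (ofL x) * (g * ofL d0)).norm =
            (ofL (lb d0) * (a⁻¹ * ofL d0)).norm := by
          rw [← FreeGroup.norm_inv_eq, ← ofL_inv]; congr 1; rw [ha]; group
        omega
      · intro i hi d hd1
        obtain ⟨h1, h2, hn1, hn2, hne, e1, e2⟩ := hg i hi d hd1
        have key : ∀ h1 h2 : FreeGroup (Fin n), h1.norm ≤ R → h2.norm ≤ R → h1 ≠ h2 →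
            hd (uu φ (u i) p * (φ ^ p) h1 * g) = some d →
            hd (uu φ (u i) p * (φ ^ p) h2 * g) = some d →
            hd (uu φ (u i) p * (φ ^ p) h1 * (g * ofL d0)) = some d := by
          intro h1 h2 hn1 hn2 hne e1 e2
          rw [← mul_assoc, hd_mul_ofL, e1]
          · intro h; rw [h, hd_eq_none.2 rfl] at e1; cases e1
          · intro h
            set a1 := uu φ (u i) p * (φ ^ p) h1 * g with ha1
            set a2 := uu φ (u i) p * (φ ^ p) h2 * g with ha2
            have ha : a1 = ofL (lb d0) := by rw [← ofL_inv]; exact eq_inv_of_mul_eq_one_left h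
            have hdd : d = lb d0 := by
              have : hd (ofL (lb d0)) = some (lb d0) := by simp [hd, ofL, FreeGroup.toWord_mk]
              rw [ha, this] at e1
              simpa using e1.symm
            have h12 := hd0 (h1⁻¹ * h2) (by
              rw [mem_ball]
              have := FreeGroup.norm_mul_le h1⁻¹ h2
              rw [FreeGroup.norm_inv_eq] at this
              omega) (by rw [Ne, inv_mul_eq_one]; exact hne)
            have h13 : g⁻¹ * (φ ^ p) (h1⁻¹ * h2) * g = ofL (lb d) * a2 := by
              have : g⁻¹ * (φ ^ p) (h1⁻¹ * h2) * g = a1⁻¹ * a2 := by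
                rw [ha1, ha2, map_mul, map_inv]; group
              rw [this, ha, ofL_inv, hdd]
            rw [h13, show d0 = lb d by rw [hdd, lb_lb]] at h12
            exact (hd_lb_mul _ _).1 h12 e2
        exact ⟨h1, h2, hn1, hn2, hne, key h1 h2 hn1 hn2 hne e1 e2,
          key h2 h1 hn2 hn1 hne.symm e2 e1⟩
  obtain ⟨g, hg, hgb⟩ := hbase _ 1 hW1 rfl
  let θ : FreeGroup (Fin n) →* FreeGroup (Fin n) := (MulAut.conj g⁻¹).toMonoidHom.comp (φ ^ p : Monoid.End _)
  have hθ : ∀ k, θ k = g⁻¹ * (φ ^ p) k * g := by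
    intro k
    change g⁻¹ * (φ ^ p) k * g⁻¹⁻¹ = _
    rw [inv_inv]
  refine A0 hn θ ?_ (2 * R + 1) (by omega) ?_ V (fun i => g⁻¹ * (uu φ (u i) p)⁻¹) D hD2 ?_ ?_
  · intro x y h
    rw [hθ, hθ] at h
    exact hφp (by simpa using h)
  · simpa only [hθ] using hgb
  · intro i hi d hd1
    obtain ⟨h1, _, hn1, _, _, e1, _⟩ := hg i hi d hd1
    refine ⟨h1, by rw [mem_ball]; omega, ?_⟩
    rw [← e1, P, hθ]; congr 1; group
  · intro i hi j hj hne b hb h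
    refine hcolp i hi j hj hne b hb ?_
    rw [hθ] at h
    have : (uu φ (u i) p)⁻¹ = (φ ^ p) b * (uu φ (u j) p)⁻¹ := by
      have : g⁻¹ * (uu φ (u i) p)⁻¹ = g⁻¹ * ((φ ^ p) b * (uu φ (u j) p)⁻¹) := by
        rw [h]; group
      exact mul_left_cancel this
    calc uu φ (u i) p * (φ ^ p) b = uu φ (u i) p * ((φ ^ p) b * (uu φ (u j) p)⁻¹) * uu φ (u j) p := by group
      _ = _ := by rw [← this]; group
end IdxSum

namespace IdxSum
open Finset

variable {n : ℕ}

/-- ends of the tree as direction fields -/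
def IsEnd (ξ : FreeGroup (Fin n) → Fin n × Bool) : Prop :=
  ∀ z d, ξ (z * ofL d) = lb d ↔ ξ z ≠ d

/-- translate of an end -/
def tr (g : FreeGroup (Fin n)) (ξ : FreeGroup (Fin n) → Fin n × Bool) :
    FreeGroup (Fin n) → Fin n × Bool := fun z => ξ (g⁻¹ * z)

theorem tr_apply (g : FreeGroup (Fin n)) (ξ : FreeGroup (Fin n) → Fin n × Bool) (z) :
    tr g ξ (g * z) = ξ z := by simp [tr]

theorem tr_tr (g h : FreeGroup (Fin n)) (ξ : FreeGroup (Fin n) → Fin n × Bool) :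
    tr g (tr h ξ) = tr (g * h) ξ := by
  funext z; simp [tr, mul_assoc]

theorem tr_one (ξ : FreeGroup (Fin n) → Fin n × Bool) : tr 1 ξ = ξ := by
  funext z; simp [tr]

theorem IsEnd.tr {ξ : FreeGroup (Fin n) → Fin n × Bool} (h : IsEnd ξ) (g : FreeGroup (Fin n)) :
    IsEnd (tr g ξ) := by
  intro z d
  have := h (g⁻¹ * z) d
  rwa [mul_assoc] at this

/-- one step towards the end -/
def st (ξ : FreeGroup (Fin n) → Fin n × Bool) (z : FreeGroup (Fin n)) : FreeGroup (Fin n) :=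
  z * ofL (ξ z)

/-- ray towards the end -/
def ray (ξ : FreeGroup (Fin n) → Fin n × Bool) (x : FreeGroup (Fin n)) (t : ℕ) :
    FreeGroup (Fin n) := (st ξ)^[t] x

theorem ray_zero (ξ : FreeGroup (Fin n) → Fin n × Bool) (x) : ray ξ x 0 = x := rfl

theorem ray_succ (ξ : FreeGroup (Fin n) → Fin n × Bool) (x) (t : ℕ) :
    ray ξ x (t + 1) = ray ξ x t * ofL (ξ (ray ξ x t)) := by
  unfold ray; rw [Function.iterate_succ_apply']; rfl

theorem ray_succ' (ξ : FreeGroup (Fin n) → Fin n × Bool) (x) (t : ℕ) :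
    ray ξ x (t + 1) = ray ξ (st ξ x) t := by
  unfold ray; rw [Function.iterate_succ_apply]

theorem ray_add (ξ : FreeGroup (Fin n) → Fin n × Bool) (x) (s t : ℕ) :
    ray ξ x (s + t) = ray ξ (ray ξ x s) t := by
  unfold ray; rw [add_comm, Function.iterate_add_apply]

theorem ray_tr (g : FreeGroup (Fin n)) (ξ : FreeGroup (Fin n) → Fin n × Bool) (x) (t : ℕ) :
    ray (tr g ξ) (g * x) t = g * ray ξ x t := by
  induction t with
  | zero => rfl
  | succ t ih => rw [ray_succ, ray_succ, ih, tr_apply, mul_assoc]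

section
variable {ξ : FreeGroup (Fin n) → Fin n × Bool}

theorem IsEnd.st_ne (hξ : IsEnd ξ) (z : FreeGroup (Fin n)) : ξ (st ξ z) ≠ lb (ξ z) := by
  intro h; exact (hξ z (ξ z)).1 h rfl

theorem IsEnd.st_back (hξ : IsEnd ξ) {z : FreeGroup (Fin n)} {d : Fin n × Bool} (h : ξ z ≠ d) :
    st ξ (z * ofL d) = z := by
  rw [st, (hξ z d).2 h, mul_ofL_lb]

theorem IsEnd.conf (hξ : IsEnd ξ) (x z : FreeGroup (Fin n)) : ∃ i j, ray ξ z i = ray ξ x j := by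
  refine path_ind x (p := fun z => ∃ i j, ray ξ z i = ray ξ x j) ⟨0, 0, rfl⟩ ?_ z
  rintro z d _ ⟨i, j, h⟩
  by_cases hd : ξ z = d
  · refine ⟨i + 1, j, ?_⟩
    rw [ray_succ', st, hd]; exact h
  · have hb := hξ.st_back hd
    cases i with
    | zero =>
      refine ⟨0, j + 1, ?_⟩
      rw [ray_succ, ← h]
      change z = st ξ (z * ofL d)
      exact hb.symm
    | succ i => exact ⟨i, j, by rw [ray_succ', hb] at h; exact h⟩

theorem IsEnd.S_mono (hξ : IsEnd ξ) {x y : FreeGroup (Fin n)} (h : P y (st ξ x) = some (ξ (st ξ x))) :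
    P y x = some (ξ x) := by
  by_contra hc
  have := (P_ax y x (ξ x)).2 hc
  change P y (st ξ x) = _ at this
  rw [h] at this
  exact hξ.st_ne x (by simpa using this)

theorem IsEnd.S_ray (hξ : IsEnd ξ) {x y : FreeGroup (Fin n)} (t : ℕ) (h : P y (ray ξ x t) = some (ξ (ray ξ x t))) :
    P y x = some (ξ x) := by
  induction t generalizing x with
  | zero => exact h
  | succ t ih => rw [ray_succ'] at h; exact hξ.S_mono (ih h)

theorem IsEnd.S_ray_le (hξ : IsEnd ξ) {x y : FreeGroup (Fin n)} {s t : ℕ} (hst : s ≤ t)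
    (h : P y (ray ξ x t) = some (ξ (ray ξ x t))) :
    P y (ray ξ x s) = some (ξ (ray ξ x s)) := by
  obtain ⟨k, rfl⟩ := Nat.exists_eq_add_of_le hst
  rw [ray_add] at h
  exact hξ.S_ray k h

theorem IsEnd.P_ray (hξ : IsEnd ξ) (x : FreeGroup (Fin n)) {s t : ℕ} (hst : s < t) :
    P (ray ξ x t) (ray ξ x s) = some (ξ (ray ξ x s)) := by
  obtain ⟨k, rfl⟩ := Nat.exists_eq_add_of_lt hst
  refine hξ.S_ray_le (t := s + k) (by omega) ?_
  rw [ray_succ, P_nb]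

theorem IsEnd.eventually (hξ : IsEnd ξ) (x z : FreeGroup (Fin n)) :
    ∃ T, ∀ t, T ≤ t → P (ray ξ x t) z = some (ξ z) := by
  obtain ⟨i, j, h⟩ := hξ.conf x z
  refine ⟨j + 1, fun t ht => ?_⟩
  have := hξ.P_ray x (show j < t by omega)
  rw [← h] at this
  exact hξ.S_ray i this

theorem IsEnd.L1 (hξ : IsEnd ξ) {y z : FreeGroup (Fin n)} (hne : z ≠ y) (h : P y z ≠ some (ξ z)) :
    P z y = some (ξ y) := by
  obtain ⟨T, hT⟩ := hξ.eventually z z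
  obtain ⟨T', hT'⟩ := hξ.eventually z y
  have h1 := hT (T + T') (by omega)
  have h2 := hT' (T + T') (by omega)
  rw [← h2]
  symm
  apply IdxSum.L1 hne
  rw [h1]; exact h.symm

theorem IsEnd.td_ray (hξ : IsEnd ξ) (x : FreeGroup (Fin n)) (t : ℕ) : td (ray ξ x t) x = t := by
  induction t with
  | zero => exact td_eq_zero.2 rfl
  | succ t ih =>
    rw [td_comm, ray_succ, td_step', td_comm, ih]
    cases t with
    | zero => rw [ray_zero, P_self]; simp
    | succ t =>
      intro h
      have h1 : P x (ray ξ x t) = some (ξ (ray ξ x t)) := by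
        rw [ray_succ] at h
        exact hξ.S_mono h
      have h2 := hξ.S_ray t h1
      rw [P_self] at h2; cases h2

theorem IsEnd.ray_back (hξ : IsEnd ξ) (x : FreeGroup (Fin n)) (t : ℕ) :
    P x (ray ξ x t) ≠ some (ξ (ray ξ x t)) := by
  intro h
  have h2 := hξ.S_ray t h
  rw [P_self] at h2; cases h2

theorem IsEnd.ray_inj (hξ : IsEnd ξ) (x : FreeGroup (Fin n)) : Function.Injective (ray ξ x) := by
  intro s t h
  rw [← hξ.td_ray x s, h, hξ.td_ray]

theorem IsEnd.ext_ray (hξ : IsEnd ξ) {η : FreeGroup (Fin n) → Fin n × Bool} (hη : IsEnd η) (x : FreeGroup (Fin n))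
    (h : ∀ t, η (ray ξ x t) = ξ (ray ξ x t)) : η = ξ := by
  have hr : ∀ t, ray η x t = ray ξ x t := by
    intro t
    induction t with
    | zero => rfl
    | succ t ih => rw [ray_succ, ray_succ, ih, h]
  funext z
  obtain ⟨T, hT⟩ := hξ.eventually x z
  obtain ⟨T', hT'⟩ := hη.eventually x z
  have h1 := hT (T + T') (by omega)
  have h2 := hT' (T + T') (by omega)
  rw [hr, h1] at h2
  exact (by simpa using h2.symm)
end

/-- a nonbacktracking sequence defines an end -/
theorem exists_end (b : ℕ → FreeGroup (Fin n)) (d : ℕ → Fin n × Bool)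
    (hb : ∀ t, b (t + 1) = b t * ofL (d t)) (hd : ∀ t, d (t + 1) ≠ lb (d t)) :
    ∃ ξ, IsEnd ξ ∧ (∀ t, ξ (b t) = d t) ∧ (∀ t, ray ξ (b 0) t = b t) := by
  have h1 : ∀ k m, P (b (m + k + 1)) (b m) = some (d m) := by
    intro k
    induction k with
    | zero => intro m; rw [add_zero, hb, P_nb]
    | succ k ih =>
      intro m
      have := ih (m + 1)
      by_contra hc
      have h2 := (P_ax _ _ _).2 hc
      rw [← hb, show m + (k + 1) + 1 = m + 1 + k + 1 by ring, this] at h2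
      exact hd m (by simpa using h2)
  have h2 : ∀ {m t}, m < t → P (b t) (b m) = some (d m) := by
    intro m t h
    obtain ⟨k, rfl⟩ := Nat.exists_eq_add_of_lt h
    exact h1 k m
  have hinj : ∀ {m t}, m < t → b t ≠ b m := by
    intro m t h e
    have := h2 h
    rw [e, P_self] at this; cases this
  have h3 : ∀ z, ∃ e T, ∀ t, T ≤ t → P (b t) z = some e := by
    intro z
    obtain ⟨T, hT⟩ : ∃ T, ∀ t, T ≤ t → b t ≠ z := by
      by_cases hz : ∃ s, b s = z
      · obtain ⟨s, rfl⟩ := hz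
        exact ⟨s + 1, fun t ht => hinj (by omega)⟩
      · push Not at hz; exact ⟨0, fun t _ => hz t⟩
    obtain ⟨e, he⟩ := P_ex (hT T le_rfl)
    refine ⟨e, T, fun t ht => ?_⟩
    induction t, ht using Nat.le_induction with
    | base => exact he
    | succ t ht ih =>
      rw [hb, P_nbr (hT t ht), ih]
      rw [← hb]; exact hT _ (by omega)
  choose ξ T hT using h3
  have hv : ∀ t, ξ (b t) = d t := by
    intro t
    have e1 := hT (b t) (T (b t) + t + 1) (by omega)
    rw [h2 (by omega)] at e1
    simpa using e1.symm
  refine ⟨ξ, ?_, hv, ?_⟩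
  · intro z e
    have e1 := hT z (T z + T (z * ofL e)) (by omega)
    have e2 := hT (z * ofL e) (T z + T (z * ofL e)) (by omega)
    have := P_ax (b (T z + T (z * ofL e))) z e
    rw [e1, e2] at this
    simpa using this
  · intro t
    induction t with
    | zero => rfl
    | succ t ih => rw [ray_succ, ih, hv, hb]
end IdxSum

namespace IdxSum
open Finset

variable {n : ℕ}

theorem exists_rep (Q : Subgroup (FreeGroup (Fin n))) :
    ∃ rep : FreeGroup (Fin n) → FreeGroup (Fin n), (∀ z, rep z * z⁻¹ ∈ Q) ∧
      ∀ q ∈ Q, ∀ z, rep (q * z) = rep z := by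
  classical
  let r := QuotientGroup.rightRel Q
  refine ⟨fun z => (Quotient.mk r z).out, fun z => ?_, fun q hq z => ?_⟩
  · have := Quotient.mk_out (s := r) z
    have h2 := (QuotientGroup.rightRel_apply (s := Q)).1 this
    have h3 := Q.inv_mem h2
    rwa [mul_inv_rev, inv_inv] at h3
  · have : Quotient.mk r (q * z) = Quotient.mk r z := by
      apply Quotient.sound
      apply (QuotientGroup.rightRel_apply (s := Q)).2
      rw [mul_inv_rev, mul_inv_cancel_left]
      exact Q.inv_mem hq
    simp only [this]

section
variable {Q : Subgroup (FreeGroup (Fin n))} {rep : FreeGroup (Fin n) → FreeGroup (Fin n)}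

theorem rep_ex (h1 : ∀ z, rep z * z⁻¹ ∈ Q) (z) : ∃ q ∈ Q, rep z = q * z :=
  ⟨_, h1 z, by simp⟩

theorem rep_rep (h1 : ∀ z, rep z * z⁻¹ ∈ Q) (h2 : ∀ q ∈ Q, ∀ z, rep (q * z) = rep z) (z) :
    rep (rep z) = rep z := by
  obtain ⟨q, hq, h⟩ := rep_ex h1 z
  conv_lhs => rw [h]
  exact h2 q hq z

theorem rep_eq (h1 : ∀ z, rep z * z⁻¹ ∈ Q) {x y} (h : rep x = rep y) : ∃ q ∈ Q, y = q * x := by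
  obtain ⟨q, hq, e⟩ := rep_ex h1 x
  obtain ⟨q', hq', e'⟩ := rep_ex h1 y
  refine ⟨q'⁻¹ * q, Q.mul_mem (Q.inv_mem hq') hq, ?_⟩
  rw [mul_assoc, ← e, h, e', inv_mul_cancel_left]

theorem Conv.const {W : Set (FreeGroup (Fin n))} (hW : Conv W) {α : Type*} (s : FreeGroup (Fin n) → α)
    (hs : ∀ z ∈ W, ∀ d, z * ofL d ∈ W → s (z * ofL d) = s z) {y z} (hy : y ∈ W) (hz : z ∈ W) :
    s z = s y := by
  revert hz
  refine path_ind y (p := fun z => z ∈ W → s z = s y) (fun _ => rfl) ?_ z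
  intro z d h ih hz
  have := hW z hz y hy d h
  rw [← ih this, hs z hz d this]

open Classical in
theorem B1 (h1 : ∀ z, rep z * z⁻¹ ∈ Q) (h2 : ∀ q ∈ Q, ∀ z, rep (q * z) = rep z)
    {κ : Type*} (b : FreeGroupBasis κ Q) (T : Finset κ) (W : Finset (FreeGroup (Fin n)))
    (hW : Conv (W : Set (FreeGroup (Fin n)))) (z0) (hz0 : z0 ∈ W)
    (hT : ∀ τ ∈ T, (b τ : FreeGroup (Fin n)) * z0 ∈ W) :
    2 * #T + 2 * #(W.image rep) ≤
      #((W.image rep ×ˢ (univ : Finset (Fin n × Bool))).filter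
        (fun e => rep (e.1 * ofL e.2) ∈ W.image rep)) + 2 := by
  set V := W.image rep with hV
  have hrW : ∀ z ∈ W, rep z ∈ V := fun z hz => mem_image_of_mem _ hz
  have hVr : ∀ v ∈ V, rep v = v := by
    intro v hv
    obtain ⟨z, _, rfl⟩ := mem_image.1 hv
    exact rep_rep h1 h2 z
  set E := (V ×ˢ (univ : Finset (Fin n))).filter (fun e => rep (e.1 * ofL (e.2, true)) ∈ V) with hE
  have hcard : 2 * #E ≤ #((V ×ˢ (univ : Finset (Fin n × Bool))).filter
        (fun e => rep (e.1 * ofL e.2) ∈ V)) := by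
    have e1 : #(E.image (fun e : FreeGroup (Fin n) × Fin n => (e.1, ((e.2, true) : Fin n × Bool)))) = #E := by
      apply card_image_of_injective
      rintro ⟨a, i⟩ ⟨a', i'⟩ h
      simpa using h
    have e2 : #(E.image (fun e : FreeGroup (Fin n) × Fin n =>
        (rep (e.1 * ofL (e.2, true)), ((e.2, false) : Fin n × Bool)))) = #E := by
      apply card_image_of_injOn
      rintro ⟨a, i⟩ ha ⟨a', i'⟩ ha' h
      simp only [Prod.mk.injEq, and_true] at h
      obtain ⟨h, rfl⟩ := h
      obtain ⟨q, hq, e⟩ := rep_eq h1 h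
      rw [← mul_assoc] at e
      have e := mul_right_cancel e
      rw [hE, mem_coe, mem_filter, mem_product] at ha ha'
      have : rep a' = rep a := by rw [e]; exact h2 q hq a
      rw [hVr _ ha.1.1, hVr _ ha'.1.1] at this
      exact Prod.ext this.symm rfl
    rw [two_mul]
    nth_rewrite 1 [← e1]
    rw [← e2, ← card_union_of_disjoint]
    · apply card_le_card
      intro x hx
      rw [mem_union, mem_image, mem_image] at hx
      rw [mem_filter, mem_product]
      rcases hx with ⟨e, he, rfl⟩ | ⟨e, he, rfl⟩
      · rw [hE, mem_filter, mem_product] at he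
        exact ⟨⟨he.1.1, mem_univ _⟩, he.2⟩
      · rw [hE, mem_filter, mem_product] at he
        refine ⟨⟨he.2, mem_univ _⟩, ?_⟩
        obtain ⟨q, hq, e'⟩ := rep_ex h1 (e.1 * ofL (e.2, true))
        have : rep (e.1 * ofL (e.2, true)) * ofL (e.2, false) = q * e.1 := by
          rw [e', mul_assoc, mul_assoc]
          have := ofL_mul_lb ((e.2, true) : Fin n × Bool)
          simp only [lb, Bool.not_true] at this
          rw [this, mul_one]
        simp only [this]
        rw [h2 q hq, hVr _ he.1.1]
        exact he.1.1
    · rw [disjoint_left]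
      intro x hx hx'
      rw [mem_image] at hx hx'
      obtain ⟨e, _, rfl⟩ := hx
      obtain ⟨e', _, h⟩ := hx'
      simp at h
  refine le_trans ?_ (Nat.add_le_add_right hcard 2)
  have hc0 : rep z0 ∈ V := hrW _ hz0
  let χ : κ → (Q →* Multiplicative ℚ) := fun τ =>
    b.lift (fun k => Multiplicative.ofAdd (if k = τ then (1:ℚ) else 0))
  have hrep' : ∀ z, z * (rep z)⁻¹ ∈ Q := fun z => by
    have := Q.inv_mem (h1 z)
    rwa [mul_inv_rev, inv_inv] at this
  let c : κ → FreeGroup (Fin n) → ℚ := fun τ z => Multiplicative.toAdd (χ τ ⟨z * (rep z)⁻¹, hrep' z⟩)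
  have hcq : ∀ τ (q : Q) z, c τ (q * z) = c τ z + Multiplicative.toAdd (χ τ q) := by
    intro τ q z
    simp only [c]
    have : (⟨q * z * (rep (q * z))⁻¹, hrep' (q * z)⟩ : Q) = q * ⟨z * (rep z)⁻¹, hrep' z⟩ := by
      ext
      simp [h2 q q.2 z, mul_assoc]
    rw [this, map_mul, toAdd_mul, add_comm]
  let S : (T → ℚ) → ({v // v ∈ V.erase (rep z0)} → ℚ) → FreeGroup (Fin n) → ℚ := fun a bb z =>
    ∑ τ, a τ * c τ z + ∑ w, bb w * (if w.1 = rep z then (1:ℚ) else 0)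
  have hSq : ∀ a bb (q : Q) z, S a bb (q * z) = S a bb z + ∑ τ, a τ * Multiplicative.toAdd (χ τ q) := by
    intro a bb q z
    simp only [S, hcq, h2 q q.2 z, mul_add, sum_add_distrib]
    ring
  let f : ((T → ℚ) × ({v // v ∈ V.erase (rep z0)} → ℚ)) →ₗ[ℚ] ({e // e ∈ E} → ℚ) :=
    { toFun := fun p e => S p.1 p.2 (e.1.1 * ofL (e.1.2, true)) - S p.1 p.2 e.1.1
      map_add' := by
        intro p p'; funext e
        simp only [S, Prod.fst_add, Prod.snd_add, Pi.add_apply, add_mul, sum_add_distrib]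
        ring
      map_smul' := by
        intro r p; funext e
        simp only [S, Prod.smul_fst, Prod.smul_snd, Pi.smul_apply, smul_eq_mul, mul_assoc, ← mul_sum,
          RingHom.id_apply]
        ring }
  have hinj : Function.Injective f := by
    rw [← LinearMap.ker_eq_bot, LinearMap.ker_eq_bot']
    rintro ⟨a, bb⟩ h0
    have hpos : ∀ z ∈ W, ∀ i, z * ofL (i, true) ∈ W → S a bb (z * ofL (i, true)) = S a bb z := by
      intro z hz i hzi
      obtain ⟨q, hq, e⟩ := rep_ex h1 z
      have hmem : (rep z, i) ∈ E := by
        rw [hE, mem_filter, mem_product]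
        refine ⟨⟨hrW z hz, mem_univ _⟩, ?_⟩
        simp only
        rw [e, mul_assoc, h2 q hq]
        exact hrW _ hzi
      have := congrFun h0 ⟨_, hmem⟩
      change S a bb (rep z * ofL (i, true)) - S a bb (rep z) = 0 at this
      rw [e, mul_assoc, hSq a bb ⟨q, hq⟩, hSq a bb ⟨q, hq⟩] at this
      linarith
    have hconst : ∀ z ∈ W, S a bb z = S a bb z0 := by
      intro z hz
      refine hW.const (S a bb) ?_ hz0 hz
      rintro z hz ⟨i, _ | _⟩ hzd
      · have := hpos _ hzd i (by
          have := mul_ofL_lb z ((i, false) : Fin n × Bool)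
          simp only [lb, Bool.not_false] at this
          rwa [this])
        have h3 := mul_ofL_lb z ((i, false) : Fin n × Bool)
        simp only [lb, Bool.not_false] at h3
        rw [h3] at this
        exact this.symm
      · exact hpos z hz i hzd
    have ha : a = 0 := by
      funext τ
      have := hconst _ (hT τ.1 τ.2)
      rw [hSq a bb (b τ)] at this
      have h4 : ∑ τ' : T, a τ' * Multiplicative.toAdd (χ τ' (b τ)) = a τ := by
        rw [Finset.sum_eq_single τ]
        · simp [χ]
        · intro τ' _ hne
          have : (τ : κ) ≠ τ' := fun h => hne (Subtype.ext h.symm)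
          simp [χ, this]
        · simp
      rw [h4] at this
      simpa using this
    have hb : bb = 0 := by
      funext w
      obtain ⟨z, hz, e⟩ := mem_image.1 (mem_of_mem_erase w.2)
      have := hconst z hz
      simp only [S, ha, Pi.zero_apply, zero_mul, sum_const_zero, zero_add] at this
      rw [Finset.sum_eq_single w, Finset.sum_eq_zero] at this
      · simpa [e] using this
      · intro w' _
        have : w'.1 ≠ rep z0 := ne_of_mem_erase w'.2
        simp [this]
      · intro w' _ hne
        have : w'.1 ≠ rep z := by rw [e]; exact fun h => hne (Subtype.ext h)
        simp [this]
      · simp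
    rw [ha, hb]; rfl
  have := LinearMap.finrank_le_finrank_of_injective hinj
  simp only [Module.finrank_prod, Module.finrank_fintype_fun_eq_card, Fintype.card_coe,
    card_erase_of_mem hc0] at this
  have : 1 ≤ #V := card_pos.2 ⟨_, hc0⟩
  omega
end
end IdxSum

namespace IdxSum
open Finset

variable {n : ℕ}

open Classical in
/-- directions at `z` occupied by the family of ends -/
noncomputable def DD (Λ : Set (FreeGroup (Fin n) → Fin n × Bool)) (z : FreeGroup (Fin n)) :
    Finset (Fin n × Bool) := univ.filter (fun d => ∃ ξ ∈ Λ, ξ z = d)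

theorem mem_DD {Λ : Set (FreeGroup (Fin n) → Fin n × Bool)} {z : FreeGroup (Fin n)} {d} :
    d ∈ DD Λ z ↔ ∃ ξ ∈ Λ, ξ z = d := by simp [DD]

theorem DD_smul {Λ : Set (FreeGroup (Fin n) → Fin n × Bool)} {Q : Subgroup (FreeGroup (Fin n))}
    (hQ : ∀ q ∈ Q, ∀ ξ ∈ Λ, tr q ξ ∈ Λ) {q} (hq : q ∈ Q) (z) : DD Λ (q * z) = DD Λ z := by
  ext d
  rw [mem_DD, mem_DD]
  constructor
  · rintro ⟨ξ, hξ, rfl⟩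
    exact ⟨_, hQ _ (Q.inv_mem hq) ξ hξ, by simp [tr]⟩
  · rintro ⟨ξ, hξ, rfl⟩
    exact ⟨_, hQ _ hq ξ hξ, by simp [tr]⟩

theorem DD_toward {Λ : Set (FreeGroup (Fin n) → Fin n × Bool)} (hΛ : ∀ ξ ∈ Λ, IsEnd ξ)
    {y z : FreeGroup (Fin n)} (hz : 2 ≤ #(DD Λ z)) {d} (h : P z y = some d) : d ∈ DD Λ y := by
  have hne : z ≠ y := by rintro rfl; rw [P_self] at h; cases h
  obtain ⟨d1, h1, d2, h2, h12⟩ := one_lt_card.1 hz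
  obtain ⟨ξ1, hξ1, e1⟩ := mem_DD.1 h1
  obtain ⟨ξ2, hξ2, e2⟩ := mem_DD.1 h2
  rw [mem_DD]
  by_cases hc : P y z = some d1
  · refine ⟨ξ2, hξ2, ?_⟩
    have := (hΛ _ hξ2).L1 hne (by rw [hc, e2]; simpa using h12)
    rw [h] at this; exact (Option.some.inj this).symm
  · refine ⟨ξ1, hξ1, ?_⟩
    have := (hΛ _ hξ1).L1 hne (by rw [e1]; exact hc)
    rw [h] at this; exact (Option.some.inj this).symm

open Classical in
theorem B (Q : Subgroup (FreeGroup (Fin n))) (Λ : Set (FreeGroup (Fin n) → Fin n × Bool))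
    (hΛ : ∀ ξ ∈ Λ, IsEnd ξ) (hQ : ∀ q ∈ Q, ∀ ξ ∈ Λ, tr q ξ ∈ Λ) {ι : Type*} [Fintype ι]
    (l : ι → FreeGroup (Fin n) → Fin n × Bool) (hl : ∀ i, l i ∈ Λ)
    (hne : ∀ i j, i ≠ j → ∀ q ∈ Q, tr q (l i) ≠ l j)
    (hfr : ∀ i x z, {t | ∃ q ∈ Q, ray (l i) x t = q * z}.Finite) (M : ℤ)
    (hM : ∀ Z : Finset (FreeGroup (Fin n)), (∀ z ∈ Z, ∀ z' ∈ Z, z ≠ z' → ∀ q ∈ Q, z' ≠ q * z) →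
      (∀ z ∈ Z, 2 ≤ #(DD Λ z)) → ∑ z ∈ Z, ((#(DD Λ z) : ℤ) - 2) ≤ M)
    (z0) (h0 : 2 ≤ #(DD Λ z0)) {κ : Type*} (b : FreeGroupBasis κ Q) (T : Finset κ) :
    2 * (#T : ℤ) - 2 + Fintype.card ι ≤ M := by
  obtain ⟨rep, h1, h2⟩ := exists_rep Q
  -- maximal set of branch vertices
  obtain ⟨Z, hZ1, hZ2, hZ3⟩ : ∃ Z : Finset (FreeGroup (Fin n)),
      (∀ z ∈ Z, ∀ z' ∈ Z, z ≠ z' → ∀ q ∈ Q, z' ≠ q * z) ∧ (∀ z ∈ Z, 3 ≤ #(DD Λ z)) ∧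
      ∀ z, 3 ≤ #(DD Λ z) → ∃ q ∈ Q, ∃ z' ∈ Z, z = q * z' := by
    let good : Finset (FreeGroup (Fin n)) → Prop := fun Z =>
      (∀ z ∈ Z, ∀ z' ∈ Z, z ≠ z' → ∀ q ∈ Q, z' ≠ q * z) ∧ (∀ z ∈ Z, 3 ≤ #(DD Λ z))
    have hb : ∀ Z, good Z → #Z ≤ M.toNat := by
      intro Z hZ
      have := hM Z hZ.1 (fun z hz => le_trans (by norm_num) (hZ.2 z hz))
      have h3 : ∑ z ∈ Z, (1 : ℤ) ≤ ∑ z ∈ Z, ((#(DD Λ z) : ℤ) - 2) :=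
        sum_le_sum (fun z hz => by have := hZ.2 z hz; omega)
      simp only [sum_const, nsmul_eq_mul, mul_one] at h3
      omega
    let A : Set ℕ := {k | ∃ Z, good Z ∧ #Z = k}
    have hA : BddAbove A := ⟨M.toNat, by rintro k ⟨Z, hZ, rfl⟩; exact hb Z hZ⟩
    have hA0 : A.Nonempty := ⟨0, ∅, ⟨by simp, by simp⟩, rfl⟩
    obtain ⟨Z, hZ, hk⟩ := Nat.sSup_mem hA0 hA
    refine ⟨Z, hZ.1, hZ.2, ?_⟩
    intro z hz
    by_contra hcon
    push Not at hcon
    have hzZ : z ∉ Z := fun h => hcon 1 Q.one_mem z h (by simp)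
    have hg : good (insert z Z) := by
      refine ⟨?_, ?_⟩
      · intro a ha a' ha' haa q hq e
        rcases mem_insert.1 ha with h3 | ha <;> rcases mem_insert.1 ha' with h4 | ha'
        · exact haa (h3.trans h4.symm)
        · exact hcon q⁻¹ (Q.inv_mem hq) a' ha' (by rw [e, h3]; simp)
        · exact hcon q hq a ha (by rw [← h4]; exact e)
        · exact hZ.1 a ha a' ha' haa q hq e
      · intro a ha
        rcases mem_insert.1 ha with rfl | ha
        · exact hz
        · exact hZ.2 a ha
    have : #(insert z Z) ≤ sSup A := le_csSup hA ⟨_, hg, rfl⟩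
    rw [card_insert_of_notMem hzZ] at this
    omega
  let Y : Finset (FreeGroup (Fin n)) := insert z0 (T.image (fun τ => (b τ : FreeGroup (Fin n)) * z0) ∪ Z)
  have hYH : ∀ y ∈ Y, 2 ≤ #(DD Λ y) := by
    intro y hy
    rcases mem_insert.1 hy with rfl | hy
    · exact h0
    rcases mem_union.1 hy with hy | hy
    · obtain ⟨τ, _, rfl⟩ := mem_image.1 hy
      rw [DD_smul hQ (b τ).2]; exact h0
    · exact le_trans (by norm_num) (hZ2 y hy)
  have hz0Y : z0 ∈ Y := mem_insert_self _ _
  have hfin := hull_finite (Y := (Y : Set (FreeGroup (Fin n)))) Y.finite_toSet ⟨z0, hz0Y⟩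
  let W := hfin.toFinset
  have hWs : (W : Set (FreeGroup (Fin n))) = hull Y := hfin.coe_toFinset
  have hW : Conv (W : Set (FreeGroup (Fin n))) := by rw [hWs]; exact hull_conv _
  have hYW : ∀ y ∈ Y, y ∈ W := fun y hy => hfin.mem_toFinset.2 (subset_hull _ hy)
  have hWH : ∀ z ∈ W, 2 ≤ #(DD Λ z) := by
    intro z hz
    by_cases hzY : z ∈ Y
    · exact hYH z hzY
    have hz := hfin.mem_toFinset.1 hz
    have hne0 : ∀ y ∈ Y, y ≠ z := fun y hy e => hzY (e ▸ hy)
    obtain ⟨d1, hd1⟩ := P_ex (hne0 z0 hz0Y)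
    obtain ⟨y2, hy2, hd2⟩ := hz (some d1) (by simp)
    obtain ⟨d2, hd2'⟩ := P_ex (hne0 y2 hy2)
    apply one_lt_card.2
    refine ⟨d1, DD_toward hΛ h0 hd1, d2, DD_toward hΛ (hYH y2 hy2) hd2', ?_⟩
    rintro rfl
    exact hd2 hd2'
  have hB1 := B1 h1 h2 b T W hW z0 (hYW _ hz0Y)
    (fun τ hτ => hYW _ (mem_insert_of_mem (mem_union_left _ (mem_image_of_mem _ hτ))))
  set V := W.image rep with hV
  have hVr : ∀ v ∈ V, rep v = v := by
    intro v hv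
    obtain ⟨z, _, rfl⟩ := mem_image.1 hv
    exact rep_rep h1 h2 z
  have hrD : ∀ z, DD Λ (rep z) = DD Λ z := by
    intro z
    obtain ⟨q, hq, e⟩ := rep_ex h1 z
    rw [e, DD_smul hQ hq]
  have hQWH : ∀ z, rep z ∈ V → 2 ≤ #(DD Λ z) := by
    intro z hz
    obtain ⟨w, hw, e⟩ := mem_image.1 hz
    rw [← hrD, ← e, hrD]; exact hWH w hw
  have hout : ∀ z, rep z ∉ V → #(DD Λ z) ≤ 2 := by
    intro z hz
    by_contra hcon
    push Not at hcon
    obtain ⟨q, hq, z', hz', rfl⟩ := hZ3 z hcon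
    apply hz
    rw [h2 q hq]
    exact mem_image_of_mem _ (hYW _ (mem_insert_of_mem (mem_union_right _ hz')))
  -- exits
  have hexit : ∀ i, ∃ x, rep x ∈ V ∧ ∀ t, rep (ray (l i) x (t + 1)) ∉ V := by
    intro i
    have hf : {t | rep (ray (l i) z0 t) ∈ V}.Finite := by
      have : {t | rep (ray (l i) z0 t) ∈ V} ⊆ ⋃ w ∈ W, {t | ∃ q ∈ Q, ray (l i) z0 t = q * w} := by
        intro t ht
        obtain ⟨w, hw, e⟩ := mem_image.1 ht
        obtain ⟨q, hq, e'⟩ := rep_eq h1 e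
        exact Set.mem_biUnion hw ⟨q, hq, e'⟩
      exact (Set.Finite.biUnion W.finite_toSet (fun w _ => hfr i z0 w)).subset this
    have hmem0 : 0 ∈ hf.toFinset := by
      rw [hf.mem_toFinset]
      exact mem_image_of_mem _ (hYW _ hz0Y)
    let t0 := hf.toFinset.max' ⟨0, hmem0⟩
    have ht0 : t0 ∈ hf.toFinset := max'_mem _ _
    refine ⟨ray (l i) z0 t0, hf.mem_toFinset.1 ht0, ?_⟩
    intro t ht
    rw [← ray_add] at ht
    have := le_max' hf.toFinset _ (hf.mem_toFinset.2 ht)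
    change _ ≤ t0 at this
    omega
  choose X hX1 hX2 using hexit
  let ex : ι → FreeGroup (Fin n) × (Fin n × Bool) := fun i => (rep (X i), l i (X i))
  have hexinj : Function.Injective ex := by
    intro i j hij
    by_contra hne'
    simp only [ex, Prod.mk.injEq] at hij
    obtain ⟨q, hq, e⟩ := rep_eq h1 hij.1
    apply hne i j hne' q hq
    have hηΛ := hQ q hq _ (hl i)
    have hη := hΛ _ hηΛ
    have hj := hΛ _ (hl j)
    apply hj.ext_ray hη (X j)
    intro t
    induction t with
    | zero =>
      rw [ray_zero]
      conv_lhs => rw [e]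
      rw [tr_apply]; exact hij.2
    | succ t ih =>
      have hD := hout _ (hX2 j t)
      by_contra hcon
      set r := ray (l j) (X j) t with hr
      have hr' : ray (l j) (X j) (t+1) = st (l j) r := ray_succ _ _ _
      have hr'' : ray (l j) (X j) (t+1) = st (tr q (l i)) r := by rw [hr', st, st, ih]
      have hb1 : lb (l j r) ∈ DD Λ (ray (l j) (X j) (t+1)) := by
        apply DD_toward hΛ (hQWH _ (hX1 j))
        rw [ray_succ, P_ax]
        exact hj.ray_back _ _
      have n1 := hj.st_ne r
      have n2 := hη.st_ne r
      rw [← hr'] at n1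
      rw [← hr'', ih] at n2
      have : 2 < #(DD Λ (ray (l j) (X j) (t+1))) := by
        rw [two_lt_card]
        exact ⟨_, hb1, _, mem_DD.2 ⟨_, hl j, rfl⟩, _, mem_DD.2 ⟨_, hηΛ, rfl⟩,
          n1.symm, n2.symm, fun h => hcon h.symm⟩
      omega
  set DE := (V ×ˢ (univ : Finset (Fin n × Bool))).filter
        (fun e => rep (e.1 * ofL e.2) ∈ V) with hDE
  let All := (V ×ˢ (univ : Finset (Fin n × Bool))).filter (fun e => e.2 ∈ DD Λ e.1)
  have hall : #All = ∑ v ∈ V, #(DD Λ v) := by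
    have hd : All = V.biUnion (fun v => (DD Λ v).image (fun d => (v, d))) := by
      ext ⟨v, d⟩
      simp only [All, mem_filter, mem_product, mem_univ, and_true, mem_biUnion, mem_image,
        Prod.mk.injEq]
      constructor
      · rintro ⟨h, h'⟩; exact ⟨v, h, d, h', rfl, rfl⟩
      · rintro ⟨_, h, _, h', rfl, rfl⟩; exact ⟨h, h'⟩
    rw [hd, card_biUnion]
    · refine sum_congr rfl (fun v _ => card_image_of_injective _ (fun a b h => by simpa using h))
    · intro v _ v' _ hvv
      change Disjoint _ _
      rw [disjoint_left]
      intro x hx hx'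
      simp only [mem_image] at hx hx'
      obtain ⟨d, _, rfl⟩ := hx
      obtain ⟨d', _, h⟩ := hx'
      simp at h
      exact hvv h.1.symm
  have hsub : DE ∪ univ.image ex ⊆ All := by
    intro e he
    rcases mem_union.1 he with he | he
    · rw [hDE, mem_filter, mem_product] at he
      simp only [All, mem_filter, mem_product]
      refine ⟨he.1, ?_⟩
      exact DD_toward hΛ (hQWH _ he.2) (P_nb _ _)
    · obtain ⟨i, _, rfl⟩ := mem_image.1 he
      simp only [All, mem_filter, mem_product, ex]
      refine ⟨⟨hX1 i, mem_univ _⟩, ?_⟩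
      rw [hrD]
      exact mem_DD.2 ⟨_, hl i, rfl⟩
  have hdis : Disjoint DE (univ.image ex) := by
    rw [disjoint_left]
    intro e he he'
    obtain ⟨i, _, rfl⟩ := mem_image.1 he'
    rw [hDE, mem_filter] at he
    apply hX2 i 0
    have := he.2
    simp only [ex] at this
    obtain ⟨q, hq, e⟩ := rep_ex h1 (X i)
    rw [e, mul_assoc, h2 q hq] at this
    rwa [ray_succ, ray_zero]
  have hc := card_le_card hsub
  rw [card_union_of_disjoint hdis, card_image_of_injective _ hexinj, card_univ, hall] at hc
  have hMV := hM V (by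
    intro z hz z' hz' hzz q hq e
    apply hzz
    rw [← hVr z hz, ← hVr z' hz', e, h2 q hq]) (by
    intro z hz
    exact hQWH z (by rw [hVr z hz]; exact hz))
  rw [sum_sub_distrib] at hMV
  simp only [sum_const, nsmul_eq_mul] at hMV
  have hc' : ((#DE + Fintype.card ι : ℕ) : ℤ) ≤ ((∑ v ∈ V, #(DD Λ v) : ℕ) : ℤ) := by exact_mod_cast hc
  push_cast at hc'
  omega
end IdxSum

namespace IdxSum
open Finset

variable {n : ℕ}

/-- `y` lies in the half tree of depth `t` along the ray from `1` to `ξ` -/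
def In (ξ : FreeGroup (Fin n) → Fin n × Bool) (t : ℕ) (y : FreeGroup (Fin n)) : Prop :=
  P y (ray ξ 1 t) = some (ξ (ray ξ 1 t))

section
variable {ξ : FreeGroup (Fin n) → Fin n × Bool}

theorem IsEnd.In_mono (hξ : IsEnd ξ) {s t : ℕ} (hst : s ≤ t) {y} (h : In ξ t y) : In ξ s y :=
  hξ.S_ray_le hst h

theorem IsEnd.In_ray (hξ : IsEnd ξ) {s t : ℕ} (hst : s < t) : In ξ s (ray ξ 1 t) := hξ.P_ray 1 hst

theorem IsEnd.not_In_ray (hξ : IsEnd ξ) {s t : ℕ} (hst : t ≤ s) : ¬ In ξ s (ray ξ 1 t) := by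
  obtain ⟨k, rfl⟩ := Nat.exists_eq_add_of_le hst
  unfold In
  rw [ray_add]
  exact hξ.ray_back _ _

theorem IsEnd.In_td (hξ : IsEnd ξ) {i k : ℕ} {w} (h : In ξ (i + k) w) : k < td w (ray ξ 1 i) := by
  induction k generalizing i with
  | zero =>
    have := td_step h
    simp only [add_zero] at this; omega
  | succ k ih =>
    have h1 : In ξ ((i + 1) + k) w := by rwa [add_assoc, add_comm 1 k]
    have h2 := ih h1
    have h3 : In ξ i w := hξ.In_mono (by omega) h
    have := td_step h3
    rw [← ray_succ] at this
    omega

theorem IsEnd.In_near (hξ : IsEnd ξ) {i k : ℕ} {w w'} (h : In ξ (i + k) w) (hd : td w w' ≤ k) :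
    In ξ i w' := by
  by_contra hc
  have h1 : In ξ i w := hξ.In_mono (by omega) h
  have h2 := hξ.In_td h
  have := td_add (y1 := w) (y' := w') (y := ray ξ 1 i) (by
    intro e; apply hc; unfold In at h1 ⊢; rw [← e, h1])
  omega

theorem IsEnd.depth (hξ : IsEnd ξ) (y) : ∃ t, (∀ i < t, In ξ i y) ∧ ¬ In ξ t y := by
  classical
  have hex : ∃ t, ¬ In ξ t y := by
    refine ⟨td y 1, fun h => ?_⟩
    have h' : In ξ (0 + td y 1) y := by rwa [zero_add]
    have := hξ.In_td h'
    rw [ray_zero] at this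
    omega
  refine ⟨Nat.find hex, fun i hi => not_not.1 (Nat.find_min hex hi), Nat.find_spec hex⟩

theorem IsEnd.depth_back (hξ : IsEnd ξ) {y} {t} (h : ∀ i < t, In ξ i y) :
    y = ray ξ 1 t ∨ P y (ray ξ 1 t) ≠ P 1 (ray ξ 1 t) := by
  cases t with
  | zero =>
    by_cases hy : y = 1
    · left; exact hy
    · right; rw [ray_zero, P_self, Ne, P_none]; exact hy
  | succ t =>
    right
    have h1 : P y (ray ξ 1 (t+1)) ≠ some (lb (ξ (ray ξ 1 t))) := by
      rw [ray_succ, Ne, P_ax, not_not]; exact h t (by omega)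
    have h2 : P 1 (ray ξ 1 (t+1)) = some (lb (ξ (ray ξ 1 t))) := by
      rw [ray_succ, P_ax]
      exact hξ.ray_back 1 t
    rw [h2]; exact h1

theorem IsEnd.In_sub (hξ : IsEnd ξ) (z) : ∃ t, ∀ y, In ξ t y → P y z = some (ξ z) := by
  obtain ⟨i, j, h⟩ := hξ.conf 1 z
  refine ⟨j, fun y hy => ?_⟩
  unfold In at hy
  rw [← h] at hy
  exact hξ.S_ray i hy

theorem half_conv (x : FreeGroup (Fin n)) (d) : Conv {w | P w x = some d} := by
  intro y hy z hz e h
  have hy : P y x = some d := hy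
  have hz : P z x = some d := hz
  change P (y * ofL e) x = some d
  have hyx : y ≠ x := by rintro rfl; rw [P_self] at hy; cases hy
  rw [P_nbr hyx, hy]
  rintro rfl
  have h1 : P y (y * ofL e) = some (lb e) := by rw [P_ax, P_self]; simp
  rw [h1] at hy
  rw [← hy, P_ax] at hz
  exact hz h

end

section
variable {ψ : Monoid.End (FreeGroup (Fin n))}

theorem exists_kappa (ψ : Monoid.End (FreeGroup (Fin n))) :
    ∃ κ : ℕ, ∀ y z, td (ψ y) (ψ z) ≤ κ * td y z := by
  obtain ⟨κ, hκ⟩ : ∃ κ, ∀ d : Fin n × Bool, (ψ (ofL d)).norm ≤ κ :=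
    ⟨univ.sup (fun d => (ψ (ofL d)).norm), fun d => le_sup (f := fun d => (ψ (ofL d)).norm) (mem_univ d)⟩
  refine ⟨κ, fun y z => ?_⟩
  refine path_ind y (p := fun z => td (ψ y) (ψ z) ≤ κ * td y z) ?_ ?_ z
  · rw [td_eq_zero.2 rfl]; omega
  · intro z d h ih
    have h1 := td_step h
    have h2 := td_triangle (ψ y) (ψ (z * ofL d)) (ψ z)
    have h3 : td (ψ (z * ofL d)) (ψ z) ≤ κ := by
      have : td (ψ (z * ofL d)) (ψ z) = (ψ (ofL d)).norm := by
        unfold td; rw [map_mul, inv_mul_cancel_left]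
      rw [this]; exact hκ d
    rw [← h1]
    nlinarith

theorem exists_proper (hψ : Function.Injective ψ) (R : ℕ) :
    ∃ C, ∀ g, (ψ g).norm ≤ R → g.norm ≤ C := by
  have hf : {g | (ψ g).norm ≤ R}.Finite := by
    apply Set.Finite.of_finite_image (f := ψ) _ hψ.injOn
    apply (ball_finite (n := n) R).subset
    rintro _ ⟨g, hg, rfl⟩
    exact hg
  obtain ⟨C, hC⟩ := (hf.image FreeGroup.norm).bddAbove
  exact ⟨C, fun g hg => hC ⟨g, hg, rfl⟩⟩

theorem cross {κ : ℕ} (hκ : ∀ y z, td (ψ y) (ψ z) ≤ κ * td y z) (a y v : FreeGroup (Fin n)) (d)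
    (ha : P (ψ a) v = some d) (hy : P (ψ y) v ≠ some d) :
    ∃ a', td (ψ a') v ≤ κ ∧ (a' = y ∨ P a' y = P a y) ∧ ∀ K, Conv K → y ∈ K → a ∈ K → a' ∈ K := by
  revert hy
  refine path_ind a (p := fun y => P (ψ y) v ≠ some d → ∃ a', td (ψ a') v ≤ κ ∧
    (a' = y ∨ P a' y = P a y) ∧ ∀ K, Conv K → y ∈ K → a ∈ K → a' ∈ K) ?_ ?_ y
  · intro h; exact absurd ha h
  · intro z e hze ih hz
    by_cases hc : P (ψ (z * ofL e)) v = some d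
    · refine ⟨z, ?_, Or.inl rfl, fun K _ h _ => h⟩
      have h1 := td_add (y1 := ψ z) (y' := ψ (z * ofL e)) (y := v) (by rw [hc]; exact hz)
      have h2 := hκ z (z * ofL e)
      have h3 : td z (z * ofL e) = 1 := by
        rw [td_comm]
        have := td_step (P_nb z e)
        rw [td_eq_zero.2 (rfl : z * ofL e = z * ofL e)] at this
        omega
      rw [h3, mul_one] at h2
      omega
    · obtain ⟨a', h1, h2, h3⟩ := ih hc
      refine ⟨a', h1, Or.inr ?_, fun K hK hz ha => h3 K hK (hK z hz a ha e hze) ha⟩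
      rw [hze]
      rcases h2 with rfl | h2
      · exact P_nb _ _
      · by_contra hcon
        have := (P_ax a' z e).2 hcon
        rw [h2, P_ax] at this
        exact this hze

theorem BCC (hψ : Function.Injective ψ) : ∃ C, ∀ a b y v d, P a y ≠ P b y → P (ψ a) v = some d →
    P (ψ b) v = some d → P (ψ y) v ≠ some d → td (ψ y) v ≤ C := by
  obtain ⟨κ, hκ⟩ := exists_kappa ψ
  obtain ⟨C0, hC0⟩ := exists_proper hψ (2 * κ)
  refine ⟨κ * C0 + κ, fun a b y v d hab ha hb hy => ?_⟩
  obtain ⟨a', ha1, ha2, -⟩ := cross hκ a y v d ha hy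
  obtain ⟨b', hb1, hb2, -⟩ := cross hκ b y v d hb hy
  rcases ha2 with rfl | ha2
  · omega
  rcases hb2 with rfl | hb2
  · omega
  have h1 : td a' b' = td a' y + td b' y := td_add (by rw [ha2, hb2]; exact hab)
  have h2 : td a' b' ≤ C0 := by
    apply hC0
    rw [map_mul, map_inv]
    have := td_triangle (ψ a') v (ψ b')
    rw [td_comm v] at this
    change td _ _ ≤ _
    omega
  have h3 := td_triangle (ψ y) (ψ a') v
  have h4 := hκ y a'
  have h5 : κ * td y a' ≤ κ * C0 := by
    apply Nat.mul_le_mul_left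
    rw [td_comm]; omega
  omega

variable {ξ : FreeGroup (Fin n) → Fin n × Bool}

theorem cont (hψ : Function.Injective ψ) (hξ : IsEnd ξ) (a : FreeGroup (Fin n))
    (ha : ∀ t, ∃ K, ∀ k, K ≤ k → In ξ t ((ψ ^ k) a)) (T0 : ℕ) :
    ∃ m, ∀ y, In ξ m y → In ξ T0 (ψ y) := by
  obtain ⟨κ, hκ⟩ := exists_kappa ψ
  obtain ⟨m, hm⟩ := exists_proper hψ (κ + T0)
  refine ⟨m, fun y hy => ?_⟩
  by_contra hc
  obtain ⟨K1, hK1⟩ := ha m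
  obtain ⟨K2, hK2⟩ := ha T0
  have e1 := hK1 (K1 + K2) (by omega)
  have e2 := hK2 (K1 + K2 + 1) (by omega)
  rw [End_pow_succ'] at e2
  obtain ⟨a', h1, -, h3⟩ := cross hκ _ y _ _ e2 hc
  have h4 : In ξ (0 + m) a' := by
    rw [zero_add]
    exact h3 _ (half_conv _ _) hy e1
  have h5 := hξ.In_td h4
  have h6 := td_triangle (ψ a') (ray ξ 1 T0) 1
  rw [hξ.td_ray] at h6
  have h7 := hm a' (by
    have : td (ψ a') 1 = (ψ a').norm := by simp [td]
    omega)
  rw [ray_zero] at h5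
  have : td a' 1 = a'.norm := by simp [td]
  omega

theorem far (hξ : IsEnd ξ)
    (hfix : ¬ ∃ v : ℕ → FreeGroup (Fin n), (∀ k, ψ (v k) = v k) ∧
      ∀ t, ∃ K, ∀ k, K ≤ k → In ξ t (v k)) (B : ℕ) :
    ∃ T, ∀ t, T ≤ t → B < td (ψ (ray ξ 1 t)) (ray ξ 1 t) := by
  by_contra hcon
  push Not at hcon
  choose f hf1 hf2 using hcon
  -- pigeonhole
  let g : ℕ → ball n B := fun k => ⟨(ray ξ 1 (f k))⁻¹ * ψ (ray ξ 1 (f k)), mem_ball.2 (hf2 k)⟩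
  obtain ⟨c, hc⟩ := Finite.exists_infinite_fiber g
  have hinf : (g ⁻¹' {c}).Infinite := Set.infinite_coe_iff.1 hc
  obtain ⟨k0, hk0⟩ := hinf.nonempty
  have hch : ∀ N, ∃ k, N ≤ k ∧ g k = c := by
    intro N
    obtain ⟨k, hk, hN⟩ := hinf.exists_gt N
    exact ⟨k, hN.le, hk⟩
  choose h hh1 hh2 using hch
  apply hfix
  refine ⟨fun k => ray ξ 1 (f (h k)) * (ray ξ 1 (f k0))⁻¹, fun k => ?_, fun t => ?_⟩
  · have e1 := congrArg Subtype.val (hh2 k)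
    have e2 := congrArg Subtype.val (show g k0 = c from hk0)
    simp only [g] at e1 e2
    have e1' : ψ (ray ξ 1 (f (h k))) = ray ξ 1 (f (h k)) * c := by rw [← e1]; simp
    have e2' : ψ (ray ξ 1 (f k0)) = ray ξ 1 (f k0) * c := by rw [← e2]; simp
    rw [map_mul, map_inv, e1', e2']
    group
  · set D := (ray ξ 1 (f k0)).norm
    refine ⟨t + D + 1, fun k hk => ?_⟩
    have h1 : In ξ (t + D) (ray ξ 1 (f (h k))) := hξ.In_ray (by
      have := hf1 (h k); have := hh1 k; omega)
    apply hξ.In_near h1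
    rw [td_comm]
    unfold td
    simp [D]

theorem trap (hψ : Function.Injective ψ) (hξ : IsEnd ξ)
    (hfix : ¬ ∃ v : ℕ → FreeGroup (Fin n), (∀ k, ψ (v k) = v k) ∧
      ∀ t, ∃ K, ∀ k, K ≤ k → In ξ t (v k))
    (a : FreeGroup (Fin n)) (ha : ∀ t, ∃ K, ∀ k, K ≤ k → In ξ t ((ψ ^ k) a)) (c : ℕ) :
    ∃ T, ∀ t, T ≤ t → ∀ y, In ξ t y → In ξ (t + c) (ψ y) := by
  obtain ⟨κ, hκ⟩ := exists_kappa ψ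
  obtain ⟨C, hC⟩ := BCC hψ
  have hx : ∀ T0, ∃ m0, ∀ m, m0 ≤ m → In ξ T0 (ψ (ray ξ 1 m)) := by
    intro T0
    obtain ⟨m, hm⟩ := cont hψ hξ a ha T0
    exact ⟨m + 1, fun k hk => hm _ (hξ.In_ray (by omega))⟩
  -- closeness to the ray
  have hnear : ∀ t j, (∀ i < j, In ξ i (ψ (ray ξ 1 t))) → ¬ In ξ j (ψ (ray ξ 1 t)) →
      td (ψ (ray ξ 1 t)) (ray ξ 1 j) ≤ C + 1 := by
    intro t j h1 h2
    set w := ψ (ray ξ 1 t) with hw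
    rcases hξ.depth_back h1 with h3 | h3
    · rw [h3, td_eq_zero.2 rfl]; omega
    by_cases hwj : w = ray ξ 1 j
    · rw [hwj, td_eq_zero.2 rfl]; omega
    obtain ⟨e, he⟩ := P_ex hwj
    obtain ⟨m0, hm0⟩ := hx j
    have hm := hm0 (m0 + t + 1) (by omega)
    have hb := hC 1 (ray ξ 1 (m0 + t + 1)) (ray ξ 1 t) (ray ξ 1 j * ofL e) (lb e) (by
        rw [hξ.P_ray 1 (show t < m0 + t + 1 by omega)]; exact hξ.ray_back 1 t) (by
        rw [map_one, P_ax, ← he]; exact h3.symm) (by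
        rw [P_ax]; unfold In at hm h2; rw [hm, ← he]; exact fun h => h2 h.symm) (by
        rw [Ne, P_ax, not_not]; exact he)
    rw [← hw] at hb
    have := td_step he
    omega
  -- push-forward of positivity
  set b := c + C + κ + 3 with hb
  obtain ⟨T1, hT1⟩ := far hξ hfix (C + 1 + b)
  have hpos : ∀ t, T1 ≤ t → In ξ t (ψ (ray ξ 1 t)) → In ξ (t + b) (ψ (ray ξ 1 t)) := by
    intro t ht h
    by_contra hcon
    obtain ⟨j, hj1, hj2⟩ := hξ.depth (ψ (ray ξ 1 t))
    have htj : t < j := by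
      by_contra hh; exact hj2 (hξ.In_mono (by omega) h)
    have hjb : j ≤ t + b := by
      by_contra hh; exact hcon (hj1 _ (by omega))
    have h1 := hnear t j hj1 hj2
    have h2 := td_triangle (ψ (ray ξ 1 t)) (ray ξ 1 j) (ray ξ 1 t)
    have h3 : td (ray ξ 1 j) (ray ξ 1 t) = j - t := by
      obtain ⟨k, rfl⟩ := Nat.exists_eq_add_of_le htj.le
      rw [ray_add, hξ.td_ray]; omega
    have := hT1 t ht
    omega
  by_cases hex : ∃ t0, T1 ≤ t0 ∧ In ξ t0 (ψ (ray ξ 1 t0))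
  · obtain ⟨t0, ht0, hin⟩ := hex
    have hall : ∀ t, t0 ≤ t → In ξ t (ψ (ray ξ 1 t)) := by
      intro t ht
      induction t, ht using Nat.le_induction with
      | base => exact hin
      | succ t ht ih =>
        have h1 := hpos t (by omega) ih
        have h2 : In ξ (t + 1 + κ) (ψ (ray ξ 1 t)) := hξ.In_mono (by omega) h1
        apply hξ.In_near h2
        refine le_trans (hκ _ _) ?_
        have : td (ray ξ 1 t) (ray ξ 1 (t+1)) = 1 := by
          rw [td_comm, ray_add, hξ.td_ray]
        rw [this]; omega
    refine ⟨t0, fun t ht y hy => ?_⟩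
    by_contra hcon
    obtain ⟨j, hj1, hj2⟩ := hξ.depth y
    have htj : t < j := by
      by_contra hh; exact hj2 (hξ.In_mono (by omega) hy)
    have hbig : In ξ (j + b) (ψ (ray ξ 1 j)) := hpos j (by omega) (hall j (by omega))
    rcases hξ.depth_back hj1 with h3 | h3
    · rw [h3] at hcon
      exact hcon (hξ.In_mono (by omega) hbig)
    have hb := hC y 1 (ray ξ 1 j) (ray ξ 1 (t + c + 1)) (lb (ξ (ray ξ 1 (t + c)))) h3 (by
      rw [ray_succ, P_ax]; exact hcon) (by
      rw [ray_succ, P_ax, map_one]; exact hξ.ray_back 1 _) (by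
      rw [ray_succ, Ne, P_ax, not_not]
      exact hξ.In_mono (show t + c ≤ j + b by omega) hbig)
    have h5 : In ξ (t + c + 1 + C) (ψ (ray ξ 1 j)) := hξ.In_mono (by omega) hbig
    have := hξ.In_td h5
    omega
  · exfalso
    push Not at hex
    -- depth is nonincreasing
    have hdec : ∀ t y, T1 ≤ t → ¬ In ξ t y → ¬ In ξ t (ψ y) := by
      intro t y ht hy hin
      obtain ⟨j, hj1, hj2⟩ := hξ.depth y
      obtain ⟨m0, hm0⟩ := hx t
      have hm := hm0 (m0 + t + 1) (by omega)
      have hbetw : P y (ray ξ 1 t) ≠ P (ray ξ 1 (m0 + t + 1)) (ray ξ 1 t) := by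
        rw [hξ.P_ray 1 (show t < m0 + t + 1 by omega)]; exact hy
      have := hC y (ray ξ 1 (m0 + t + 1)) (ray ξ 1 t) (ray ξ 1 t) _ hbetw hin hm (hex t ht)
      have := hT1 t ht
      omega
    obtain ⟨K, hK⟩ := ha T1
    obtain ⟨j, hj1, hj2⟩ := hξ.depth ((ψ ^ K) a)
    have hTj : T1 < j := by
      by_contra hh; exact hj2 (hξ.In_mono (by omega) (hK K le_rfl))
    have hneg : ∀ k, ¬ In ξ j ((ψ ^ (K + k)) a) := by
      intro k
      induction k with
      | zero => exact hj2
      | succ k ih => rw [← add_assoc, End_pow_succ']; exact hdec j _ (by omega) ih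
    obtain ⟨K', hK'⟩ := ha j
    exact hneg K' (hK' _ (by omega))
end
end IdxSum

namespace IdxSum
open Finset

variable {n : ℕ}

/-- convergence to an end -/
def Cv (ξ : FreeGroup (Fin n) → Fin n × Bool) (v : ℕ → FreeGroup (Fin n)) : Prop :=
  ∀ z, ∃ T, ∀ t, T ≤ t → P (v t) z = some (ξ z)

theorem Cv.uniq {ξ η : FreeGroup (Fin n) → Fin n × Bool} {v} (h : Cv ξ v) (h' : Cv η v) : ξ = η := by
  funext z
  obtain ⟨T, hT⟩ := h z
  obtain ⟨T', hT'⟩ := h' z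
  have h1 := hT (T + T') (by omega)
  have h2 := hT' (T + T') (by omega)
  rw [h1] at h2
  exact Option.some.inj h2

theorem Cv.tr {ξ : FreeGroup (Fin n) → Fin n × Bool} {v} (h : Cv ξ v) (g) :
    Cv (tr g ξ) (fun t => g * v t) := by
  intro z
  obtain ⟨T, hT⟩ := h (g⁻¹ * z)
  exact ⟨T, fun t ht => by rw [P_smul']; exact hT t ht⟩

theorem Cv_iff_In {ξ : FreeGroup (Fin n) → Fin n × Bool} (hξ : IsEnd ξ) {v} :
    Cv ξ v ↔ ∀ t, ∃ K, ∀ k, K ≤ k → In ξ t (v k) := by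
  constructor
  · intro h t; exact h _
  · intro h z
    obtain ⟨t, ht⟩ := hξ.In_sub z
    obtain ⟨K, hK⟩ := h t
    exact ⟨K, fun k hk => ht _ (hK k hk)⟩

theorem Cv.mul_right {ξ : FreeGroup (Fin n) → Fin n × Bool} (hξ : IsEnd ξ) {v} (h : Cv ξ v) (g) :
    Cv ξ (fun t => v t * g) := by
  rw [Cv_iff_In hξ] at h ⊢
  intro t
  obtain ⟨K, hK⟩ := h (t + g.norm)
  refine ⟨K, fun k hk => ?_⟩
  apply hξ.In_near (hK k hk)
  simp [td]

theorem exists_endOf (W : InfRedWord n) : ∃ ξ : FreeGroup (Fin n) → Fin n × Bool, IsEnd ξ ∧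
    ∀ t, ξ (ray ξ 1 t) = W.1 t := by
  let b : ℕ → FreeGroup (Fin n) := fun t => Nat.rec 1 (fun t x => x * ofL (W.1 t)) t
  obtain ⟨ξ, h1, h2, h3⟩ := exists_end b W.1 (fun t => rfl) (fun t => W.2 t)
  refine ⟨ξ, h1, fun t => ?_⟩
  have := h3 t
  change ray ξ 1 t = b t at this
  rw [this, h2]

/-- the end associated with an infinite word -/
noncomputable def endOf (W : InfRedWord n) : FreeGroup (Fin n) → Fin n × Bool :=
  (exists_endOf W).choose

theorem endOf_isEnd (W : InfRedWord n) : IsEnd (endOf W) := (exists_endOf W).choose_spec.1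
theorem endOf_ray (W : InfRedWord n) (t) : endOf W (ray (endOf W) 1 t) = W.1 t :=
  (exists_endOf W).choose_spec.2 t

theorem toWord_lb_mul {d : Fin n × Bool} {g : FreeGroup (Fin n)} (h : hd g = some d) :
    (ofL (lb d) * g).toWord = g.toWord.tail := by
  rw [toWord_ofL_mul]
  unfold hd at h
  cases hg : g.toWord with
  | nil => rw [hg] at h; cases h
  | cons a l =>
    rw [hg] at h
    simp only [List.head?_cons, Option.some.injEq] at h
    subst h
    simp [lb]

theorem toWord_drop {ξ : FreeGroup (Fin n) → Fin n × Bool} {g} (j : ℕ) (h : ∀ i < j, In ξ i g) :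
    ((ray ξ 1 j)⁻¹ * g).toWord = g.toWord.drop j := by
  induction j with
  | zero => simp [ray_zero]
  | succ j ih =>
    have h1 := ih (fun i hi => h i (by omega))
    have h2 : In ξ j g := h j (by omega)
    have h3 := toWord_lb_mul h2
    rw [ray_succ, mul_inv_rev, ofL_inv, mul_assoc, h3, h1, List.tail_drop]

theorem In_iff_word {ξ : FreeGroup (Fin n) → Fin n × Bool} {g} (m : ℕ) :
    (∀ i < m, In ξ i g) ↔ ∀ i < m, (g.toWord)[i]? = some (ξ (ray ξ 1 i)) := by
  induction m with
  | zero => simp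
  | succ m ih =>
    have key : (∀ i < m, In ξ i g) → (In ξ m g ↔ (g.toWord)[m]? = some (ξ (ray ξ 1 m))) := by
      intro h
      unfold In P hd
      rw [toWord_drop m h, List.head?_drop]
    constructor
    · intro h i hi
      have h0 : ∀ i < m, In ξ i g := fun i hi => h i (by omega)
      rcases Nat.lt_succ_iff_lt_or_eq.1 hi with hi | rfl
      · exact ih.1 h0 i hi
      · exact (key h0).1 (h _ (by omega))
    · intro h i hi
      have h0 : ∀ i < m, In ξ i g := ih.2 (fun i hi => h i (by omega))
      rcases Nat.lt_succ_iff_lt_or_eq.1 hi with hi | rfl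
      · exact h0 i hi
      · exact (key h0).2 (h _ (by omega))

theorem TB_iff {W : InfRedWord n} {v : ℕ → FreeGroup (Fin n)} :
    TendsToBoundary v W ↔ ∀ t, ∃ K, ∀ k, K ≤ k → In (endOf W) t (v k) := by
  unfold TendsToBoundary
  constructor
  · intro h t
    obtain ⟨K, hK⟩ := h (t + 1)
    refine ⟨K, fun k hk => ?_⟩
    exact (In_iff_word (ξ := endOf W) (t + 1)).2 (fun i hi => by rw [endOf_ray]; exact hK k hk i hi) t (by omega)
  · intro h m
    obtain ⟨K, hK⟩ := h m
    refine ⟨K, fun k hk j hj => ?_⟩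
    have := (In_iff_word (ξ := endOf W) m).1 (fun i hi => (endOf_isEnd W).In_mono hi.le (hK k hk)) j hj
    rwa [endOf_ray] at this

theorem sameFix_of_tr {ψ : Monoid.End (FreeGroup (Fin n))} {W V : InfRedWord n} {g}
    (hg : g ∈ fixSubgroup ψ) (h : tr g (endOf V) = endOf W) : SameFixOrbit ψ W V := by
  have h0 : Cv (endOf V) (fun t => ray (endOf V) 1 t) := fun z => (endOf_isEnd V).eventually 1 z
  have h1 := h0.tr g
  rw [h] at h1
  exact ⟨g, hg, _, TB_iff.2 ((Cv_iff_In (endOf_isEnd V)).1 h0), TB_iff.2 ((Cv_iff_In (endOf_isEnd W)).1 h1)⟩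

section Per
variable {G : Type*} [Group G]

/-- the `m`-th power of `i_u ∘ φ` -/
def Ps (φ : Monoid.End G) (u : G) (m : ℕ) (q : G) : G := uu φ u m * (φ ^ m) q * (uu φ u m)⁻¹

variable (φ : Monoid.End G) (u : G)

theorem Ps_mul (m : ℕ) (q q' : G) : Ps φ u m (q * q') = Ps φ u m q * Ps φ u m q' := by
  simp only [Ps, map_mul]; group

theorem Ps_map_one (m : ℕ) : Ps φ u m 1 = 1 := by simp [Ps]

theorem Ps_inv (m : ℕ) (q : G) : Ps φ u m q⁻¹ = (Ps φ u m q)⁻¹ := by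
  simp only [Ps, map_inv]; group

theorem Ps_zero (q : G) : Ps φ u 0 q = q := by simp [Ps, uu]

theorem Ps_one (q : G) : Ps φ u 1 q = u * φ q * u⁻¹ := by simp [Ps, uu_one]

theorem Ps_add (a b : ℕ) (q : G) : Ps φ u (a + b) q = Ps φ u a (Ps φ u b q) := by
  simp only [Ps, uu_add, End_pow_add, map_mul, map_inv]; group

theorem Ps_period {m : ℕ} {q : G} (h : Ps φ u m q = q) (k : ℕ) : Ps φ u (m * k) q = q := by
  induction k with
  | zero => exact Ps_zero φ u q
  | succ k ih => rw [Nat.mul_succ, Ps_add, h, ih]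

theorem Ps_dvd {m p : ℕ} {q : G} (h : Ps φ u m q = q) (hd : m ∣ p) : Ps φ u p q = q := by
  obtain ⟨k, rfl⟩ := hd; exact Ps_period φ u h k

/-- periodic elements of `i_u ∘ φ` -/
def Per : Subgroup G where
  carrier := {q | ∃ m, 1 ≤ m ∧ Ps φ u m q = q}
  one_mem' := ⟨1, le_rfl, Ps_map_one φ u 1⟩
  mul_mem' := by
    rintro a b ⟨m, hm, h⟩ ⟨m', hm', h'⟩
    refine ⟨m * m', Nat.mul_pos hm hm', ?_⟩
    rw [Ps_mul, Ps_dvd φ u h (Dvd.intro _ rfl), Ps_dvd φ u h' (Dvd.intro_left _ rfl)]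
  inv_mem' := by
    rintro a ⟨m, hm, h⟩
    exact ⟨m, hm, by rw [Ps_inv, h]⟩

theorem mem_Per {q : G} : q ∈ Per φ u ↔ ∃ m, 1 ≤ m ∧ Ps φ u m q = q := Iff.rfl

theorem uu_f (p : ℕ) (q h : G) : uu φ u p * (φ ^ p) (q * h) = Ps φ u p q * (uu φ u p * (φ ^ p) h) := by
  simp only [Ps, map_mul]; group

theorem Per_eq {u v : G} {r : ℕ} (hr : 1 ≤ r) (h : uu φ u r = uu φ v r) : Per φ u = Per φ v := by
  have key : ∀ u v : G, uu φ u r = uu φ v r → Per φ u ≤ Per φ v := by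
    intro u v h q hq
    obtain ⟨m, hm, hq⟩ := hq
    refine ⟨m * r, Nat.mul_pos hm hr, ?_⟩
    have h1 := Ps_dvd φ u hq (Dvd.intro r rfl)
    unfold Ps at h1 ⊢
    rw [← uu_dvd_eq φ h (Dvd.intro_left m rfl)]
    exact h1
  exact le_antisymm (key u v h) (key v u h.symm)

theorem Ps_conj (g : G) (m : ℕ) (q : G) :
    Ps φ (g⁻¹ * u * φ g) m q = g⁻¹ * Ps φ u m (g * q * g⁻¹) * g := by
  simp only [Ps, uu_conj, map_mul, map_inv]; group

theorem mem_Per_conj (g q : G) : q ∈ Per φ (g⁻¹ * u * φ g) ↔ g * q * g⁻¹ ∈ Per φ u := by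
  simp only [mem_Per, Ps_conj]
  refine exists_congr fun m => and_congr_right fun _ => ?_
  rw [mul_assoc, inv_mul_eq_iff_eq_mul, ← eq_mul_inv_iff_mul_eq]

theorem w_mem_Per {u v : G} {m : ℕ} (hm : 1 ≤ m) (h : uu φ v m = uu φ u m) : v * u⁻¹ ∈ Per φ u := by
  refine ⟨m, hm, ?_⟩
  have h1 : v * φ (uu φ u m) = uu φ u m * (φ ^ m) v := by
    rw [← h]
    have := uu_add (φ := φ) v m 1
    rwa [uu_one, uu] at this
  have h2 : u * φ (uu φ u m) = uu φ u m * (φ ^ m) u := by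
    have := uu_add (φ := φ) u m 1
    rwa [uu_one, uu] at this
  unfold Ps
  rw [map_mul, map_inv]
  calc uu φ u m * ((φ ^ m) v * ((φ ^ m) u)⁻¹) * (uu φ u m)⁻¹
      = (uu φ u m * (φ ^ m) v) * (uu φ u m * (φ ^ m) u)⁻¹ := by group
    _ = v * u⁻¹ := by rw [← h1, ← h2]; group
end Per

/-- everything we use about attracting ends -/
structure AttE (φ : Monoid.End (FreeGroup (Fin n))) (u : FreeGroup (Fin n))
    (ξ : FreeGroup (Fin n) → Fin n × Bool) : Prop where
  isEnd : IsEnd ξ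
  fixed : ∀ v, Cv ξ v → Cv ξ (fun t => u * φ (v t) * u⁻¹)
  good : ∀ z, ∃ h1 h2, h1 ≠ h2 ∧ ∀ p, P (uu φ u p * (φ ^ p) h1) z = some (ξ z) ∧
    P (uu φ u p * (φ ^ p) h2) z = some (ξ z)
  fr : ∀ x z, {t | ∃ q ∈ Per φ u, ray ξ x t = q * z}.Finite

theorem attE_of {φ : Monoid.End (FreeGroup (Fin n))} {u : FreeGroup (Fin n)}
    {ψ : Monoid.End (FreeGroup (Fin n))} (hφ : Function.Injective φ)
    (hψ : ∀ g, ψ g = u * φ g * u⁻¹) {W : InfRedWord n} (hW : IsAttractingFixPt ψ W) :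
    AttE φ u (endOf W) := by
  set ξ := endOf W
  have hξ : IsEnd ξ := endOf_isEnd W
  have hinj : Function.Injective ψ := by
    intro a b h
    rw [hψ, hψ] at h
    exact hφ (mul_left_cancel (mul_right_cancel h))
  obtain ⟨h1, a, ha⟩ := hW
  have hfix : ¬ ∃ v : ℕ → FreeGroup (Fin n), (∀ k, ψ (v k) = v k) ∧
      ∀ t, ∃ K, ∀ k, K ≤ k → In ξ t (v k) := by
    rintro ⟨v, hv, hv'⟩
    exact h1 ⟨v, hv, TB_iff.2 hv'⟩
  have ha' := TB_iff.1 ha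
  have htrap := trap hinj hξ hfix a ha'
  refine ⟨hξ, ?_, ?_, ?_⟩
  · intro v hv
    have hv1 := (Cv_iff_In hξ).1 hv
    rw [Cv_iff_In hξ]
    intro t
    obtain ⟨T, hT⟩ := htrap 0
    obtain ⟨K, hK⟩ := hv1 (T + t)
    refine ⟨K, fun k hk => ?_⟩
    have := hT (T + t) (by omega) _ (hK k hk)
    rw [hψ] at this
    exact hξ.In_mono (by omega) this
  · intro z
    obtain ⟨t0, ht0⟩ := hξ.In_sub z
    obtain ⟨T, hT⟩ := htrap (1 + u.norm)
    have hf : ∀ t, T ≤ t → ∀ y, In ξ t y → In ξ (t + 1) (u * φ y) := by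
      intro t ht y hy
      have := hT t ht y hy
      rw [← add_assoc] at this
      apply hξ.In_near this
      rw [hψ, td_comm]
      simp [td, mul_assoc]
    have hp : ∀ y, In ξ (T + t0) y → ∀ p, P (uu φ u p * (φ ^ p) y) z = some (ξ z) := by
      intro y hy p
      apply ht0
      have : In ξ (T + t0 + p) (uu φ u p * (φ ^ p) y) := by
        induction p with
        | zero => simpa [uu, End_pow_zero] using hy
        | succ p ih =>
          rw [uu, End_pow_succ', mul_assoc, ← map_mul]
          exact hf (T + t0 + p) (by omega) _ ih
      exact hξ.In_mono (by omega) this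
    refine ⟨ray ξ 1 (T + t0 + 1), ray ξ 1 (T + t0 + 2), ?_, fun p => ⟨hp _ ?_ p, hp _ ?_ p⟩⟩
    · intro h
      have := hξ.ray_inj 1 h
      omega
    · exact hξ.In_ray (by omega)
    · exact hξ.In_ray (by omega)
  · intro x z
    obtain ⟨T, hT⟩ := htrap 1
    have hPs : ∀ m q, Ps φ u m q = (ψ ^ m) q := by
      intro m q
      induction m with
      | zero => exact Ps_zero φ u q
      | succ m ih => rw [add_comm, Ps_add, ih, Ps_one, ← hψ, add_comm, End_pow_succ']
    have hno : ∀ q ∈ Per φ u, ¬ In ξ T q := by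
      rintro q ⟨m, hm, hq⟩ hin
      have hgrow : ∀ k, In ξ (T + k) ((ψ ^ k) q) := by
        intro k
        induction k with
        | zero => exact hin
        | succ k ih => rw [End_pow_succ', ← add_assoc]; exact hT _ (by omega) _ ih
      obtain ⟨j, -, hj⟩ := hξ.depth q
      apply hj
      have h2 := hgrow (m * j)
      rw [← hPs, Ps_dvd φ u hq (Dvd.intro _ rfl)] at h2
      exact hξ.In_mono (by nlinarith) h2
    obtain ⟨K, hK⟩ := hξ.eventually x (ray ξ 1 (T + z.norm))
    refine (Set.finite_lt_nat K).subset ?_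
    rintro t ⟨q, hq, e⟩
    by_contra hc
    have h2 : In ξ (T + z.norm) (ray ξ x t) := hK t (by simpa using hc)
    apply hno q hq
    apply hξ.In_near h2
    rw [e]
    simp [td]

theorem AttE.conj {φ : Monoid.End (FreeGroup (Fin n))} {u : FreeGroup (Fin n)}
    {ξ : FreeGroup (Fin n) → Fin n × Bool} (h : AttE φ u ξ) (g) :
    AttE φ (g⁻¹ * u * φ g) (tr g⁻¹ ξ) := by
  refine ⟨h.isEnd.tr _, ?_, ?_, ?_⟩
  · intro v hv
    have h1 := hv.tr g
    rw [tr_tr, mul_inv_cancel, tr_one] at h1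
    have h2 := (h.fixed _ (h1.mul_right h.isEnd g⁻¹)).tr g⁻¹
    have h3 := h2.mul_right (h.isEnd.tr _) g
    convert h3 using 2
    simp only [map_mul, map_inv]; group
  · intro z
    obtain ⟨h1, h2, hne, hp⟩ := h.good (g * z)
    refine ⟨g⁻¹ * h1, g⁻¹ * h2, fun e => hne (mul_left_cancel e), fun p => ?_⟩
    have key : ∀ y, uu φ (g⁻¹ * u * φ g) p * (φ ^ p) (g⁻¹ * y) = g⁻¹ * (uu φ u p * (φ ^ p) y) := by
      intro y
      rw [uu_conj, map_mul, map_inv]; group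
    rw [key, key, P_smul' g⁻¹ (uu φ u p * (φ ^ p) h1), P_smul' g⁻¹ (uu φ u p * (φ ^ p) h2), inv_inv]
    have := hp p
    have e : tr g⁻¹ ξ z = ξ (g * z) := by unfold tr; rw [inv_inv]
    rw [e]
    exact this
  · intro x z
    refine (h.fr (g * x) (g * z)).subset ?_
    rintro t ⟨q, hq, e⟩
    refine ⟨g * q * g⁻¹, (mem_Per_conj φ u g q).1 hq, ?_⟩
    have := ray_tr g⁻¹ ξ (g * x) t
    rw [inv_mul_cancel_left, e] at this
    rw [eq_inv_mul_iff_mul_eq] at this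
    rw [← this]; group
end IdxSum

namespace IdxSum
open Finset

/-! ### Cuts in groups -/
section Cuts
variable {Q : Type*} [Group Q]

/-- right coboundary of a set -/
def cb (s : Q) (A : Set Q) : Set Q := {x | ¬(x ∈ A ↔ x * s ∈ A)}

/-- almost invariant sets -/
def AI (A : Set Q) : Prop := ∀ s, (cb s A).Finite

theorem cb_compl (s : Q) (A : Set Q) : cb s Aᶜ = cb s A := by
  ext x; simp only [cb, Set.mem_setOf_eq, Set.mem_compl_iff]; tauto

theorem AI.compl {A : Set Q} (h : AI A) : AI Aᶜ := fun s => by rw [cb_compl]; exact h s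

theorem cb_inter_union (s : Q) (A B : Set Q) :
    cb s (A ∩ B) ∪ cb s (A ∪ B) ⊆ cb s A ∪ cb s B := by
  intro x; simp only [cb, Set.mem_setOf_eq, Set.mem_union, Set.mem_inter_iff]; tauto

theorem cb_inter_union' (s : Q) (A B : Set Q) :
    cb s (A ∩ B) ∩ cb s (A ∪ B) ⊆ cb s A ∩ cb s B := by
  intro x; simp only [cb, Set.mem_setOf_eq, Set.mem_union, Set.mem_inter_iff]; tauto

theorem AI.inter {A B : Set Q} (h : AI A) (h' : AI B) : AI (A ∩ B) := fun s =>
  ((h s).union (h' s)).subset (Set.subset_union_left.trans (cb_inter_union s A B))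

theorem AI.union {A B : Set Q} (h : AI A) (h' : AI B) : AI (A ∪ B) := fun s =>
  ((h s).union (h' s)).subset (Set.subset_union_right.trans (cb_inter_union s A B))

theorem submod {A B : Set Q} (hA : AI A) (hB : AI B) (s : Q) :
    (cb s (A ∩ B)).ncard + (cb s (A ∪ B)).ncard ≤ (cb s A).ncard + (cb s B).ncard := by
  have h1 := Set.ncard_union_add_ncard_inter _ _ (hA.inter hB s) (hA.union hB s)
  have h2 := Set.ncard_union_add_ncard_inter _ _ (hA s) (hB s)
  have h3 := Set.ncard_le_ncard (cb_inter_union s A B) ((hA s).union (hB s))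
  have h4 := Set.ncard_le_ncard (cb_inter_union' s A B) ((hA s).inter_of_left _)
  omega

theorem submod_lt {A B : Set Q} (hA : AI A) (hB : AI B) {s x : Q} (h1 : x ∈ A) (h2 : x ∉ B)
    (h3 : x * s ∉ A) (h4 : x * s ∈ B) :
    (cb s (A ∩ B)).ncard + (cb s (A ∪ B)).ncard < (cb s A).ncard + (cb s B).ncard := by
  have e1 := Set.ncard_union_add_ncard_inter _ _ (hA.inter hB s) (hA.union hB s)
  have e2 := Set.ncard_union_add_ncard_inter _ _ (hA s) (hB s)
  have e3 := Set.ncard_le_ncard (cb_inter_union s A B) ((hA s).union (hB s))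
  have e4 : (cb s (A ∩ B) ∩ cb s (A ∪ B)).ncard < (cb s A ∩ cb s B).ncard := by
    apply Set.ncard_lt_ncard _ ((hA s).inter_of_left _)
    refine ⟨cb_inter_union' s A B, fun h => ?_⟩
    have : x ∈ cb s A ∩ cb s B := by
      constructor <;> simp only [cb, Set.mem_setOf_eq] <;> tauto
    have := (h this).1
    simp only [cb, Set.mem_setOf_eq, Set.mem_inter_iff] at this
    tauto
  omega

/-- weights of a cut -/
noncomputable def MM (S : ℕ → Finset Q) (A : Set Q) : Lex (ℕ → ℤ) :=
  toLex fun k => ∑ s ∈ S k, ((cb s A).ncard : ℤ)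

theorem MM_compl (S : ℕ → Finset Q) (A : Set Q) : MM S Aᶜ = MM S A := by
  unfold MM; simp only [cb_compl]

theorem MM_submod {S : ℕ → Finset Q} (hS : ∀ s, ∃ k, s ∈ S k) {A B : Set Q} (hA : AI A) (hB : AI B)
    {x y : Q} (h1 : x ∈ A) (h2 : x ∉ B) (h3 : y ∉ A) (h4 : y ∈ B) :
    MM S (A ∩ B) + MM S (A ∪ B) < MM S A + MM S B := by
  have : (fun k => ∑ s ∈ S k, ((cb s (A ∩ B)).ncard : ℤ)) + (fun k => ∑ s ∈ S k, ((cb s (A ∪ B)).ncard : ℤ))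
    < (fun k => ∑ s ∈ S k, ((cb s A).ncard : ℤ)) + (fun k => ∑ s ∈ S k, ((cb s B).ncard : ℤ)) := by
    rw [Pi.lt_def]
    refine ⟨fun k => ?_, ?_⟩
    · simp only [Pi.add_apply, ← Finset.sum_add_distrib]
      exact Finset.sum_le_sum fun s _ => by exact_mod_cast submod hA hB s
    · obtain ⟨k, hk⟩ := hS (x⁻¹ * y)
      refine ⟨k, ?_⟩
      simp only [Pi.add_apply, ← Finset.sum_add_distrib]
      refine Finset.sum_lt_sum (fun s _ => by exact_mod_cast submod hA hB s) ⟨_, hk, ?_⟩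
      exact_mod_cast submod_lt hA hB h1 h2 (by simpa using h3) (by simpa using h4)
  exact Pi.toLex_strictMono this

theorem MM_bij {S : ℕ → Finset Q} {A B : Set Q} (e : Q → Q) 
    (f : Q → Q) (hf : Function.Injective f) (he : Function.Injective e)
    (hS : ∀ k, ∀ s ∈ S k, e s ∈ S k) (h : ∀ s, cb (e s) B = f '' cb s A) : MM S B = MM S A := by
  unfold MM
  congr 1
  funext k
  symm
  apply Finset.sum_bij (fun s _ => e s) (hS k) (fun _ _ _ _ h => he h)
  · intro b hb
    have := Finset.surj_on_of_inj_on_of_card_le (s := S k) (t := S k) (fun s _ => e s) (hS k)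
      (fun _ _ _ _ h => he h) le_rfl b hb
    obtain ⟨a, ha, h⟩ := this
    exact ⟨a, ha, h.symm⟩
  · intro a _
    rw [h, Set.ncard_image_of_injective _ hf]

/-- the set converges along powers of `g` -/
def Pl (g : Q) (A : Set Q) : Prop := ∃ M, ∀ m ≥ M, g ^ m ∈ A

def Cut (g : Q) (A : Set Q) : Prop := AI A ∧ Pl g A ∧ Pl g⁻¹ Aᶜ

theorem Pl.not_compl {g : Q} {A : Set Q} (h : Pl g A) : ¬ Pl g Aᶜ := by
  rintro ⟨M', h'⟩
  obtain ⟨M, h⟩ := h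
  exact h' (M + M') (by omega) (h (M + M') (by omega))

theorem Pl.inter {g : Q} {A B : Set Q} (h : Pl g A) (h' : Pl g B) : Pl g (A ∩ B) := by
  obtain ⟨M, h⟩ := h
  obtain ⟨M', h'⟩ := h'
  exact ⟨M + M', fun m hm => ⟨h m (by omega), h' m (by omega)⟩⟩

theorem Pl.mono {g : Q} {A B : Set Q} (h : Pl g A) (h' : A ⊆ B) : Pl g B := by
  obtain ⟨M, h⟩ := h
  exact ⟨M, fun m hm => h' (h m hm)⟩

variable (Q) in
def Inf : Prop := ∀ g : Q, g ≠ 1 → Function.Injective (fun m : ℕ => g ^ m)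

theorem fin_ev {g : Q} (hg : Function.Injective (fun m : ℕ => g ^ m)) {X : Set Q} (hX : X.Finite) :
    ∃ M, ∀ m ≥ M, g ^ m ∉ X := by
  have : {m : ℕ | g ^ m ∈ X}.Finite := hX.preimage hg.injOn
  obtain ⟨M, hM⟩ := this.bddAbove
  exact ⟨M + 1, fun m hm h => by have := hM h; omega⟩

theorem Pl_or (hI : Inf Q) {g : Q} (hg : g ≠ 1) {A : Set Q} (hA : AI A) : Pl g A ∨ Pl g Aᶜ := by
  obtain ⟨M, hM⟩ := fin_ev (hI g hg) (hA g)
  have key : ∀ k, (g ^ M ∈ A ↔ g ^ (M + k) ∈ A) := by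
    intro k
    induction k with
    | zero => rfl
    | succ k ih =>
      have := hM (M + k) (by omega)
      simp only [cb, Set.mem_setOf_eq, not_not] at this
      rw [ih, this, ← pow_succ]; rfl
  by_cases h : g ^ M ∈ A
  · left
    refine ⟨M, fun m hm => ?_⟩
    obtain ⟨k, rfl⟩ := Nat.exists_eq_add_of_le hm
    exact (key k).1 h
  · right
    refine ⟨M, fun m hm => ?_⟩
    obtain ⟨k, rfl⟩ := Nat.exists_eq_add_of_le hm
    exact fun h' => h ((key k).2 h')

theorem Pl_mul (hI : Inf Q) {g : Q} (hg : g ≠ 1) {A : Set Q} (hA : AI A) (h : Pl g A) (x : Q) :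
    ∃ M, ∀ m ≥ M, g ^ m * x ∈ A := by
  obtain ⟨M, hM⟩ := fin_ev (hI g hg) (hA x)
  obtain ⟨M', h⟩ := h
  refine ⟨M + M', fun m hm => ?_⟩
  have := hM m (by omega)
  simp only [cb, Set.mem_setOf_eq, not_not] at this
  exact this.1 (h m (by omega))

theorem Cut.ne_one {g : Q} {A : Set Q} (h : Cut g A) : g ≠ 1 := by
  rintro rfl
  obtain ⟨-, h1, h2⟩ := h
  rw [inv_one] at h2
  exact h1.not_compl h2

theorem Cut.compl {g : Q} {A : Set Q} (h : Cut g A) : Cut g⁻¹ Aᶜ :=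
  ⟨h.1.compl, h.2.2, by rw [inv_inv, compl_compl]; exact h.2.1⟩

def Min (S : ℕ → Finset Q) (g : Q) (A : Set Q) : Prop := Cut g A ∧ ∀ B, Cut g B → MM S A ≤ MM S B

theorem Min.compl {S : ℕ → Finset Q} {g : Q} {A : Set Q} (h : Min S g A) : Min S g⁻¹ Aᶜ := by
  refine ⟨h.1.compl, fun B hB => ?_⟩
  have := hB.compl
  rw [inv_inv] at this
  have := h.2 _ this
  rwa [MM_compl, ← MM_compl S A] at this

theorem Min.le_compl {S : ℕ → Finset Q} {g : Q} {A B : Set Q} (h : Min S g A) (hB : Cut g⁻¹ B) :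
    MM S A ≤ MM S B := by
  have := h.compl.2 B hB
  rwa [MM_compl] at this

theorem corner {X : Type*} [AddCommGroup X] [LinearOrder X] [IsOrderedAddMonoid X]
    {a b c1 c2 d1 d2 : X} (hc : c1 + c2 < a + b) (hd : d1 + d2 < a + b)
    (h1 : a ≤ c1 ∨ a ≤ d1) (h2 : a ≤ c2 ∨ a ≤ d2) (h3 : b ≤ c1 ∨ b ≤ d2) (h4 : b ≤ c2 ∨ b ≤ d1) :
    False := by
  grind

theorem nested {S : ℕ → Finset Q} (hI : Inf Q) (hS : ∀ s, ∃ k, s ∈ S k) {g h : Q} {A B : Set Q}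
    (hA : Min S g A) (hB : Min S h B) : A ⊆ B ∨ B ⊆ A ∨ A ⊆ Bᶜ ∨ Aᶜ ⊆ B := by
  by_contra hc
  push Not at hc
  obtain ⟨h1, h2, h3, h4⟩ := hc
  obtain ⟨x1, hx1, hx1'⟩ := Set.not_subset.1 h1
  obtain ⟨x2, hx2, hx2'⟩ := Set.not_subset.1 h2
  obtain ⟨x3, hx3, hx3'⟩ := Set.not_subset.1 h3
  obtain ⟨x4, hx4, hx4'⟩ := Set.not_subset.1 h4
  rw [Set.mem_compl_iff, not_not] at hx3'
  have c := MM_submod hS hA.1.1 hB.1.1 hx1 hx1' hx2' hx2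
  have d := MM_submod hS hA.1.1 hB.1.1.compl hx3 (fun h => h hx3') hx4 hx4'
  rw [MM_compl S B] at d
  have eAB : MM S (A ∪ Bᶜ) = MM S (B ∩ Aᶜ) := by
    rw [← MM_compl]; congr 1; rw [Set.compl_union, compl_compl, Set.inter_comm]
  rw [eAB] at d
  have gA := hA.1.2.1
  have gA' := hA.1.2.2
  have hB1 := hB.1.2.1
  have hB2 := hB.1.2.2
  have aiA := hA.1.1
  have aiB := hB.1.1
  have ng := hA.1.ne_one
  have nh := hB.1.ne_one
  refine corner c d ?_ ?_ ?_ ?_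
  · rcases Pl_or hI ng aiB with h | h
    · exact .inl (hA.2 _ ⟨aiA.inter aiB, gA.inter h, gA'.mono (by rw [Set.compl_inter]; exact Set.subset_union_left)⟩)
    · exact .inr (hA.2 _ ⟨aiA.inter aiB.compl, gA.inter h, gA'.mono (by rw [Set.compl_inter]; exact Set.subset_union_left)⟩)
  · rcases Pl_or hI (inv_ne_one.2 ng) aiB with h | h
    · exact .inr (hA.le_compl ⟨aiB.inter aiA.compl, h.inter gA', by rw [inv_inv]; exact gA.mono (by rw [Set.compl_inter, compl_compl]; exact Set.subset_union_right)⟩)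
    · exact .inl (hA.2 _ ⟨aiA.union aiB, gA.mono Set.subset_union_left, (gA'.inter h).mono (by rw [Set.compl_union])⟩)
  · rcases Pl_or hI nh aiA with h | h
    · exact .inl (hB.2 _ ⟨aiA.inter aiB, h.inter hB1, hB2.mono (by rw [Set.compl_inter]; exact Set.subset_union_right)⟩)
    · exact .inr (hB.2 _ ⟨aiB.inter aiA.compl, hB1.inter h, hB2.mono (by rw [Set.compl_inter]; exact Set.subset_union_left)⟩)
  · rcases Pl_or hI (inv_ne_one.2 nh) aiA with h | h
    · exact .inr (hB.le_compl ⟨aiA.inter aiB.compl, h.inter hB2, by rw [inv_inv]; exact hB1.mono (by rw [Set.compl_inter, compl_compl]; exact Set.subset_union_right)⟩)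
    · exact .inl (hB.2 _ ⟨aiA.union aiB, hB1.mono Set.subset_union_right, (h.inter hB2).mono (by rw [Set.compl_union])⟩)

end Cuts

/-! ### Finiteness of tight cuts -/
section Tight
variable {V : Type*}

/-- connectedness of a set of vertices -/
def Cn (R : V → V → Prop) (A : Set V) : Prop :=
  ∀ C ⊆ A, C.Nonempty → (∀ a ∈ C, ∀ b ∈ A, R a b → b ∈ C) → C = A

theorem tight_finite (k : ℕ) : ∀ (R : V → V → Prop), (∀ a b, R a b → R b a) → ∀ x y,
    Relation.ReflTransGen R x y → {A : Set V | x ∈ A ∧ y ∉ A ∧ Cn R A ∧ Cn R Aᶜ ∧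
      {p : V × V | p.1 ∈ A ∧ p.2 ∉ A ∧ R p.1 p.2}.encard ≤ k}.Finite := by
  induction k with
  | zero =>
    intro R hR x y hxy
    induction hxy with
    | refl => exact Set.finite_empty.subset fun A h => h.2.1 h.1
    | @tail b c _ hbc ih =>
      refine ih.subset ?_
      rintro A ⟨h1, h2, h3, h4, h5⟩
      refine ⟨h1, fun hb => ?_, h3, h4, h5⟩
      simp only [Nat.cast_zero, nonpos_iff_eq_zero, Set.encard_eq_zero] at h5
      have : (b, c) ∈ {p : V × V | p.1 ∈ A ∧ p.2 ∉ A ∧ R p.1 p.2} := ⟨hb, h2, hbc⟩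
      rw [h5] at this
      exact this
  | succ k ihk =>
    intro R hR x y hxy
    induction hxy with
    | refl => exact Set.finite_empty.subset fun A h => h.2.1 h.1
    | @tail b c _ hbc ih =>
      let R' : V → V → Prop := fun u v => R u v ∧ ¬(u = b ∧ v = c) ∧ ¬(u = c ∧ v = b)
      have hR' : ∀ u v, R' u v → R' v u := fun u v h => ⟨hR _ _ h.1, by tauto, by tauto⟩
      let K : Set V := {v | Relation.ReflTransGen R' b v}
      have hfin : {A : Set V | b ∈ A ∧ c ∉ A ∧ Cn R A ∧ Cn R Aᶜ ∧
          {p : V × V | p.1 ∈ A ∧ p.2 ∉ A ∧ R p.1 p.2}.encard ≤ (k + 1 : ℕ)}.Finite := by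
        have hcn : ∀ A : Set V, b ∈ A → c ∉ A → Cn R A → Cn R Aᶜ → Cn R' A ∧ Cn R' Aᶜ := by
          intro A hb hc h1 h2
          refine ⟨fun C hC hne h => h1 C hC hne fun u hu v hv huv => h u hu v hv ⟨huv, ?_, ?_⟩,
            fun C hC hne h => h2 C hC hne fun u hu v hv huv => h u hu v hv ⟨huv, ?_, ?_⟩⟩
          · rintro ⟨rfl, rfl⟩; exact hc hv
          · rintro ⟨rfl, rfl⟩; exact hc (hC hu)
          · rintro ⟨rfl, rfl⟩; exact hC hu hb
          · rintro ⟨rfl, rfl⟩; exact hv hb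
        by_cases hcK : c ∈ K
        · refine (ihk R' hR' b c hcK).subset ?_
          rintro A ⟨h1, h2, h3, h4, h5⟩
          refine ⟨h1, h2, (hcn A h1 h2 h3 h4).1, (hcn A h1 h2 h3 h4).2, ?_⟩
          have hins : insert (b, c) {p : V × V | p.1 ∈ A ∧ p.2 ∉ A ∧ R' p.1 p.2} ⊆
              {p : V × V | p.1 ∈ A ∧ p.2 ∉ A ∧ R p.1 p.2} := by
            rintro p (rfl | hp)
            · exact ⟨h1, h2, hbc⟩
            · exact ⟨hp.1, hp.2.1, hp.2.2.1⟩
          have h6 := (Set.encard_le_encard hins).trans h5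
          rw [Set.encard_insert_of_notMem (fun h => h.2.2.2.1 ⟨rfl, rfl⟩)] at h6
          push_cast at h6
          exact (ENat.add_le_add_iff_right (by simp)).1 h6
        · refine (Set.finite_singleton K).subset ?_
          rintro A ⟨h1, h2, h3, h4, h5⟩
          obtain ⟨h3, h4⟩ := hcn A h1 h2 h3 h4
          have e1 : K ∩ A = A := by
            apply h3 _ Set.inter_subset_right ⟨b, Relation.ReflTransGen.refl, h1⟩
            rintro u ⟨hu, _⟩ v hv huv
            exact ⟨Relation.ReflTransGen.tail hu huv, hv⟩
          have e2 : Kᶜ ∩ Aᶜ = Aᶜ := by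
            apply h4 _ Set.inter_subset_right ⟨c, hcK, h2⟩
            rintro u ⟨hu, _⟩ v hv huv
            exact ⟨fun hv' => hu (Relation.ReflTransGen.tail hv' (hR' _ _ huv)), hv⟩
          rw [Set.inter_eq_right] at e1 e2
          rw [Set.mem_singleton_iff]
          exact Set.Subset.antisymm e1 (Set.compl_subset_compl.1 e2)
      refine (ih.union hfin).subset ?_
      rintro A ⟨h1, h2, h3, h4, h5⟩
      by_cases hb : b ∈ A
      · exact .inr ⟨hb, h2, h3, h4, h5⟩
      · exact .inl ⟨h1, hb, h3, h4, h5⟩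

end Tight
end IdxSum

namespace IdxSum
open Finset
open scoped Pointwise

section Cuts2
variable {Q : Type*} [Group Q]

theorem cb_mul (s t : Q) (A : Set Q) : cb (s * t) A ⊆ cb s A ∪ (fun x => x * s⁻¹) '' cb t A := by
  intro x hx
  by_cases h : x ∈ cb s A
  · exact .inl h
  · right
    refine ⟨x * s, ?_, by simp⟩
    simp only [cb, Set.mem_setOf_eq, ← mul_assoc] at *
    tauto

theorem AI_of_gen {S0 : Finset Q} (hgen : Subgroup.closure (S0 : Set Q) = ⊤) {A : Set Q}
    (h : ∀ s ∈ S0, (cb s A).Finite) : AI A := by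
  intro s
  have hs : s ∈ Subgroup.closure (S0 : Set Q) := by rw [hgen]; trivial
  induction hs using Subgroup.closure_induction with
  | mem x hx => exact h x hx
  | one => convert Set.finite_empty; simp [cb]
  | mul x y _ _ hx hy => exact (hx.union (hy.image _)).subset (cb_mul x y A)
  | inv x _ hx =>
    refine (hx.image (fun y => y * x)).subset ?_
    intro y hy
    refine ⟨y * x⁻¹, ?_, by simp⟩
    simp only [cb, Set.mem_setOf_eq, inv_mul_cancel_right] at *
    tauto

theorem cb_empty {S0 : Finset Q} (hgen : Subgroup.closure (S0 : Set Q) = ⊤) {A : Set Q}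
    (h : ∀ s ∈ S0, cb s A = ∅) {a : Q} (ha : a ∈ A) (b : Q) : b ∈ A := by
  have key : ∀ s, cb s A = ∅ := by
    intro s
    have hs : s ∈ Subgroup.closure (S0 : Set Q) := by rw [hgen]; trivial
    induction hs using Subgroup.closure_induction with
    | mem x hx => exact h x hx
    | one => simp [cb]
    | mul x y _ _ hx hy =>
      have := cb_mul x y A
      rw [hx, hy] at this
      simpa using this
    | inv x _ hx =>
      rw [Set.eq_empty_iff_forall_notMem] at *
      intro y hy
      apply hx (y * x⁻¹)
      simp only [cb, Set.mem_setOf_eq, inv_mul_cancel_right] at *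
      tauto
  have := key (a⁻¹ * b)
  rw [Set.eq_empty_iff_forall_notMem] at this
  have := this a
  simp only [cb, Set.mem_setOf_eq, mul_inv_cancel_left, not_not] at this
  exact this.1 ha

/-- the number of generators edges in the coboundary -/
noncomputable def N0 (S : ℕ → Finset Q) (A : Set Q) : ℕ := ∑ s ∈ S 0, (cb s A).ncard

theorem N0_le {S : ℕ → Finset Q} {A B : Set Q} (h : MM S A ≤ MM S B) : N0 S A ≤ N0 S B := by
  by_contra hc
  push Not at hc
  refine absurd h (not_le.2 ?_)
  refine ⟨0, fun j hj => absurd hj (by simp), ?_⟩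
  change (∑ s ∈ S 0, ((cb s B).ncard : ℤ)) < ∑ s ∈ S 0, ((cb s A).ncard : ℤ)
  unfold N0 at hc
  exact_mod_cast hc

theorem MM_lt {S : ℕ → Finset Q} {A B : Set Q} (h : N0 S A < N0 S B) : MM S A < MM S B := by
  by_contra hc
  have := N0_le (not_lt.1 hc)
  omega

def CR (S : ℕ → Finset Q) (x y : Q) : Prop := x⁻¹ * y ∈ S 0 ∨ y⁻¹ * x ∈ S 0

theorem CR_symm (S : ℕ → Finset Q) (x y : Q) (h : CR S x y) : CR S y x := h.symm

theorem CR_conn {S : ℕ → Finset Q} (hgen : Subgroup.closure ((S 0 : Finset Q) : Set Q) = ⊤) (x y : Q) :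
    Relation.ReflTransGen (CR S) x y := by
  have : y ∈ {v | Relation.ReflTransGen (CR S) x v} := by
    refine cb_empty hgen (a := x) ?_ Relation.ReflTransGen.refl y
    intro s hs
    rw [Set.eq_empty_iff_forall_notMem]
    intro v hv
    apply hv
    constructor
    · intro h; exact Relation.ReflTransGen.tail h (.inl (by simpa using hs))
    · intro h; exact Relation.ReflTransGen.tail h (.inr (by simpa using hs))
  exact this

theorem encard_cut {S : ℕ → Finset Q} {A : Set Q} (hA : AI A) :
    {p : Q × Q | p.1 ∈ A ∧ p.2 ∉ A ∧ CR S p.1 p.2}.encard ≤ N0 S A := by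
  classical
  let f : Q → Q → Q × Q := fun s x => if x ∈ A then (x, x * s) else (x * s, x)
  let X : Finset (Q × Q) := (S 0).biUnion fun s => (hA s).toFinset.image (f s)
  have h1 : {p : Q × Q | p.1 ∈ A ∧ p.2 ∉ A ∧ CR S p.1 p.2} ⊆ (X : Set (Q × Q)) := by
    rintro ⟨x, y⟩ ⟨hx, hy, h⟩
    simp only [X, Finset.coe_biUnion, Set.mem_iUnion, Finset.mem_coe, Finset.mem_image,
      Set.Finite.mem_toFinset]
    simp only at hx hy h
    rcases h with h | h
    · refine ⟨_, h, x, ?_, ?_⟩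
      · simp only [cb, Set.mem_setOf_eq, mul_inv_cancel_left]; tauto
      · simp [f, hx]
    · refine ⟨_, h, y, ?_, ?_⟩
      · simp only [cb, Set.mem_setOf_eq, mul_inv_cancel_left]; tauto
      · simp [f, hy]
  refine (Set.encard_le_encard h1).trans ?_
  rw [Set.encard_coe_eq_coe_finsetCard]
  refine Nat.cast_le.2 (Finset.card_biUnion_le.trans ?_)
  refine Finset.sum_le_sum fun s _ => ?_
  rw [Set.ncard_eq_toFinset_card _ (hA s)]
  exact Finset.card_image_le

theorem tight {S : ℕ → Finset Q} (hI : Inf Q) (hgen : Subgroup.closure ((S 0 : Finset Q) : Set Q) = ⊤)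
    {g : Q} {A : Set Q} (hA : Cut g A) (hmin : ∀ B, Cut g B → N0 S A ≤ N0 S B) : Cn (CR S) A := by
  intro C hC hne hcl
  by_contra hneq
  obtain ⟨d, hd, hdC⟩ : ∃ d ∈ A, d ∉ C := by
    by_contra hc; push Not at hc
    exact hneq (Set.Subset.antisymm hC hc)
  have hun : ∀ s ∈ S 0, cb s C ⊆ cb s A ∧ cb s (A \ C) ⊆ cb s A ∧ Disjoint (cb s C) (cb s (A \ C)) := by
    intro s hs
    have e1 : ∀ x, x ∈ C → x * s ∈ A → x * s ∈ C := fun x hx hy => hcl x hx _ hy (.inl (by simpa using hs))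
    have e2 : ∀ x, x * s ∈ C → x ∈ A → x ∈ C := fun x hx hy => hcl _ hx _ hy (.inr (by simpa using hs))
    refine ⟨fun x hx => ?_, fun x hx => ?_, Set.disjoint_left.2 fun x hx hx' => ?_⟩
    · have := e1 x; have := e2 x; have := @hC x; have := @hC (x * s)
      simp only [cb, Set.mem_setOf_eq, Set.mem_diff] at *; tauto
    · have := e1 x; have := e2 x; have := @hC x; have := @hC (x * s)
      simp only [cb, Set.mem_setOf_eq, Set.mem_diff] at *; tauto
    · have := e1 x; have := e2 x; have := @hC x; have := @hC (x * s)
      simp only [cb, Set.mem_setOf_eq, Set.mem_diff] at *; tauto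
  have hsum : N0 S C + N0 S (A \ C) ≤ N0 S A := by
    unfold N0
    rw [← Finset.sum_add_distrib]
    refine Finset.sum_le_sum fun s hs => ?_
    obtain ⟨h1, h2, h3⟩ := hun s hs
    rw [← Set.ncard_union_eq h3 ((hA.1 s).subset h1) ((hA.1 s).subset h2)]
    exact Set.ncard_le_ncard (Set.union_subset h1 h2) (hA.1 s)
  have aiC : AI C := AI_of_gen hgen fun s hs => (hA.1 s).subset (hun s hs).1
  have aiD : AI (A \ C) := AI_of_gen hgen fun s hs => (hA.1 s).subset (hun s hs).2.1
  have hzero : ∀ B : Set Q, AI B → B ⊆ A → B.Nonempty → N0 S B ≠ 0 := by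
    rintro B aiB hB ⟨b, hb⟩ h0
    unfold N0 at h0
    rw [Finset.sum_eq_zero_iff] at h0
    have := cb_empty hgen (fun s hs => (Set.ncard_eq_zero (aiB s)).1 (h0 s hs)) hb
    obtain ⟨M, hM⟩ := hA.2.2
    exact hM M le_rfl (hB (this _))
  rcases Pl_or hI hA.ne_one aiC with h | h
  · have := hmin C ⟨aiC, h, hA.2.2.mono (Set.compl_subset_compl.2 hC)⟩
    exact hzero _ aiD Set.diff_subset ⟨d, hd, hdC⟩ (by omega)
  · have := hmin (A \ C) ⟨aiD, hA.2.1.inter h, hA.2.2.mono (Set.compl_subset_compl.2 Set.diff_subset)⟩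
    exact hzero _ aiC hC hne (by omega)

theorem tight_compl {S : ℕ → Finset Q} (hI : Inf Q) (hgen : Subgroup.closure ((S 0 : Finset Q) : Set Q) = ⊤)
    {g : Q} {A : Set Q} (hA : Cut g A) (hmin : ∀ B, Cut g B → N0 S A ≤ N0 S B) : Cn (CR S) Aᶜ := by
  refine tight hI hgen hA.compl fun B hB => ?_
  have h1 := hB.compl
  rw [inv_inv] at h1
  have := hmin _ h1
  unfold N0 at *
  simpa only [cb_compl] using this

theorem sep_finite {S : ℕ → Finset Q} (hI : Inf Q) (hgen : Subgroup.closure ((S 0 : Finset Q) : Set Q) = ⊤)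
    (K : ℕ) (x y : Q) : {A : Set Q | x ∈ A ∧ y ∉ A ∧ N0 S A ≤ K ∧
      ∃ g, Cut g A ∧ ∀ B, Cut g B → N0 S A ≤ N0 S B}.Finite := by
  refine (tight_finite K (CR S) (CR_symm S) x y (CR_conn hgen x y)).subset ?_
  rintro A ⟨h1, h2, h3, g, h4, h5⟩
  exact ⟨h1, h2, tight hI hgen h4 h5, tight_compl hI hgen h4 h5,
    (encard_cut h4.1).trans (by exact_mod_cast h3)⟩

/-- affine maps -/
def Sg (w : Q) (α : Q ≃* Q) (x : Q) : Q := w * α x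

theorem Sg_inj (w : Q) (α : Q ≃* Q) : Function.Injective (Sg w α) := fun a b h =>
  α.injective (mul_left_cancel h)

theorem mem_Sg {w : Q} {α : Q ≃* Q} {A : Set Q} {x : Q} : Sg w α x ∈ Sg w α '' A ↔ x ∈ A :=
  (Sg_inj w α).mem_set_image

theorem Sg_mul (w : Q) (α : Q ≃* Q) (x y : Q) : Sg w α (x * y) = Sg w α x * α y := by
  simp [Sg, mul_assoc]

theorem Sg_symm (w : Q) (α : Q ≃* Q) (x : Q) : Sg w α (Sg (α.symm w⁻¹) α.symm x) = x := by
  simp [Sg]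

theorem Sg_symm' (w : Q) (α : Q ≃* Q) (x : Q) : Sg (α.symm w⁻¹) α.symm (Sg w α x) = x := by
  simp [Sg]

theorem Sg_image_symm (w : Q) (α : Q ≃* Q) (A : Set Q) :
    Sg w α '' (Sg (α.symm w⁻¹) α.symm '' A) = A := by
  rw [Set.image_image]; simp only [Sg_symm, Set.image_id']

theorem cb_Sg (w : Q) (α : Q ≃* Q) (s : Q) (A : Set Q) :
    cb (α s) (Sg w α '' A) = Sg w α '' cb s A := by
  ext x
  rw [← Sg_symm w α x, mem_Sg]
  simp only [cb, Set.mem_setOf_eq]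
  rw [← Sg_mul, mem_Sg, mem_Sg]

theorem MM_Sg {S : ℕ → Finset Q} {α : Q ≃* Q} (hα : ∀ k, ∀ s ∈ S k, α s ∈ S k) (w : Q) (A : Set Q) :
    MM S (Sg w α '' A) = MM S A :=
  MM_bij α (Sg w α) (Sg_inj w α) α.injective hα (fun s => cb_Sg w α s A)

theorem AI.Sg {A : Set Q} (hA : AI A) (w : Q) (α : Q ≃* Q) : AI (Sg w α '' A) := by
  intro s
  have := cb_Sg w α (α.symm s) A
  rw [MulEquiv.apply_symm_apply] at this
  rw [this]
  exact (hA _).image _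

theorem Pl.Sg (hI : Inf Q) {g : Q} (hg : g ≠ 1) {A : Set Q} (hA : AI A) (h : Pl g A) (w : Q)
    (α : Q ≃* Q) : Pl (w * α g * w⁻¹) (Sg w α '' A) := by
  obtain ⟨M, hM⟩ := Pl_mul hI hg hA h (α.symm w⁻¹)
  refine ⟨M, fun m hm => ⟨_, hM m hm, ?_⟩⟩
  rw [Sg_mul, MulEquiv.apply_symm_apply, conj_pow]
  simp [IdxSum.Sg]

theorem Cut.Sg (hI : Inf Q) {g : Q} {A : Set Q} (hA : Cut g A) (w : Q) (α : Q ≃* Q) :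
    Cut (w * α g * w⁻¹) (Sg w α '' A) := by
  refine ⟨hA.1.Sg w α, hA.2.1.Sg hI hA.ne_one hA.1 w α, ?_⟩
  have := hA.2.2.Sg hI (inv_ne_one.2 hA.ne_one) hA.1.compl w α
  rw [Set.image_compl_eq ⟨Sg_inj w α, fun x => ⟨_, Sg_symm w α x⟩⟩] at this
  convert this using 1
  simp [mul_assoc]

theorem Min.Sg (hI : Inf Q) {S : ℕ → Finset Q} {α : Q ≃* Q} (hα : ∀ k, ∀ s ∈ S k, α s ∈ S k)
    {g : Q} {A : Set Q} (hA : Min S g A) (w : Q) : Min S (w * α g * w⁻¹) (Sg w α '' A) := by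
  refine ⟨hA.1.Sg hI w α, fun B hB => ?_⟩
  have h1 := hB.Sg hI (α.symm w⁻¹) α.symm
  have h2 : α.symm w⁻¹ * α.symm (w * α g * w⁻¹) * (α.symm w⁻¹)⁻¹ = g := by simp [mul_assoc]
  rw [h2] at h1
  have := hA.2 _ h1
  rw [MM_Sg hα]
  rwa [← MM_Sg hα w (IdxSum.Sg (α.symm w⁻¹) α.symm '' B), Sg_image_symm] at this

theorem smul_eq_Sg (q : Q) (A : Set Q) : q • A = Sg q (MulEquiv.refl Q) '' A := rfl

theorem Min.smul (hI : Inf Q) {S : ℕ → Finset Q} {g : Q} {A : Set Q} (hA : Min S g A) (q : Q) :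
    Min S (q * g * q⁻¹) (q • A) :=
  hA.Sg hI (α := MulEquiv.refl Q) (fun _ _ h => h) q

theorem MM_smul (S : ℕ → Finset Q) (q : Q) (A : Set Q) : MM S (q • A) = MM S A :=
  MM_Sg (α := MulEquiv.refl Q) (fun _ _ h => h) q A

theorem Cut.smul (hI : Inf Q) {g : Q} {A : Set Q} (hA : Cut g A) (q : Q) :
    Cut (q * g * q⁻¹) (q • A) := hA.Sg hI q (MulEquiv.refl Q)

theorem exists_step {g : Q} {A : Set Q} (hA : Cut g A) : ∃ q : Q, (1 : Q) ∈ q • A ∧ g⁻¹ ∉ q • A ∧ q * g * q⁻¹ = g := by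
  obtain ⟨-, ⟨M, hM⟩, ⟨M', hM'⟩⟩ := hA
  by_contra hc
  push Not at hc
  have key : ∀ j : ℕ, g ^ (M : ℤ) * (g⁻¹) ^ j ∈ A := by
    intro j
    induction j with
    | zero => simpa using hM M le_rfl
    | succ j ih =>
      by_contra hn
      have := hc ((g ^ (M : ℤ) * (g⁻¹) ^ j)⁻¹) (by
        rw [Set.mem_smul_set_iff_inv_smul_mem]; simpa using ih) (by
        rw [Set.mem_smul_set_iff_inv_smul_mem]
        simpa [pow_succ, mul_assoc] using hn)
      apply this
      group
  have h1 := key (M + M')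
  have h2 := hM' M' le_rfl
  apply h2
  convert h1 using 1
  rw [pow_add, ← mul_assoc]; simp

theorem exists_min (hI : Inf Q) {S : ℕ → Finset Q} (hgen : Subgroup.closure ((S 0 : Finset Q) : Set Q) = ⊤)
    {g : Q} {A0 : Set Q} (h0 : Cut g A0) : ∃ A, Min S g A := by
  classical
  have hex : ∃ k, ∃ A, Cut g A ∧ N0 S A = k := ⟨_, A0, h0, rfl⟩
  set k0 := Nat.find hex with hk0
  obtain ⟨A1, hA1, hk1⟩ := Nat.find_spec hex
  have hle : ∀ B, Cut g B → k0 ≤ N0 S B := fun B hB => Nat.find_min' hex ⟨B, hB, rfl⟩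
  let X : Set (Set Q) := {A | Cut g A ∧ N0 S A = k0 ∧ 1 ∈ A ∧ g⁻¹ ∉ A}
  have hX : X.Finite := by
    refine (sep_finite (S := S) hI hgen k0 1 g⁻¹).subset ?_
    rintro A ⟨h1, h2, h3, h4⟩
    exact ⟨h3, h4, h2.le, g, h1, fun B hB => by rw [h2]; exact hle B hB⟩
  have hN : ∀ (q : Q) (B : Set Q), N0 S (q • B) = N0 S B := by
    intro q B
    have := MM_smul S q B
    exact le_antisymm (N0_le this.le) (N0_le this.ge)
  have htr : ∀ B, Cut g B → N0 S B = k0 → ∃ q : Q, q • B ∈ X := by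
    intro B hB hk
    obtain ⟨q, h1, h2, h3⟩ := exists_step hB
    refine ⟨q, ?_, (hN q B).trans hk, h1, h2⟩
    have := hB.smul hI q
    rwa [h3] at this
  obtain ⟨q1, hq1⟩ := htr A1 hA1 hk1
  obtain ⟨A, hA, hmin⟩ := Set.exists_min_image X (MM S) hX ⟨_, hq1⟩
  refine ⟨A, hA.1, fun B hB => ?_⟩
  rcases (hle B hB).lt_or_eq with h | h
  · rw [← hA.2.1] at h
    exact (MM_lt h).le
  · obtain ⟨q, hq⟩ := htr B hB h.symm
    rw [← MM_smul S q B]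
    exact hmin _ hq

end Cuts2
end IdxSum

namespace IdxSum
open Finset
open scoped Pointwise

section Chain
variable {Q : Type*}

/-- the vertex at the head of a cut -/
def th (D : Set (Set Q)) (B : Set Q) : Set (Set Q) := {B' | B' ∈ D ∧ (B ⊆ B' ∨ (Bᶜ ⊆ B' ∧ Bᶜ ≠ B'))}

structure Nst (D : Set (Set Q)) : Prop where
  compl : ∀ A ∈ D, Aᶜ ∈ D
  nest : ∀ A ∈ D, ∀ B ∈ D, A ⊆ B ∨ B ⊆ A ∨ A ⊆ Bᶜ ∨ Aᶜ ⊆ B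
  ne : ∀ A ∈ D, A.Nonempty

theorem Nst.ex_not {D : Set (Set Q)} (h : Nst D) {A : Set Q} (hA : A ∈ D) : ∃ x, x ∉ A :=
  h.ne _ (h.compl _ hA)

theorem th_adj {D : Set (Set Q)} (h : Nst D) {A B : Set Q} (hA : A ∈ D) (hB : B ∈ D) (hBA : B ⊆ A)
    (hne : B ≠ A) (hadj : ∀ C ∈ D, B ⊆ C → C ⊆ A → C = B ∨ C = A) : th D Bᶜ = th D A := by
  obtain ⟨b, hb⟩ := h.ne B hB
  obtain ⟨a, ha⟩ := h.ex_not hA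
  ext C
  simp only [th, Set.mem_setOf_eq, compl_compl]
  refine and_congr_right fun hC => ?_
  constructor
  · rintro (h1 | ⟨h1, h2⟩)
    · right
      refine ⟨(Set.compl_subset_compl.2 hBA).trans h1, ?_⟩
      rintro rfl
      exact hne (Set.Subset.antisymm hBA (Set.compl_subset_compl.1 h1))
    · rcases h.nest A hA C hC with h3 | h3 | h3 | h3
      · exact .inl h3
      · rcases hadj C hC h1 h3 with rfl | rfl
        · exact absurd rfl h2
        · exact .inl le_rfl
      · exact absurd (h1 hb) (h3 (hBA hb))
      · refine .inr ⟨h3, ?_⟩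
        rintro rfl
        exact h1 hb (hBA hb)
  · rintro (h1 | ⟨h1, h2⟩)
    · right
      refine ⟨hBA.trans h1, ?_⟩
      rintro rfl
      exact hne (Set.Subset.antisymm hBA h1)
    · have hno : ¬ C ⊆ A := fun h3 => ha (h3 (h1 ha))
      rcases h.nest B hB C hC with h3 | h3 | h3 | h3
      · refine .inr ⟨h3, ?_⟩
        rintro rfl
        exact hno hBA
      · exact absurd (h3.trans hBA) hno
      · left
        rcases hadj Cᶜ (h.compl _ hC) h3 (Set.compl_subset_comm.1 h1) with h4 | h4
        · rw [← h4, compl_compl]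
        · exact absurd (by rw [← h4, compl_compl]) h2
      · exact .inl h3

theorem chain {D : Set (Set Q)} (h : Nst D) (s : Set (Set Q) → ℚ) {A' : Set Q} (hA' : A' ∈ D) (k : ℕ) :
    ∀ A ∈ D, A' ⊆ A → {B | B ∈ D ∧ A' ⊆ B ∧ B ⊆ A ∧ B ≠ A}.Finite →
    {B | B ∈ D ∧ A' ⊆ B ∧ B ⊆ A ∧ B ≠ A}.ncard ≤ k →
    s (th D A') - s (th D A) =
      ∑ᶠ B ∈ {B | B ∈ D ∧ A' ⊆ B ∧ B ⊆ A ∧ B ≠ A}, (s (th D B) - s (th D Bᶜ)) := by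
  obtain ⟨a', ha'⟩ := h.ne A' hA'
  induction k with
  | zero =>
    intro A hA hsub hfin hk
    have h0 := (Set.ncard_eq_zero hfin).1 (by omega)
    rw [h0, finsum_mem_empty]
    have : A' = A := by
      by_contra hne
      have : A' ∈ {B | B ∈ D ∧ A' ⊆ B ∧ B ⊆ A ∧ B ≠ A} := ⟨hA', le_rfl, hsub, hne⟩
      rw [h0] at this
      exact this
    rw [this, sub_self]
  | succ k ih =>
    intro A hA hsub hfin hk
    by_cases hne : A' = A
    · subst hne
      rw [sub_self]
      symm
      convert finsum_mem_empty
      refine Set.eq_empty_iff_forall_notMem.2 ?_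
      rintro B ⟨-, h1, h2, h3⟩
      exact h3 (Set.Subset.antisymm h2 h1)
    · obtain ⟨a, ha⟩ := h.ex_not hA
      obtain ⟨B, hBm⟩ := hfin.exists_maximal ⟨A', hA', le_rfl, hsub, hne⟩
      obtain ⟨⟨hB, hAB, hBA, hBne⟩, hmax⟩ := hBm
      have hset : {B | B ∈ D ∧ A' ⊆ B ∧ B ⊆ A ∧ B ≠ A} =
          insert B {C | C ∈ D ∧ A' ⊆ C ∧ C ⊆ B ∧ C ≠ B} := by
        ext C
        constructor
        · rintro ⟨h1, h2, h3, h4⟩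
          by_cases hCB : C = B
          · exact .inl hCB
          · right
            refine ⟨h1, h2, ?_, hCB⟩
            rcases h.nest C h1 B hB with h5 | h5 | h5 | h5
            · exact h5
            · exact hmax ⟨h1, h2, h3, h4⟩ h5
            · exact absurd (hAB ha') (h5 (h2 ha'))
            · exact absurd (hBA (h5 (fun h6 => ha (h3 h6)))) ha
        · rintro (rfl | ⟨h1, h2, h3, h4⟩)
          · exact ⟨hB, hAB, hBA, hBne⟩
          · refine ⟨h1, h2, h3.trans hBA, ?_⟩
            rintro rfl
            exact h4 (Set.Subset.antisymm h3 hBA)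
      have hnot : B ∉ {C | C ∈ D ∧ A' ⊆ C ∧ C ⊆ B ∧ C ≠ B} := fun hh => hh.2.2.2 rfl
      rw [hset] at hfin hk ⊢
      have hfin' := hfin.subset (Set.subset_insert B _)
      rw [Set.ncard_insert_of_notMem hnot hfin'] at hk
      rw [finsum_mem_insert _ hnot hfin', ← ih B hB hAB hfin' (by omega)]
      have : th D Bᶜ = th D A := by
        apply th_adj h hA hB hBA hBne
        intro C hC h1 h2
        by_cases hCA : C = A
        · exact .inr hCA
        · exact .inl (Set.Subset.antisymm (hmax ⟨hC, hAB.trans h1, h2, hCA⟩ h1) h1)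
      rw [this]; ring

theorem exists_s {F X : Type*} [Group F] [MulAction F X] (χ : F → ℚ) (hχ : ∀ a b, χ (a * b) = χ a + χ b) :
    ∃ s : X → ℚ, ∀ x : X, (∀ f : F, f • x = x → f = 1) → ∀ f : F, s (f • x) = s x + χ f := by
  classical
  let r : X → X := fun x => Quotient.out (s := MulAction.orbitRel F X) (Quotient.mk _ x)
  have hr : ∀ x, ∃ f : F, f • r x = x := fun x => by
    have : (MulAction.orbitRel F X) (r x) x := Quotient.mk_out (s := MulAction.orbitRel F X) x
    obtain ⟨f, hf⟩ := this
    exact ⟨f⁻¹, by rw [← hf, inv_smul_smul]⟩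
  have hr2 : ∀ x (f : F), r (f • x) = r x := fun x f => by
    have : (Quotient.mk (MulAction.orbitRel F X) (f • x)) = Quotient.mk (MulAction.orbitRel F X) x :=
      Quotient.sound ⟨f, rfl⟩
    simp only [r, this]
  choose p hp using hr
  refine ⟨fun x => χ (p x), fun x hx f => ?_⟩
  have h1 := hp (f • x)
  rw [hr2] at h1
  have h2 := hp x
  have h3 : (f * p x)⁻¹ * p (f • x) = 1 := by
    have e : ((f * p x)⁻¹ * p (f • x)) • r x = r x := by
      rw [mul_smul, h1, inv_smul_eq_iff, mul_smul, h2]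
    have : (p x * ((f * p x)⁻¹ * p (f • x)) * (p x)⁻¹) • x = x := by
      have e' : (p x)⁻¹ • x = r x := by rw [inv_smul_eq_iff]; exact h2.symm
      rw [mul_smul, mul_smul, e', e, h2]
    have := hx _ this
    rwa [conj_eq_one_iff] at this
  have h4 : p (f • x) = f * p x := by rw [inv_mul_eq_one] at h3; exact h3.symm
  show χ (p (f • x)) = _
  rw [h4, hχ, add_comm]

end Chain

section Lam
variable {Q : Type*} [Group Q]

open Classical in
theorem exists_lam {C : Set (Set Q)} (hC : ∀ x y : Q, {B | B ∈ C ∧ x ∈ B ∧ y ∉ B}.Finite)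
    (κ : Set Q → ℚ) (hsupp : ∀ B, κ B ≠ 0 → B ∈ C) (hinv : ∀ (q : Q) B, κ (q • B) = κ B) :
    ∃ Λ : Q → ℚ, (∀ a b, Λ (a * b) = Λ a + Λ b) ∧ ∀ e : Set Q → ℚ,
      {B | B ∈ C ∧ e B ≠ if (1 : Q) ∈ B then 1 else 0}.Finite →
      ∀ g : Q, Λ g = 2⁻¹ * ∑ᶠ B, κ B * (e (g⁻¹ • B) - e B) := by
  let e1 : Q → Set Q → ℚ := fun x B => if x ∈ B then 1 else 0
  let c : (Set Q → ℚ) → (Set Q → ℚ) → ℚ := fun e e' => ∑ᶠ B, κ B * (e B - e' B)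
  let ok : (Set Q → ℚ) → (Set Q → ℚ) → Prop := fun e e' => {B | κ B ≠ 0 ∧ e B ≠ e' B}.Finite
  have ok_trans : ∀ a b d, ok a b → ok b d → ok a d := by
    intro a b d h1 h2
    refine (h1.union h2).subset ?_
    rintro B ⟨hB, h⟩
    by_cases hab : a B = b B
    · exact .inr ⟨hB, fun h' => h (hab.trans h')⟩
    · exact .inl ⟨hB, hab⟩
  have ok_symm : ∀ a b, ok a b → ok b a := fun a b h => h.subset fun B hB => ⟨hB.1, hB.2.symm⟩
  have ok1 : ∀ x y, ok (e1 x) (e1 y) := by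
    intro x y
    refine ((hC x y).union (hC y x)).subset ?_
    rintro B ⟨hB, h⟩
    have hB := hsupp B hB
    simp only [e1] at h
    by_cases hx : x ∈ B <;> by_cases hy : y ∈ B <;> simp [hx, hy] at h
    · exact .inl ⟨hB, hx, hy⟩
    · exact .inr ⟨hB, hy, hx⟩
  have cadd : ∀ a b d, ok a b → ok b d → c a d = c a b + c b d := by
    intro a b d h1 h2
    simp only [c]
    rw [← finsum_add_distrib]
    · congr 1; funext B; ring
    · refine h1.subset fun B hB => ?_
      rw [Function.mem_support] at hB
      exact ⟨left_ne_zero_of_mul hB, sub_ne_zero.1 (right_ne_zero_of_mul hB)⟩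
    · refine h2.subset fun B hB => ?_
      rw [Function.mem_support] at hB
      exact ⟨left_ne_zero_of_mul hB, sub_ne_zero.1 (right_ne_zero_of_mul hB)⟩
  let tt : Q → (Set Q → ℚ) → (Set Q → ℚ) := fun g e B => e (g⁻¹ • B)
  have okt : ∀ g a b, ok a b → ok (tt g a) (tt g b) := by
    intro g a b h
    refine (h.image (fun B => g • B)).subset ?_
    rintro B ⟨h1, h2⟩
    exact ⟨g⁻¹ • B, ⟨by rwa [hinv], h2⟩, smul_inv_smul g B⟩
  have ct : ∀ g a b, c (tt g a) (tt g b) = c a b := by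
    intro g a b
    simp only [c, tt]
    refine (finsum_eq_of_bijective (fun B => g • B) (MulAction.bijective g) fun B => ?_).symm
    simp only [inv_smul_smul, hinv]
  have t1 : ∀ g x, tt g (e1 x) = e1 (g * x) := by
    intro g x
    funext B
    simp only [tt, e1, Set.mem_inv_smul_set_iff, smul_eq_mul]
  refine ⟨fun g => 2⁻¹ * c (e1 g) (e1 1), ?_, ?_⟩
  · intro a b
    have h1 : e1 (a * b) = tt a (e1 b) := (t1 a b).symm
    have h2 : e1 a = tt a (e1 1) := by rw [t1, mul_one]
    show 2⁻¹ * c (e1 (a * b)) (e1 1) = 2⁻¹ * c (e1 a) (e1 1) + 2⁻¹ * c (e1 b) (e1 1)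
    rw [cadd (e1 (a * b)) (e1 a) (e1 1) (ok1 _ _) (ok1 _ _)]
    have : c (e1 (a * b)) (e1 a) = c (e1 b) (e1 1) := by rw [h1, h2]; exact ct a (e1 b) (e1 1)
    rw [this]; ring
  · intro e he g
    have oke : ok e (e1 1) := he.subset fun B hB => ⟨hsupp B hB.1, hB.2⟩
    have h2 : e1 g = tt g (e1 1) := by rw [t1, mul_one]
    show 2⁻¹ * c (e1 g) (e1 1) = 2⁻¹ * c (tt g e) e
    have oke2 : ok (tt g e) (e1 g) := by rw [h2]; exact okt g _ _ oke
    rw [cadd (tt g e) (e1 g) e oke2 (ok_trans _ _ _ (ok1 _ _) (ok_symm _ _ oke)),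
      cadd (e1 g) (e1 1) e (ok1 _ _) (ok_symm _ _ oke)]
    have e1' : c (tt g e) (e1 g) = c e (e1 1) := by rw [h2]; exact ct g e (e1 1)
    have e2' : c e (e1 1) + c (e1 1) e = 0 := by
      rw [← cadd _ _ _ oke (ok_symm _ _ oke)]; simp [c]
    rw [e1']; linear_combination (-2⁻¹) * e2'

open Classical in
/-- indicator of a vertex -/
noncomputable def ev (A B : Set Q) : ℚ := if A ⊆ B ∨ (Aᶜ ⊆ B ∧ Aᶜ ≠ B) then 1 else 0

open Classical in
theorem ev_diff {C : Set (Set Q)} (h : Nst C) {A' A : Set Q} (hA' : A' ∈ C) (hA : A ∈ C) (hs : A' ⊆ A)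
    {B : Set Q} (hB : B ∈ C) : ev A' B - ev A B =
      (if A' ⊆ B ∧ B ⊆ A ∧ B ≠ A then 1 else 0) - if A' ⊆ Bᶜ ∧ Bᶜ ⊆ A ∧ Bᶜ ≠ A then 1 else 0 := by
  have key : ∀ B ∈ C, (A' ⊆ B ∨ (A'ᶜ ⊆ B ∧ A'ᶜ ≠ B)) ∧ ¬(A ⊆ B ∨ (Aᶜ ⊆ B ∧ Aᶜ ≠ B)) ↔
      (A' ⊆ B ∧ B ⊆ A ∧ B ≠ A) := by
    intro B hB
    obtain ⟨a', ha'⟩ := h.ne _ hA'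
    obtain ⟨a, ha⟩ := h.ex_not hA
    constructor
    · rintro ⟨h1, h2⟩
      push Not at h2
      have hsc := Set.compl_subset_compl.2 hs
      have h1' : A' ⊆ B := by
        rcases h1 with h1 | ⟨h1, h1'⟩
        · exact h1
        · have h3 := h2.2 (hsc.trans h1)
          exfalso; apply h1'
          exact Set.Subset.antisymm h1 (h3 ▸ hsc)
      rcases h.nest A hA B hB with h3 | h3 | h3 | h3
      · exact absurd h3 h2.1
      · exact ⟨h1', h3, fun e => h2.1 e.ge⟩
      · exact absurd (h1' ha') (h3 (hs ha'))
      · have := h2.2 h3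
        rw [← this] at h1'
        exact absurd (hs ha') (h1' ha')
    · rintro ⟨h1, h2, h3⟩
      refine ⟨.inl h1, ?_⟩
      rintro (h4 | ⟨h4, -⟩)
      · exact h3 (Set.Subset.antisymm h2 h4)
      · exact ha (h2 (h4 ha))
  have hc : ∀ A ∈ C, ((A ⊆ Bᶜ ∨ (Aᶜ ⊆ Bᶜ ∧ Aᶜ ≠ Bᶜ)) ↔ ¬(A ⊆ B ∨ (Aᶜ ⊆ B ∧ Aᶜ ≠ B))) := by
    intro A hA
    obtain ⟨a', ha'⟩ := h.ne _ hA
    obtain ⟨b, hb⟩ := h.ne _ hB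
    obtain ⟨a, ha⟩ := h.ex_not hA
    constructor
    · rintro (h1 | ⟨h1, h2⟩) (h3 | ⟨h3, h4⟩)
      · exact h1 ha' (h3 ha')
      · exact h4 (Set.Subset.antisymm h3 (Set.subset_compl_comm.1 h1))
      · exact h2 (by rw [Set.Subset.antisymm h3 (Set.compl_subset_compl.1 h1)])
      · exact h1 ha (h3 ha)
    · intro h1
      push Not at h1
      rcases h.nest A hA B hB with h3 | h3 | h3 | h3
      · exact absurd h3 h1.1
      · refine .inr ⟨Set.compl_subset_compl.2 h3, fun e => h1.1 ?_⟩
        rw [compl_inj_iff.1 e]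
      · exact .inl h3
      · have := h1.2 h3
        left; rw [← this, compl_compl]
  have k1 := key B hB
  have k2 := key Bᶜ (h.compl _ hB)
  rw [hc A' hA', hc A hA] at k2
  unfold ev
  have aux : ∀ p q r t : Prop, (p ∧ ¬q ↔ r) → (¬p ∧ ¬¬q ↔ t) →
      ((if p then (1 : ℚ) else 0) - if q then 1 else 0) = (if r then 1 else 0) - if t then 1 else 0 := by
    intro p q r t h1 h2
    by_cases p <;> by_cases q <;> by_cases r <;> by_cases t <;> simp_all
  convert aux _ _ _ _ k1 k2
end Lam
end IdxSum

namespace IdxSum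
open Finset
open scoped Pointwise

section ThC
variable {Q : Type*} [Group Q]

/-- the family of minimal cuts -/
def CC (S : ℕ → Finset Q) : Set (Set Q) := {A | ∃ g, Min S g A}

theorem Pl.nonempty {g : Q} {A : Set Q} (h : Pl g A) : A.Nonempty := by
  obtain ⟨M, hM⟩ := h
  exact ⟨_, hM M le_rfl⟩

theorem CC_nst (hI : Inf Q) {S : ℕ → Finset Q} (hS : ∀ s, ∃ k, s ∈ S k) : Nst (CC S) where
  compl := by rintro A ⟨g, hg⟩; exact ⟨_, hg.compl⟩
  nest := by rintro A ⟨g, hg⟩ B ⟨h, hh⟩; exact nested hI hS hg hh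
  ne := by rintro A ⟨g, hg⟩; exact hg.1.2.1.nonempty

theorem CC_fin (hI : Inf Q) {S : ℕ → Finset Q} (hgen : Subgroup.closure ((S 0 : Finset Q) : Set Q) = ⊤)
    {K : ℕ} (hK : ∀ g : Q, g ≠ 1 → ∃ A, Cut g A ∧ N0 S A ≤ K) (x y : Q) :
    {B | B ∈ CC S ∧ x ∈ B ∧ y ∉ B}.Finite := by
  refine (sep_finite hI hgen K x y).subset ?_
  rintro B ⟨⟨g, hg⟩, h1, h2⟩
  obtain ⟨A, hA, hAK⟩ := hK g hg.1.ne_one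
  exact ⟨h1, h2, (N0_le (hg.2 A hA)).trans hAK, g, hg.1, fun B hB => N0_le (hg.2 B hB)⟩

theorem CC_stab (hI : Inf Q) {S : ℕ → Finset Q} {A : Set Q} (hA : A ∈ CC S) {q : Q} (hq : q • A = A) : q = 1 := by
  by_contra hne
  obtain ⟨g, hg⟩ := hA
  obtain ⟨a, ha⟩ := hg.1.2.1.nonempty
  obtain ⟨a', ha'⟩ := hg.1.2.2.nonempty
  have hpow : ∀ (m : ℕ) x, (q ^ m * x ∈ A ↔ x ∈ A) := by
    intro m x
    induction m with
    | zero => simp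
    | succ m ih =>
      rw [pow_succ', mul_assoc]
      conv_lhs => rw [← hq]
      rw [← smul_eq_mul, Set.smul_mem_smul_set_iff, ih]
  have hfin := hg.1.1 (a⁻¹ * a')
  have : (Set.range fun m : ℕ => q ^ m * a).Infinite :=
    Set.infinite_range_of_injective fun m m' h => hI q hne (mul_right_cancel h)
  refine this (hfin.subset ?_)
  rintro _ ⟨m, rfl⟩
  simp only [cb, Set.mem_setOf_eq]
  rw [hpow, mul_assoc, mul_inv_cancel_left, hpow]
  intro h
  exact ha' (h.1 ha)

theorem star (hI : Inf Q) {S : ℕ → Finset Q} (hS : ∀ s, ∃ k, s ∈ S k) {α : Q ≃* Q}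
    (hα : ∀ k, ∀ s ∈ S k, α s ∈ S k) {w : Q} {L : ℕ} (hL1 : 1 ≤ L) (hL : (Sg w α)^[L] = id)
    {f : Q} (hf : w * α f * w⁻¹ = f) {B : Set Q} (hB : B ∈ CC S) (hc : Cut f B) : Sg w α '' B = B := by
  have h1 := hc.Sg hI w α
  rw [hf] at h1
  have h2 : Sg w α '' B ∈ CC S := by
    obtain ⟨g, hg⟩ := hB
    exact ⟨_, hg.Sg hI hα w⟩
  have h3 : B ⊆ Sg w α '' B ∨ Sg w α '' B ⊆ B := by
    rcases (CC_nst hI hS).nest _ hB _ h2 with h | h | h | h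
    · exact .inl h
    · exact .inr h
    · exact absurd (hc.2.1.mono h) h1.2.1.not_compl
    · refine absurd (hc.2.2.mono h) ?_
      have := h1.2.2.not_compl
      rwa [compl_compl] at this
  have himg : ∀ m, (fun X => Sg w α '' X)^[m] B = (Sg w α)^[m] '' B := by
    intro m
    induction m with
    | zero => simp
    | succ m ih => rw [Function.iterate_succ_apply', ih, Function.iterate_succ', Set.image_comp]
  have hper : (fun X => Sg w α '' X)^[L] B = B := by rw [himg, hL, Set.image_id]
  obtain ⟨L, rfl⟩ : ∃ k, L = k + 1 := ⟨L - 1, by omega⟩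
  have mono : Monotone (fun X : Set Q => Sg w α '' X) := fun _ _ h => Set.image_mono h
  rw [Function.iterate_succ_apply] at hper
  rcases h3 with h | h
  · refine Set.Subset.antisymm ?_ h
    conv_rhs => rw [← hper]
    exact (mono.monotone_iterate_of_le_map (f := fun X : Set Q => Sg w α '' X)
      (x := Sg w α '' B) (mono h)) (Nat.zero_le L)
  · refine Set.Subset.antisymm h ?_
    conv_lhs => rw [← hper]
    exact (mono.antitone_iterate_of_map_le (f := fun X : Set Q => Sg w α '' X)
      (x := Sg w α '' B) (mono h)) (Nat.zero_le L)

theorem exists_axis (hI : Inf Q) {S : ℕ → Finset Q} (hS : ∀ s, ∃ k, s ∈ S k)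
    (hgen : Subgroup.closure ((S 0 : Finset Q) : Set Q) = ⊤)
    {K : ℕ} (hK : ∀ g : Q, g ≠ 1 → ∃ A, Cut g A ∧ N0 S A ≤ K) {f : Q} (hf : f ≠ 1) :
    ∃ A, Min S f A ∧ f • A ⊆ A := by
  obtain ⟨A0, hA0, -⟩ := hK f hf
  obtain ⟨A, hA⟩ := exists_min hI hgen hA0
  refine ⟨A, hA, ?_⟩
  have h1 := hA.smul hI f
  rw [mul_inv_cancel_right] at h1
  rcases nested hI hS hA h1 with h | h | h | h
  · exfalso
    obtain ⟨a, ha⟩ := hA.1.2.1.nonempty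
    have key : ∀ m : ℕ, f⁻¹ ^ m * a ∈ A := by
      intro m
      induction m with
      | zero => simpa
      | succ m ih =>
        have := h ih
        rw [Set.mem_smul_set_iff_inv_smul_mem, smul_eq_mul, ← mul_assoc, ← pow_succ'] at this
        exact this
    obtain ⟨M, hM⟩ := Pl_mul hI (inv_ne_one.2 hf) hA.1.1.compl hA.1.2.2 a
    exact hM M le_rfl (key M)
  · exact h
  · exact absurd (hA.1.2.1.mono h) h1.1.2.1.not_compl
  · refine absurd (hA.1.2.2.mono h) ?_
    have := h1.1.2.2.not_compl
    rwa [compl_compl] at this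

theorem th_smul {D : Set (Set Q)} {f : Q} (hD : ∀ B, f • B ∈ D ↔ B ∈ D) (A : Set Q) :
    f • th D A = th D (f • A) := by
  ext B
  rw [Set.mem_smul_set_iff_inv_smul_mem]
  simp only [th, Set.mem_setOf_eq]
  rw [← hD (f⁻¹ • B), smul_inv_smul, Set.subset_smul_set_iff, Set.subset_smul_set_iff, inv_inv,
    ← Set.smul_set_compl]
  have : Aᶜ ≠ f⁻¹ • B ↔ f • Aᶜ ≠ B := by rw [ne_eq, ne_eq, eq_inv_smul_iff]
  rw [this]

theorem th_free (hI : Inf Q) {S : ℕ → Finset Q} (hS : ∀ s, ∃ k, s ∈ S k)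
    {D : Set (Set Q)} (hDC : D ⊆ CC S) {f : Q} (hf : f ≠ 1) {C : Set Q} (hC : Cut f C) (hCD : C ∈ D)
    (hD : ∀ B, f • B ∈ D ↔ B ∈ D) {A : Set Q} (hA : A ∈ D) : f • th D A ≠ th D A := by
  intro heq
  have hN := CC_nst hI hS
  obtain ⟨a, ha⟩ := hN.ne _ (hDC hA)
  obtain ⟨a', ha'⟩ := hN.ex_not (hDC hA)
  have hD' : ∀ (k : ℕ), f ^ k • C ∈ D := by
    intro k
    induction k with
    | zero => simpa
    | succ k ih => rw [pow_succ', mul_smul, hD]; exact ih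
  have hD2 : ∀ (k : ℕ), f⁻¹ ^ k • C ∈ D := by
    intro k
    induction k with
    | zero => simpa
    | succ k ih => rw [pow_succ', mul_smul, ← hD, smul_inv_smul]; exact ih
  have hX : ∀ B, f • B ∈ th D A ↔ B ∈ th D A := by
    intro B
    conv_lhs => rw [← heq]
    rw [Set.smul_mem_smul_set_iff]
  by_cases hCX : C ∈ th D A
  · have h1 : ∀ k : ℕ, f ^ k • C ∈ th D A := by
      intro k
      induction k with
      | zero => simpa
      | succ k ih => rw [pow_succ', mul_smul, hX]; exact ih
    obtain ⟨M, hM⟩ := Pl_mul hI (inv_ne_one.2 hf) hC.1.compl hC.2.2 a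
    obtain ⟨M', hM'⟩ := Pl_mul hI (inv_ne_one.2 hf) hC.1.compl hC.2.2 a'
    have e : ∀ k x, x ∈ f ^ k • C ↔ f⁻¹ ^ k * x ∈ C := by
      intro k x
      rw [Set.mem_smul_set_iff_inv_smul_mem, smul_eq_mul, inv_pow]
    rcases (h1 (M + M')).2 with h | h
    · exact hM (M + M') (by omega) ((e _ _).1 (h ha))
    · exact hM' (M + M') (by omega) ((e _ _).1 (h.1 ha'))
  · have h1 : ∀ k : ℕ, f⁻¹ ^ k • C ∉ th D A := by
      intro k
      induction k with
      | zero => simpa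
      | succ k ih => rw [pow_succ', mul_smul, ← hX, smul_inv_smul]; exact ih
    obtain ⟨M, hM⟩ := Pl_mul hI hf hC.1 hC.2.1 a
    obtain ⟨M', hM'⟩ := Pl_mul hI hf hC.1 hC.2.1 a'
    have e : ∀ k x, x ∈ f⁻¹ ^ k • C ↔ f ^ k * x ∈ C := by
      intro k x
      rw [Set.mem_smul_set_iff_inv_smul_mem, smul_eq_mul, inv_pow, inv_inv]
    have e1 := (e _ _).2 (hM (M + M') (by omega))
    have e2 := (e _ _).2 (hM' (M + M') (by omega))
    have e3 := h1 (M + M')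
    have e4 := hD2 (M + M')
    rcases hN.nest _ (hDC hA) _ (hDC e4) with h | h | h | h
    · exact e3 ⟨e4, .inl h⟩
    · exact ha' (h e2)
    · exact h ha e1
    · refine e3 ⟨e4, .inr ⟨h, ?_⟩⟩
      intro h5
      rw [← h5] at e1
      exact e1 ha

theorem Sg_smul (w v : Q) (α : Q ≃* Q) (p : Q) (E : Set Q) :
    Sg w α '' (p • E) = (w * α p * v⁻¹) • (Sg v α '' E) := by
  ext x
  constructor
  · rintro ⟨_, ⟨y, hy, rfl⟩, rfl⟩
    exact ⟨Sg v α y, ⟨y, hy, rfl⟩, by simp [Sg, mul_assoc]⟩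
  · rintro ⟨_, ⟨y, hy, rfl⟩, rfl⟩
    exact ⟨p • y, ⟨y, hy, rfl⟩, by simp [Sg, mul_assoc]⟩

open Classical in
theorem thmC (hI : Inf Q) {S : ℕ → Finset Q} (hS : ∀ s, ∃ k, s ∈ S k)
    (hgen : Subgroup.closure ((S 0 : Finset Q) : Set Q) = ⊤) {α : Q ≃* Q}
    (hα : ∀ k, ∀ s ∈ S k, α s ∈ S k)
    {K : ℕ} (hK : ∀ g : Q, g ≠ 1 → ∃ A, Cut g A ∧ N0 S A ≤ K)
    {ι : Type*} (w : ι → Q) (hw : ∀ i, ∃ L, 1 ≤ L ∧ (Sg (w i) α)^[L] = id)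
    (hdist : ∀ i j, i ≠ j → ∀ q, w i ≠ q⁻¹ * w j * α q)
    (F : ι → Subgroup Q) (hF : ∀ i f, f ∈ F i ↔ w i * α f * (w i)⁻¹ = f)
    (χ : ∀ i, F i → ℚ) (hχ : ∀ i a b, χ i (a * b) = χ i a + χ i b) :
    ∃ Λ : Q → ℚ, (∀ a b, Λ (a * b) = Λ a + Λ b) ∧ ∀ i (f : F i), Λ f = χ i f := by
  have hN := CC_nst hI hS
  have hfin := CC_fin hI hgen hK
  let D : ι → Set (Set Q) := fun i => {A | A ∈ CC S ∧ Sg (w i) α '' A = A}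
  have hDC : ∀ i, D i ⊆ CC S := fun i A h => h.1
  have smulC : ∀ (q : Q) A, A ∈ CC S → q • A ∈ CC S := by
    rintro q A ⟨g, hg⟩; exact ⟨_, hg.smul hI q⟩
  have hDN : ∀ i, Nst (D i) := fun i =>
    { compl := fun A hA => ⟨hN.compl A hA.1, by
        rw [Set.image_compl_eq ⟨Sg_inj _ α, fun x => ⟨_, Sg_symm _ α x⟩⟩, hA.2]⟩
      nest := fun A hA B hB => hN.nest A hA.1 B hB.1
      ne := fun A hA => hN.ne A hA.1 }
  have hDs1 : ∀ i, ∀ f ∈ F i, ∀ B, B ∈ D i → f • B ∈ D i := by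
    intro i f hf B hB
    refine ⟨smulC _ _ hB.1, ?_⟩
    rw [Sg_smul (w i) (w i), hB.2, (hF i f).1 hf]
  have hDs : ∀ i, ∀ f ∈ F i, ∀ B, f • B ∈ D i ↔ B ∈ D i := by
    intro i f hf B
    refine ⟨fun h => ?_, hDs1 i f hf B⟩
    have := hDs1 i f⁻¹ (inv_mem hf) _ h
    rwa [inv_smul_smul] at this
  have hstar : ∀ i, ∀ f ∈ F i, ∀ B ∈ CC S, Cut f B → B ∈ D i := by
    intro i f hf B hB hc
    obtain ⟨L, hL1, hL⟩ := hw i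
    exact ⟨hB, star hI hS hα hL1 hL ((hF i f).1 hf) hB hc⟩
  have hfree : ∀ i, ∀ A ∈ D i, ∀ f : F i, f • th (D i) A = th (D i) A → f = 1 := by
    intro i A hA f hf
    by_contra hne
    have hne' : (f : Q) ≠ 1 := fun h => hne (Subtype.ext h)
    obtain ⟨C, hC, -⟩ := exists_axis hI hS hgen hK hne'
    exact th_free hI hS (hDC i) hne' hC.1 (hstar i f f.2 C ⟨_, hC⟩ hC.1) (hDs i f f.2) hA hf
  have hs : ∀ i, ∃ s : Set (Set Q) → ℚ, ∀ A ∈ D i, ∀ f : F i,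
      s (th (D i) ((f : Q) • A)) = s (th (D i) A) + χ i f := by
    intro i
    obtain ⟨s, hs⟩ := exists_s (X := Set (Set Q)) (χ i) (hχ i)
    refine ⟨s, fun A hA f => ?_⟩
    rw [← th_smul (hDs i f f.2)]
    exact hs _ (hfree i A hA) f
  choose s hs using hs
  let κ : ι → Set Q → ℚ := fun i B => s i (th (D i) B) - s i (th (D i) Bᶜ)
  have κinv : ∀ i, ∀ f ∈ F i, ∀ B ∈ D i, κ i (f • B) = κ i B := by
    intro i f hf B hB
    simp only [κ]
    rw [← Set.smul_set_compl, hs i B hB ⟨f, hf⟩, hs i Bᶜ ((hDN i).compl B hB) ⟨f, hf⟩]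
    ring
  have wd : ∀ i j (p : Q) E, E ∈ D i → p • E ∈ D j → i = j ∧ p ∈ F i := by
    intro i j p E hE hpE
    have h1 := hpE.2
    rw [Sg_smul (w j) (w i), hE.2, ← inv_smul_eq_iff, ← mul_smul] at h1
    have h2 := CC_stab hI hE.1 h1
    have h3 : w i = p⁻¹ * w j * α p := by
      have := eq_of_mul_inv_eq_one (a := p⁻¹ * w j * α p) (b := w i) (by simpa [mul_assoc] using h2)
      exact this.symm
    have h4 : i = j := by
      by_contra hne
      exact hdist i j hne p h3
    refine ⟨h4, ?_⟩
    subst h4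
    rw [hF, mul_inv_eq_iff_eq_mul]
    nth_rewrite 2 [h3]
    group
  let κ' : Set Q → ℚ := fun B => if h : ∃ i, ∃ q : Q, q • B ∈ D i then κ h.choose (h.choose_spec.choose • B) else 0
  have κ'eq : ∀ i (q : Q) B, q • B ∈ D i → κ' B = κ i (q • B) := by
    intro i q B hq
    have h : ∃ i, ∃ q : Q, q • B ∈ D i := ⟨i, q, hq⟩
    simp only [κ', dif_pos h]
    have h1 := h.choose_spec.choose_spec
    generalize h.choose_spec.choose = q' at *
    generalize h.choose = j at *
    obtain ⟨rfl, h3⟩ := wd i j (q' * q⁻¹) (q • B) hq (by rwa [← mul_smul, inv_mul_cancel_right])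
    rw [← κinv i _ h3 _ hq, ← mul_smul, inv_mul_cancel_right]
  have κ'no : ∀ B, (¬ ∃ i, ∃ q : Q, q • B ∈ D i) → κ' B = 0 := fun B h => by simp only [κ', dif_neg h]
  have κ'supp : ∀ B, κ' B ≠ 0 → B ∈ CC S := by
    intro B hB
    by_contra hc
    apply hB
    apply κ'no
    rintro ⟨i, q, h⟩
    apply hc
    have := smulC q⁻¹ _ h.1
    rwa [inv_smul_smul] at this
  have κ'inv : ∀ (q : Q) B, κ' (q • B) = κ' B := by
    intro g B
    by_cases h : ∃ i, ∃ q : Q, q • B ∈ D i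
    · obtain ⟨i, q, hq⟩ := h
      rw [κ'eq i q B hq, κ'eq i (q * g⁻¹) (g • B) (by rwa [← mul_smul, inv_mul_cancel_right]),
        ← mul_smul, inv_mul_cancel_right]
    · rw [κ'no B h, κ'no]
      rintro ⟨i, q, hq⟩
      exact h ⟨i, q * g, by rwa [mul_smul]⟩
  have κ'odd : ∀ B, κ' Bᶜ = - κ' B := by
    intro B
    by_cases h : ∃ i, ∃ q : Q, q • B ∈ D i
    · obtain ⟨i, q, hq⟩ := h
      have hq' : q • Bᶜ ∈ D i := by rw [Set.smul_set_compl]; exact (hDN i).compl _ hq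
      rw [κ'eq i q B hq, κ'eq i q Bᶜ hq']
      simp only [κ]
      rw [Set.smul_set_compl, compl_compl]; ring
    · rw [κ'no B h, κ'no, neg_zero]
      rintro ⟨i, q, hq⟩
      refine h ⟨i, q, ?_⟩
      rw [Set.smul_set_compl] at hq
      have := (hDN i).compl _ hq
      rwa [compl_compl] at this
  obtain ⟨Λ, hadd, hΛ⟩ := exists_lam hfin κ' κ'supp κ'inv
  refine ⟨Λ, hadd, fun i f => ?_⟩
  by_cases hf1 : f = 1
  · subst hf1
    have h1 := hadd 1 1
    have h2 := hχ i 1 1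
    rw [mul_one] at h1 h2
    have e1 : Λ 1 = 0 := by linarith
    have e2 : χ i 1 = 0 := by linarith
    rw [e2]; exact e1
  have hf1' : (f : Q) ≠ 1 := fun h => hf1 (Subtype.ext h)
  obtain ⟨A, hA, hfA⟩ := exists_axis hI hS hgen hK hf1'
  have hAC : A ∈ CC S := ⟨_, hA⟩
  have hAD := hstar i f f.2 A hAC hA.1
  have hfAD := hDs1 i f f.2 A hAD
  obtain ⟨a, ha⟩ := hN.ne _ hAC
  obtain ⟨a', ha'⟩ := hN.ex_not hAC
  have hok : {B | B ∈ CC S ∧ ev A B ≠ if (1 : Q) ∈ B then 1 else 0}.Finite := by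
    refine (((hfin a 1).union (hfin a' 1)).union ((hfin 1 a).union (hfin 1 a'))).subset ?_
    rintro B ⟨hB, h⟩
    unfold ev at h
    by_cases h1 : A ⊆ B ∨ (Aᶜ ⊆ B ∧ Aᶜ ≠ B)
    · by_cases h2 : (1 : Q) ∈ B
      · exact absurd (by rw [if_pos h1, if_pos h2]) h
      · left
        rcases h1 with h1 | h1
        · exact .inl ⟨hB, h1 ha, h2⟩
        · exact .inr ⟨hB, h1.1 ha', h2⟩
    · by_cases h2 : (1 : Q) ∈ B
      · right
        push Not at h1
        rcases hN.nest _ hAC _ hB with h3 | h3 | h3 | h3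
        · exact absurd h3 h1.1
        · exact .inr ⟨hB, h2, fun h4 => ha' (h3 h4)⟩
        · exact .inl ⟨hB, h2, h3 ha⟩
        · refine .inl ⟨hB, h2, ?_⟩
          rw [← h1.2 h3]
          exact fun h4 => h4 ha
      · exact absurd (by rw [if_neg h1, if_neg h2]) h
  rw [hΛ (ev A) hok f]
  have hev : ∀ B, ev A ((f : Q)⁻¹ • B) = ev ((f : Q) • A) B := by
    intro B
    unfold ev
    rw [Set.subset_smul_set_iff, Set.subset_smul_set_iff, inv_inv, ← Set.smul_set_compl]
    have : Aᶜ ≠ (f : Q)⁻¹ • B ↔ (f : Q) • Aᶜ ≠ B := by rw [ne_eq, ne_eq, eq_inv_smul_iff]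
    simp only [this]
  let D' : Set (Set Q) := {B | B ∈ D i ∧ (f : Q) • A ⊆ B ∧ B ⊆ A ∧ B ≠ A}
  have hD'f : D'.Finite := by
    refine (hfin (f * a) a').subset ?_
    rintro B ⟨h1, h2, h3, h4⟩
    exact ⟨h1.1, h2 (Set.smul_mem_smul_set ha), fun h => ha' (h3 h)⟩
  have hcutA := hA.1.smul hI f
  rw [mul_inv_cancel_right] at hcutA
  have hD'iff : ∀ B ∈ CC S, ((f : Q) • A ⊆ B ∧ B ⊆ A ∧ B ≠ A) ↔ B ∈ D' := by
    intro B hB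
    refine ⟨fun h => ⟨hstar i f f.2 B hB ?_, h⟩, fun h => h.2⟩
    obtain ⟨g, hg⟩ := hB
    exact ⟨hg.1.1, hcutA.2.1.mono h.1, hA.1.2.2.mono (Set.compl_subset_compl.2 h.2.1)⟩
  have hterm : ∀ B, κ' B * (ev A ((f : Q)⁻¹ • B) - ev A B) =
      (if B ∈ D' then κ' B else 0) + (if Bᶜ ∈ D' then κ' Bᶜ else 0) := by
    intro B
    rw [hev, κ'odd]
    by_cases hB : B ∈ CC S
    · rw [ev_diff hN hfAD.1 hAC hfA hB]
      simp only [hD'iff B hB, hD'iff Bᶜ (hN.compl _ hB)]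
      by_cases h1 : B ∈ D' <;> by_cases h2 : Bᶜ ∈ D' <;> simp [h1, h2]
    · have : κ' B = 0 := by
        by_contra h
        exact hB (κ'supp B h)
      simp [this]
  simp_rw [hterm]
  have hsum : ∑ᶠ B, (if B ∈ D' then κ' B else 0) = χ i f := by
    have h1 : (∑ᶠ B, if B ∈ D' then κ' B else 0) = ∑ᶠ B ∈ D', (s i (th (D i) B) - s i (th (D i) Bᶜ)) := by
      refine finsum_congr fun B => ?_
      by_cases hB : B ∈ D'
      · have h2 := κ'eq i 1 B (by rw [one_smul]; exact hB.1)
        rw [one_smul] at h2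
        rw [if_pos hB, h2]
        simp [hB, κ]
      · simp [hB]
    rw [h1, ← chain (hDN i) (s i) hfAD _ A hAD hfA hD'f le_rfl, hs i A hAD f]
    ring
  have hsup : ∀ g : Set Q → ℚ, (Function.support fun B => if B ∈ D' then g B else 0).Finite := by
    intro g
    refine hD'f.subset fun B hB => ?_
    by_contra h
    exact hB (if_neg h)
  have hsum2 : ∑ᶠ B, (if Bᶜ ∈ D' then κ' Bᶜ else 0) = χ i f := by
    rw [← hsum]
    exact finsum_eq_of_bijective compl compl_bijective fun B => rfl
  rw [finsum_add_distrib (hsup _), hsum, hsum2]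
  · ring
  · exact (hsup κ').preimage compl_injective.injOn

end ThC
end IdxSum

namespace IdxSum
open Finset
open scoped Pointwise

section Axis
variable {n : ℕ}

theorem P_eq_of_td {x y z : FreeGroup (Fin n)} (h : td x y < td x z) : P x z = P y z := by
  by_contra hne
  have := td_add hne
  omega

theorem hd_P (c : FreeGroup (Fin n)) : hd c = P c 1 := by simp [P]
theorem hd_inv_P (c : FreeGroup (Fin n)) : hd c⁻¹ = P 1 c := by simp [P]

theorem exists_axis_pt (g : FreeGroup (Fin n)) (hg : g ≠ 1) :
    ∃ h : FreeGroup (Fin n), hd (h⁻¹ * g * h) ≠ hd (h⁻¹ * g * h)⁻¹ := by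
  classical
  have hex : ∃ k, ∃ h : FreeGroup (Fin n), td (h⁻¹ * g * h) 1 = k := ⟨_, 1, rfl⟩
  obtain ⟨h, hh⟩ := Nat.find_spec hex
  refine ⟨h, fun heq => ?_⟩
  set c := h⁻¹ * g * h with hc
  have hc1 : c ≠ 1 := by
    intro h1
    apply hg
    rw [hc] at h1
    have : g = h * (h⁻¹ * g * h) * h⁻¹ := by group
    rw [this, h1]; group
  obtain ⟨d, hd'⟩ := P_ex hc1
  have hd2 : P 1 c = some d := by rw [← hd_inv_P, ← heq, hd_P, hd']
  have t1 := td_step hd'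
  rw [one_mul] at t1
  have t2 := td_step hd2
  have hcd : c ≠ ofL d := by
    intro h1
    have h2 := P_ax 1 1 d
    rw [one_mul, ← h1, hd2, P_self] at h2
    have := h2.2 (by simp)
    exact lb_ne d (Option.some.inj this).symm
  have hpos : td c (ofL d) ≠ 0 := fun h => hcd (td_eq_zero.1 h)
  have t3 : P (ofL d) c = some d := by
    by_contra hne
    rw [← hd2] at hne
    have := td_add hne
    have e : td (ofL d) 1 = 1 := by
      have := td_step' (y := 1) (z := 1) (d := d) (by rw [P_self]; simp)
      rw [one_mul, td_comm, td_eq_zero.2 rfl] at this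
      simpa using this
    rw [td_comm (ofL d) c, td_comm 1 c] at this
    omega
  have t4 := td_step t3
  have hlt : td ((h * ofL d)⁻¹ * g * (h * ofL d)) 1 < Nat.find hex := by
    have : (h * ofL d)⁻¹ * g * (h * ofL d) = (ofL d)⁻¹ * (c * ofL d) := by rw [hc]; group
    rw [this, ← td_smul (ofL d), mul_inv_cancel_left, mul_one, td_comm]
    rw [td_comm (ofL d) c] at t4
    omega
  exact Nat.find_min hex hlt ⟨_, rfl⟩

theorem axis_hd {c : FreeGroup (Fin n)} (h : hd c ≠ hd c⁻¹) (m : ℕ) :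
    hd (c ^ (m + 1)) = hd c ∧ P (c ^ (m + 1 + 1)) c ≠ P 1 c := by
  have hc1 : c ≠ 1 := by
    rintro rfl
    simp at h
  have e0 : P 1 c = P c⁻¹ 1 := by rw [← P_smul c c⁻¹ 1, mul_inv_cancel, mul_one]
  have e1 : ∀ m, P (c ^ (m + 1 + 1)) c = hd (c ^ (m + 1)) := by
    intro m
    rw [hd_P, ← P_smul c _ 1, mul_one, ← pow_succ']
  induction m with
  | zero =>
    refine ⟨by simp, ?_⟩
    rw [e1, e0, ← hd_P]; simpa using h
  | succ m ih =>
    have h1 : hd (c ^ (m + 1 + 1)) = hd c := by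
      rw [hd_P, hd_P]
      exact L1 hc1 ih.2
    refine ⟨h1, ?_⟩
    rw [e1, e0, h1, ← hd_P]
    exact h

theorem axis_pow {c : FreeGroup (Fin n)} (h : hd c ≠ hd c⁻¹) (m : ℕ) :
    hd (c ^ (m + 1)) = hd c ∧ td (c ^ m) 1 = m * td c 1 := by
  refine ⟨(axis_hd h m).1, ?_⟩
  induction m with
  | zero => simp [td_eq_zero]
  | succ m ih =>
    rcases m with _ | m
    · simp
    rw [td_add (axis_hd h m).2, pow_succ' c (m + 1), td_comm 1 c]
    have : td (c * c ^ (m + 1)) c = td (c ^ (m + 1)) 1 := by rw [← td_smul c _ 1, mul_one]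
    rw [this, ih]; push_cast; ring

theorem axis_ev {c : FreeGroup (Fin n)} (h : hd c ≠ hd c⁻¹) (x : FreeGroup (Fin n)) :
    ∃ M, ∀ m ≥ M, hd (c ^ m * x) = hd c := by
  have hc1 : c ≠ 1 := by
    rintro rfl
    simp at h
  refine ⟨td 1 x + 1, fun m hm => ?_⟩
  obtain ⟨k, rfl⟩ : ∃ k, m = k + 1 := ⟨m - 1, by omega⟩
  rw [← (axis_pow h k).1, hd_P, hd_P]
  symm
  apply P_eq_of_td
  have h0 : 1 ≤ td c 1 := Nat.one_le_iff_ne_zero.2 fun h => hc1 (td_eq_zero.1 h)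
  have e : td (c ^ (k + 1)) (c ^ (k + 1) * x) = td 1 x := by
    nth_rewrite 1 [← mul_one (c ^ (k + 1))]
    rw [td_smul]
  rw [e, (axis_pow h (k + 1)).2]
  nlinarith

end Axis

section Rank
variable {n : ℕ}

theorem Inf_sub (Q : Subgroup (FreeGroup (Fin n))) : Inf Q := by
  intro g hg
  have h : ¬ IsOfFinOrder (g : FreeGroup (Fin n)) := by
    rw [isOfFinOrder_iff_eq_one]
    exact fun h => hg (Subtype.ext h)
  have h2 := injective_pow_iff_not_isOfFinOrder.2 h
  intro a b hab
  apply h2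
  have := congrArg Subtype.val hab
  simpa using this

theorem halfCut (Q : Subgroup (FreeGroup (Fin n))) (S : ℕ → Finset Q) :
    ∃ K, ∀ g : Q, g ≠ 1 → ∃ A, Cut g A ∧ N0 S A ≤ K := by
  refine ⟨∑ s ∈ S 0, #(ball n (td 1 (s : FreeGroup (Fin n)))), fun g hg => ?_⟩
  obtain ⟨h, hh⟩ := exists_axis_pt (g : FreeGroup (Fin n)) fun h => hg (Subtype.ext h)
  set c := h⁻¹ * (g : FreeGroup (Fin n)) * h with hc
  let A : Set Q := {x | P (x : FreeGroup (Fin n)) h = hd c}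
  have hcb : ∀ s : Q, (cb s A).Finite ∧ (cb s A).ncard ≤ #(ball n (td 1 (s : FreeGroup (Fin n)))) := by
    intro s
    have hmap : ∀ x ∈ cb s A, h⁻¹ * (x : FreeGroup (Fin n)) ∈
        ((ball n (td 1 (s : FreeGroup (Fin n))) : Finset _) : Set (FreeGroup (Fin n))) := by
      intro x hx
      have hne : P (x : FreeGroup (Fin n)) h ≠ P ((x * s : Q) : FreeGroup (Fin n)) h := by
        intro heq
        apply hx
        simp only [A, Set.mem_setOf_eq, heq]
      have h1 := td_add hne
      have h2 : td (x : FreeGroup (Fin n)) ((x * s : Q) : FreeGroup (Fin n)) = td 1 (s : FreeGroup (Fin n)) := by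
        rw [Subgroup.coe_mul, ← td_smul (x : FreeGroup (Fin n)) 1, mul_one]
      rw [Finset.mem_coe, mem_ball]
      have h3 : td (x : FreeGroup (Fin n)) h = (h⁻¹ * (x : FreeGroup (Fin n))).norm := rfl
      omega
    have hinj : Set.InjOn (fun x : Q => h⁻¹ * (x : FreeGroup (Fin n))) (cb s A) :=
      fun x _ y _ hxy => Subtype.ext (mul_left_cancel hxy)
    refine ⟨Set.Finite.of_finite_image ((Finset.finite_toSet _).subset (Set.image_subset_iff.2 hmap)) hinj, ?_⟩
    have := Set.ncard_le_ncard_of_injOn _ hmap hinj (Finset.finite_toSet _)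
    rwa [Set.ncard_coe_finset] at this
  refine ⟨A, ⟨fun s => (hcb s).1, ?_, ?_⟩, Finset.sum_le_sum fun s _ => (hcb s).2⟩
  · obtain ⟨M, hM⟩ := axis_ev hh h⁻¹
    refine ⟨M, fun m hm => ?_⟩
    show P ((g ^ m : Q) : FreeGroup (Fin n)) h = hd c
    rw [← hM m hm, P, hc]
    congr 1
    have : h⁻¹ * (g : FreeGroup (Fin n)) * h = h⁻¹ * (g : FreeGroup (Fin n)) * (h⁻¹)⁻¹ := by group
    rw [this, conj_pow, Subgroup.coe_pow]; group
  · have hh' : hd c⁻¹ ≠ hd (c⁻¹)⁻¹ := by rw [inv_inv]; exact hh.symm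
    obtain ⟨M, hM⟩ := axis_ev hh' h⁻¹
    refine ⟨M, fun m hm => ?_⟩
    show ¬ P ((g⁻¹ ^ m : Q) : FreeGroup (Fin n)) h = hd c
    have e : P ((g⁻¹ ^ m : Q) : FreeGroup (Fin n)) h = hd (c⁻¹ ^ m * h⁻¹) := by
      rw [P, hc]
      congr 1
      have : (h⁻¹ * (g : FreeGroup (Fin n)) * h)⁻¹ = h⁻¹ * (g : FreeGroup (Fin n))⁻¹ * (h⁻¹)⁻¹ := by group
      rw [this, conj_pow, Subgroup.coe_pow, Subgroup.coe_inv]; group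
    rw [e, hM m hm]
    exact hh.symm

theorem closure_basis {κ G : Type*} [Group G] (b : FreeGroupBasis κ G) :
    Subgroup.closure (Set.range b) = ⊤ := by
  have h := FreeGroup.closure_range_of (α := κ)
  have h2 : Set.range b = b.repr.symm '' (Set.range FreeGroup.of) := by
    rw [← Set.range_comp]; rfl
  have h3 := (MonoidHom.map_closure b.repr.symm.toMonoidHom (Set.range FreeGroup.of)).symm
  rw [h2]
  refine Eq.trans h3 ?_
  rw [h]
  exact Subgroup.map_top_of_surjective _ b.repr.symm.surjective

theorem exists_S (Q : Subgroup (FreeGroup (Fin n))) {S0 : Finset Q} 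
    (hgen : Subgroup.closure (S0 : Set Q) = ⊤) (α : Q ≃* Q) (hα : ∃ N, 1 ≤ N ∧ ∀ x, α^[N] x = x) :
    ∃ S : ℕ → Finset Q, (∀ s, ∃ k, s ∈ S k) ∧ Subgroup.closure ((S 0 : Finset Q) : Set Q) = ⊤ ∧
      ∀ k, ∀ s ∈ S k, α s ∈ S k := by
  classical
  obtain ⟨N, hN, hα⟩ := hα
  have hcl : ∀ (X : Finset Q), ∃ Y : Finset Q, X ⊆ Y ∧ ∀ s ∈ Y, α s ∈ Y := by
    intro X
    refine ⟨(Finset.range N ×ˢ X).image fun p => α^[p.1] p.2, ?_, ?_⟩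
    · intro x hx
      exact Finset.mem_image.2 ⟨(0, x), by simp [hx]; omega, rfl⟩
    · intro s hs
      obtain ⟨⟨j, x⟩, hjx, rfl⟩ := Finset.mem_image.1 hs
      simp only [Finset.mem_product, Finset.mem_range] at hjx
      rw [Finset.mem_image]
      by_cases hj : j + 1 = N
      · refine ⟨(0, x), by simp [hjx]; omega, ?_⟩
        show x = α (α^[j] x)
        rw [← Function.iterate_succ_apply' (f := α)]
        show x = α^[j + 1] x
        rw [hj, hα]
      · refine ⟨(j + 1, x), by simp [hjx]; omega, ?_⟩
        simp only
        rw [← Function.iterate_succ_apply' (f := α)]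
  choose Y hY1 hY2 using hcl
  obtain ⟨f, hf⟩ := exists_surjective_nat Q
  refine ⟨fun k => Y (if k = 0 then S0 else {f (k - 1)}), ?_, ?_, fun k => hY2 _⟩
  · intro s
    obtain ⟨k, rfl⟩ := hf s
    exact ⟨k + 1, hY1 _ (by simp)⟩
  · rw [eq_top_iff, ← hgen]
    exact Subgroup.closure_mono (by simpa using hY1 S0)

theorem rankC_aux (Q : Subgroup (FreeGroup (Fin n))) {κ : Type*} [Fintype κ] (b : FreeGroupBasis κ Q)
    (α : Q ≃* Q) (hα : ∃ N, 1 ≤ N ∧ ∀ x, α^[N] x = x)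
    {ι : Type*} [Fintype ι] (w : ι → Q) (hw : ∀ i, ∃ L, 1 ≤ L ∧ (Sg (w i) α)^[L] = id)
    (hdist : ∀ i j, i ≠ j → ∀ q, w i ≠ q⁻¹ * w j * α q)
    (F : ι → Subgroup Q) (hF : ∀ i f, f ∈ F i ↔ w i * α f * (w i)⁻¹ = f)
    {κ' : ι → Type*} (b' : ∀ i, FreeGroupBasis (κ' i) (F i)) (T : ∀ i, Finset (κ' i)) :
    ∑ i, #(T i) ≤ Fintype.card κ := by
  classical
  have hg : Subgroup.closure ((Finset.univ.image b : Finset Q) : Set Q) = ⊤ := by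
    rw [Finset.coe_image, Finset.coe_univ, Set.image_univ, closure_basis]
  obtain ⟨S, hS, hgen, hαS⟩ := exists_S Q hg α hα
  obtain ⟨K, hK⟩ := halfCut Q S
  let I := Σ i, {t // t ∈ T i}
  let χ : I → ∀ i, F i → ℚ := fun p i f =>
    if h : p.1 = i then Multiplicative.toAdd
      ((b' i).lift (fun t => Multiplicative.ofAdd (if (h ▸ p.2.1) = t then (1 : ℚ) else 0)) f) else 0
  have hχ : ∀ p i a b, χ p i (a * b) = χ p i a + χ p i b := by
    intro p i a b
    by_cases h : p.1 = i
    · simp only [χ, dif_pos h, map_mul, toAdd_mul]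
    · simp only [χ, dif_neg h, add_zero]
  have hval : ∀ p q : I, χ p q.1 (b' q.1 q.2.1) = if p = q then 1 else 0 := by
    rintro ⟨i, t, ht⟩ ⟨j, t', ht'⟩
    by_cases h : i = j
    · subst h
      simp only [χ, dif_pos]
      rw [FreeGroupBasis.lift_apply_apply]
      by_cases htt : t = t'
      · subst htt; simp
      · have : (⟨i, t, ht⟩ : I) ≠ ⟨i, t', ht'⟩ := by
          intro he
          rw [Sigma.mk.injEq] at he
          exact htt (congrArg Subtype.val (eq_of_heq he.2))
        rw [if_neg this]
        simp [htt]
    · have : (⟨i, t, ht⟩ : I) ≠ ⟨j, t', ht'⟩ := by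
        intro he
        exact h (congrArg Sigma.fst he)
      rw [if_neg this]
      simp only [χ, dif_neg h]
  have hex := fun p : I => thmC (Inf_sub Q) hS hgen hαS hK w hw hdist F hF (χ p) (hχ p)
  choose Λ hadd hΛ using hex
  let v : I → κ → ℚ := fun p k => Λ p (b k)
  have hli : LinearIndependent ℚ v := by
    rw [Fintype.linearIndependent_iff]
    intro c hc q
    let Φ : Q →* Multiplicative ℚ := MonoidHom.mk' (fun x => Multiplicative.ofAdd (∑ p, c p * Λ p x)) (by
      intro x y
      rw [← ofAdd_add, ← Finset.sum_add_distrib]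
      congr 1
      refine Finset.sum_congr rfl fun p _ => ?_
      rw [hadd]; ring)
    have hΦ : Φ = 1 := by
      refine b.ext_hom _ _ fun k => ?_
      have := congrFun hc k
      simp only [Finset.sum_apply, Pi.smul_apply, smul_eq_mul, Pi.zero_apply, v] at this
      show Multiplicative.ofAdd (∑ p, c p * Λ p (b k)) = 1
      rw [this]; rfl
    have h1 : ∑ p, c p * Λ p ((b' q.1 q.2.1 : F q.1) : Q) = 0 := by
      have := DFunLike.congr_fun hΦ ((b' q.1 q.2.1 : F q.1) : Q)
      exact Multiplicative.ofAdd.injective this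
    simp only [hΛ, hval] at h1
    rw [Finset.sum_eq_single q (by intro p _ hp; simp [hp]) (by simp)] at h1
    simpa using h1
  have := hli.fintype_card_le_finrank
  rw [Module.finrank_fintype_fun_eq_card] at this
  simpa [I] using this

theorem rankC (Q : Subgroup (FreeGroup (Fin n))) {κ : Type*} [Fintype κ] (b : FreeGroupBasis κ Q)
    (α : Q ≃* Q) (hα : ∃ N, 1 ≤ N ∧ ∀ x, α^[N] x = x)
    {ι : Type*} [Fintype ι] (w : ι → Q) (hw : ∀ i, ∃ L, 1 ≤ L ∧ (Sg (w i) α)^[L] = id)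
    (hdist : ∀ i j, i ≠ j → ∀ q, w i ≠ q⁻¹ * w j * α q)
    (F : ι → Subgroup Q) (hF : ∀ i f, f ∈ F i ↔ w i * α f * (w i)⁻¹ = f) [∀ i, Group.FG (F i)] :
    ∑ i, Group.rank (F i) ≤ Fintype.card κ := by
  classical
  have key := rankC_aux Q b α hα w hw hdist F hF (fun i => IsFreeGroup.basis (F i))
  have hfin : ∀ i, Finite (IsFreeGroup.Generators (F i)) := by
    intro i
    by_contra hinf
    rw [not_finite_iff_infinite] at hinf
    obtain ⟨T, hT⟩ := Infinite.exists_subset_card_eq (IsFreeGroup.Generators (F i)) (Fintype.card κ + 1)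
    have h1 := key (fun j => if h : j = i then h ▸ T else ∅)
    have h2 := Finset.single_le_sum (f := fun j => #((if h : j = i then h ▸ T else ∅) : Finset (IsFreeGroup.Generators (F j))))
      (fun _ _ => Nat.zero_le _) (Finset.mem_univ i)
    simp only [dif_pos] at h2
    omega
  have := fun i => Fintype.ofFinite (IsFreeGroup.Generators (F i))
  refine le_trans (Finset.sum_le_sum fun i _ => ?_) (key fun i => Finset.univ)
  have hg : Subgroup.closure ((Finset.univ.image (IsFreeGroup.basis (F i)) : Finset (F i)) : Set (F i)) = ⊤ := by
    rw [Finset.coe_image, Finset.coe_univ, Set.image_univ, closure_basis]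
  exact (Group.rank_le hg).trans Finset.card_image_le

end Rank
end IdxSum

namespace IdxSum
open Finset

section Comb
variable {n : ℕ}

/-- goodness of an end for all large multiples -/
def Good (φ : Monoid.End (FreeGroup (Fin n))) (u : FreeGroup (Fin n))
    (ξ : FreeGroup (Fin n) → Fin n × Bool) : Prop :=
  ∀ z, ∃ m, 1 ≤ m ∧ ∃ L : Finset (FreeGroup (Fin n)), ∀ p, 1 ≤ p → m ∣ p →
    ∃ h1 ∈ L, ∃ h2 ∈ L, h1 ≠ h2 ∧ P (uu φ u p * (φ ^ p) h1) z = some (ξ z) ∧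
      P (uu φ u p * (φ ^ p) h2) z = some (ξ z)

theorem Good.tr {φ : Monoid.End (FreeGroup (Fin n))} {u : FreeGroup (Fin n)}
    {ξ : FreeGroup (Fin n) → Fin n × Bool} (h : Good φ u ξ) {q} (hq : q ∈ Per φ u) :
    Good φ u (tr q ξ) := by
  classical
  intro z
  obtain ⟨m, hm, L, hL⟩ := h (q⁻¹ * z)
  obtain ⟨r, hr, hqr⟩ := hq
  refine ⟨m * r, Nat.mul_pos hm hr, L.image (fun x => q * x), fun p hp hd => ?_⟩
  obtain ⟨h1, hh1, h2, hh2, hne, e1, e2⟩ := hL p hp (dvd_trans (Dvd.intro r rfl) hd)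
  have hP : Ps φ u p q = q := Ps_dvd φ u hqr (dvd_trans (Dvd.intro_left m rfl) hd)
  refine ⟨q * h1, mem_image_of_mem _ hh1, q * h2, mem_image_of_mem _ hh2, by simpa using hne, ?_, ?_⟩
  · rw [uu_f, hP, P_smul', e1]; rfl
  · rw [uu_f, hP, P_smul', e2]; rfl

theorem AttE.toGood {φ : Monoid.End (FreeGroup (Fin n))} {u v : FreeGroup (Fin n)}
    {ξ : FreeGroup (Fin n) → Fin n × Bool} (h : AttE φ v ξ) {m : ℕ} (hm : 1 ≤ m)
    (he : uu φ v m = uu φ u m) : Good φ u ξ := by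
  classical
  intro z
  obtain ⟨h1, h2, hne, hh⟩ := h.good z
  refine ⟨m, hm, {h1, h2}, fun p hp hd => ?_⟩
  have := uu_dvd_eq φ he hd
  refine ⟨h1, by simp, h2, by simp, hne, ?_, ?_⟩
  · rw [← this]; exact (hh p).1
  · rw [← this]; exact (hh p).2

theorem A_comb (hn : 1 ≤ n) (φ : Monoid.End (FreeGroup (Fin n))) (hφ : Function.Injective φ)
    {C : Type*} [Fintype C] (u : C → FreeGroup (Fin n))
    (hu : ∀ c c', c ≠ c' → ∀ m, 1 ≤ m → ∀ g, uu φ (u c) m ≠ g * uu φ (u c') m * ((φ ^ m) g)⁻¹)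
    (Λ : C → Set (FreeGroup (Fin n) → Fin n × Bool))
    (hgood : ∀ c, ∀ ξ ∈ Λ c, Good φ (u c) ξ)
    (S : C → ℤ)
    (hS : ∀ c, ∀ M : ℤ, (∀ Z : Finset (FreeGroup (Fin n)),
      (∀ z ∈ Z, ∀ z' ∈ Z, z ≠ z' → ∀ q ∈ Per φ (u c), z' ≠ q * z) →
      (∀ z ∈ Z, 2 ≤ #(DD (Λ c) z)) → ∑ z ∈ Z, ((#(DD (Λ c) z) : ℤ) - 2) ≤ M) → S c ≤ M) :
    ∑ c, S c ≤ 2 * n - 2 := by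
  classical
  set ok : C → Finset (FreeGroup (Fin n)) → Prop := fun c Z =>
      (∀ z ∈ Z, ∀ z' ∈ Z, z ≠ z' → ∀ q ∈ Per φ (u c), z' ≠ q * z) ∧
      (∀ z ∈ Z, 2 ≤ #(DD (Λ c) z)) with hok
  set sm : C → Finset (FreeGroup (Fin n)) → ℤ := fun c Z => ∑ z ∈ Z, ((#(DD (Λ c) z) : ℤ) - 2)
    with hsm
  -- joint bound
  have joint : ∀ Z : C → Finset (FreeGroup (Fin n)), (∀ c, ok c (Z c)) →
      ∑ c, sm c (Z c) ≤ 2 * n - 2 := by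
    intro Z hZ
    have := A1 hn φ hφ (univ.sigma Z) (fun x => x.2⁻¹ * u x.1 * φ x.2)
      (fun ⟨c, z⟩ hx ⟨c', z'⟩ hy hne p hp heq => ?_) (fun x => DD (Λ x.1) x.2)
      (fun x hx => (hZ x.1).2 x.2 (mem_sigma.1 hx).2)
      (fun ⟨c, z⟩ hx d hd => ?_)
    · rw [sum_sigma] at this
      exact this
    · simp only [uu_conj] at heq
      have hz := (mem_sigma.1 hx).2
      have hz' := (mem_sigma.1 hy).2
      by_cases hc : c = c'
      · subst hc
        have hzz : z ≠ z' := by rintro rfl; exact hne rfl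
        refine (hZ c).1 z hz z' hz' hzz (z' * z⁻¹) ⟨p, hp, ?_⟩ (by group)
        simp only [Ps, map_mul, map_inv]
        have e : uu φ (u c) p * (φ ^ p) z' = z' * (z⁻¹ * uu φ (u c) p * (φ ^ p) z) := by
          rw [heq]; group
        calc uu φ (u c) p * ((φ ^ p) z' * ((φ ^ p) z)⁻¹) * (uu φ (u c) p)⁻¹
            = (uu φ (u c) p * (φ ^ p) z') * ((φ ^ p) z)⁻¹ * (uu φ (u c) p)⁻¹ := by group
          _ = _ := by rw [e]; group
      · refine hu c c' hc p hp (z * z'⁻¹) ?_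
        simp only [map_mul, map_inv]
        calc uu φ (u c) p = z * (z⁻¹ * uu φ (u c) p * (φ ^ p) z) * ((φ ^ p) z)⁻¹ := by group
          _ = _ := by rw [heq]; group
    · obtain ⟨ξ, hξ, rfl⟩ := mem_DD.1 hd
      obtain ⟨m, hm, L, hL⟩ := hgood c ξ hξ z
      refine ⟨m, hm, L.image (fun x => z⁻¹ * x), fun p hp hpd => ?_⟩
      obtain ⟨h1, hh1, h2, hh2, hne, e1, e2⟩ := hL p hp hpd
      refine ⟨_, mem_image_of_mem _ hh1, _, mem_image_of_mem _ hh2, by simpa using hne, ?_, ?_⟩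
      · rw [← e1]; simp only [uu_conj, P, map_mul, map_inv]; congr 1; group
      · rw [← e2]; simp only [uu_conj, P, map_mul, map_inv]; congr 1; group
  have single : ∀ c Z, ok c Z → sm c Z ≤ 2 * n - 2 := by
    intro c Z hZ
    have := joint (fun c' => if c' = c then Z else ∅) (fun c' => by
      by_cases h : c' = c
      · subst h; simpa using hZ
      · simp [h, hok])
    rw [Finset.sum_eq_single c] at this
    · simpa using this
    · intro b _ hb; simp [hb, hsm]
    · simp
  have hmax : ∀ c, ∃ Z, ok c Z ∧ ∀ Z', ok c Z' → sm c Z' ≤ sm c Z := by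
    intro c
    obtain ⟨M, ⟨Z, hZ, rfl⟩, hM⟩ := Int.exists_greatest_of_bdd
      (P := fun x => ∃ Z, ok c Z ∧ sm c Z = x) ⟨2 * n - 2, by
        rintro _ ⟨Z, hZ, rfl⟩; exact single c Z hZ⟩ ⟨0, ∅, by simp [hok], by simp [hsm]⟩
    exact ⟨Z, hZ, fun Z' hZ' => hM _ ⟨Z', hZ', rfl⟩⟩
  choose Z hZ hZm using hmax
  refine le_trans (sum_le_sum fun c _ => ?_) (joint Z hZ)
  exact hS c _ (fun Z' h1 h2 => hZm c Z' ⟨h1, h2⟩)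

end Comb
end IdxSum

namespace IdxSum
open Finset

section Legs
variable {n : ℕ} {ξ ζ η : FreeGroup (Fin n) → Fin n × Bool}

theorem IsEnd.ray_off (hξ : IsEnd ξ) (x y : FreeGroup (Fin n)) :
    ∃ T, ∀ t ≥ T, P y (ray ξ x t) ≠ some (ξ (ray ξ x t)) := by
  obtain ⟨i, j, h⟩ := hξ.conf x y
  refine ⟨j, fun t ht => ?_⟩
  obtain ⟨k, rfl⟩ := Nat.exists_eq_add_of_le ht
  rw [ray_add, ← h, ← ray_add]
  exact hξ.ray_back y _

theorem stab_shift (hξ : IsEnd ξ) {s} (hs : tr s ξ = ξ) :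
    ∃ i j, ∀ k, s * ray ξ 1 (i + k) = ray ξ 1 (j + k) := by
  obtain ⟨i, j, h⟩ := hξ.conf 1 s
  refine ⟨i, j, fun k => ?_⟩
  have h1 : ∀ t, ray ξ s t = s * ray ξ 1 t := by
    intro t
    have := ray_tr s ξ 1 t
    rwa [hs, mul_one] at this
  rw [← h1, ray_add, h, ← ray_add]

theorem stab_comm (hξ : IsEnd ξ) {s s'} (hs : tr s ξ = ξ) (hs' : tr s' ξ = ξ) : s * s' = s' * s := by
  obtain ⟨i, j, h⟩ := stab_shift hξ hs
  obtain ⟨i', j', h'⟩ := stab_shift hξ hs'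
  have e1 : s * s' * ray ξ 1 (i' + i) = ray ξ 1 (j' + j) := by
    rw [mul_assoc, h' i, show j' + i = i + j' by ring, h j', add_comm]
  have e2 : s' * s * ray ξ 1 (i' + i) = ray ξ 1 (j' + j) := by
    rw [mul_assoc, add_comm i', h i', show j + i' = i' + j by ring, h' j]
  exact mul_right_cancel (e1.trans e2.symm)

theorem stab_aux {Q : Subgroup (FreeGroup (Fin n))} (hξ : IsEnd ξ)
    (hfr : ∀ x z, {t | ∃ q ∈ Q, ray ξ x t = q * z}.Finite) {s} (hsQ : s ∈ Q) {i d : ℕ}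
    (h : ∀ k, s * ray ξ 1 (i + k) = ray ξ 1 (i + d + k)) : d = 0 := by
  by_contra hd
  have key : ∀ k : ℕ, s ^ k * ray ξ 1 i = ray ξ 1 (i + d * k) := by
    intro k
    induction k with
    | zero => simp
    | succ k ih =>
      rw [pow_succ', mul_assoc, ih, h]
      congr 1
      ring
  have hf := hfr 1 (ray ξ 1 i)
  have hinj : Function.Injective (fun k : ℕ => i + d * k) := by
    intro a b hab
    simp only [Nat.add_left_cancel_iff] at hab
    exact Nat.eq_of_mul_eq_mul_left (Nat.pos_of_ne_zero hd) hab
  refine Set.infinite_of_injective_forall_mem hinj (fun k => ?_) hf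
  exact ⟨s ^ k, Q.pow_mem hsQ k, (key k).symm⟩

theorem stab_one {Q : Subgroup (FreeGroup (Fin n))} (hξ : IsEnd ξ)
    (hfr : ∀ x z, {t | ∃ q ∈ Q, ray ξ x t = q * z}.Finite) {s} (hsQ : s ∈ Q) (hs : tr s ξ = ξ) :
    s = 1 := by
  obtain ⟨i, j, h⟩ := stab_shift hξ hs
  have hij : i = j := by
    rcases le_total i j with hij | hij
    · obtain ⟨d, rfl⟩ := Nat.exists_eq_add_of_le hij
      have := stab_aux hξ hfr hsQ h
      omega
    · obtain ⟨d, rfl⟩ := Nat.exists_eq_add_of_le hij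
      have := stab_aux hξ hfr (Q.inv_mem hsQ) (i := j) (d := d) (fun k => by rw [← h k]; group)
      omega
  subst hij
  exact mul_eq_right.1 (h 0)

theorem AttE.rel {φ : Monoid.End (FreeGroup (Fin n))} {u v : FreeGroup (Fin n)}
    (hξ : AttE φ u ξ) (hη : AttE φ v η) {m : ℕ} (hm : 1 ≤ m) (he : uu φ v m = uu φ u m)
    {g} (hg : g ∈ Per φ u) (h : tr g ξ = η) : u = g⁻¹ * v * φ g := by
  have h0 : Cv ξ (fun t => ray ξ 1 t) := fun z => hξ.isEnd.eventually 1 z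
  have h1 := (hξ.fixed _ h0).mul_right hξ.isEnd u
  have h2 := h0.tr g
  rw [h] at h2
  have h3 := ((hη.fixed _ h2).mul_right hη.isEnd v).tr g⁻¹
  have e : tr g⁻¹ η = ξ := by rw [← h, tr_tr, inv_mul_cancel, tr_one]
  rw [e] at h3
  have h4 := h1.tr (g⁻¹ * v * φ g * u⁻¹)
  have hfun : (fun t => g⁻¹ * v * φ g * u⁻¹ * (u * φ (ray ξ 1 t) * u⁻¹ * u)) =
      fun t => g⁻¹ * (v * φ (g * ray ξ 1 t) * v⁻¹ * v) := by
    funext t; simp only [map_mul]; group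
  rw [hfun] at h4
  have h5 := h4.uniq h3
  have hQ : g⁻¹ * v * φ g * u⁻¹ ∈ Per φ u := by
    have a1 := w_mem_Per φ hm he
    have a2 : Ps φ u 1 g ∈ Per φ u := by
      obtain ⟨r, hr, hgr⟩ := hg
      exact ⟨r, hr, by rw [← Ps_add, add_comm, Ps_add, hgr]⟩
    have := mul_mem (mul_mem (inv_mem hg) a1) a2
    rw [Ps_one] at this
    convert this using 1
    group
  have := stab_one hξ.isEnd hξ.fr hQ h5
  rw [mul_inv_eq_one] at this
  exact this.symm

/-- the two ends of an infinite cyclic subgroup -/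
theorem pow_end {g : FreeGroup (Fin n)} {h : FreeGroup (Fin n)}
    (hh : hd (h⁻¹ * g * h) ≠ hd (h⁻¹ * g * h)⁻¹) :
    ∃ ξ, IsEnd ξ ∧ (∀ y, Cv ξ (fun m => g ^ m * y)) ∧ some (ξ h) = hd (h⁻¹ * g * h) := by
  set c := h⁻¹ * g * h with hc
  have hcpow : ∀ m, c ^ m = h⁻¹ * g ^ m * h := by
    intro m
    induction m with
    | zero => simp
    | succ m ih => rw [pow_succ, ih, pow_succ, hc]; group
  have hh' : hd c⁻¹ ≠ hd (c⁻¹)⁻¹ := by rw [inv_inv]; exact hh.symm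
  have hc1 : c ≠ 1 := by
    intro h1; rw [h1] at hh; simp at hh
  have key : ∀ z, ∃ d : Fin n × Bool, ∀ y, ∃ T, ∀ t, T ≤ t → P (g ^ t * y) z = some d := by
    intro z
    obtain ⟨k, hk⟩ := axis_ev hh' (h⁻¹ * z)
    have hk := hk k le_rfl
    have e : P z (g ^ k * h) = hd c⁻¹ := by
      rw [← hk, P, inv_pow, hcpow]
      congr 1
      group
    have hne : g ^ k * h ≠ z := by
      rintro rfl
      rw [P_self, eq_comm, hd_eq_none, inv_eq_one] at e
      exact hc1 e
    obtain ⟨d, hd'⟩ := Option.ne_none_iff_exists'.1 (fun hh => hne (P_none.1 hh) : P (g ^ k * h) z ≠ none)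
    refine ⟨d, fun y => ?_⟩
    obtain ⟨M, hM⟩ := axis_ev hh (h⁻¹ * y)
    refine ⟨k + M, fun t ht => ?_⟩
    have e2 : P (g ^ t * y) (g ^ k * h) = hd c := by
      rw [← hM (t - k) (by omega), P, hcpow]
      congr 1
      have : g ^ t = g ^ k * g ^ (t - k) := by rw [← pow_add]; congr 1; omega
      rw [this]
      group
    rw [L1 hne (by rw [e2, e]; exact hh), hd']
  choose ξ hξ using key
  have hCv : ∀ y, Cv ξ (fun m => g ^ m * y) := fun y z => hξ z y
  refine ⟨ξ, ?_, hCv, ?_⟩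
  · intro z d
    obtain ⟨T, hT⟩ := hCv 1 z
    obtain ⟨T', hT'⟩ := hCv 1 (z * ofL d)
    have a := hT (T + T') (by omega)
    have b := hT' (T + T') (by omega)
    have := P_ax (g ^ (T + T') * 1) z d
    rw [a, b] at this
    simpa using this
  · obtain ⟨T, hT⟩ := hCv h h
    obtain ⟨M, hM⟩ := axis_ev hh 1
    rw [← hT (T + M) (by omega), ← hM (T + M) (by omega), hcpow, P]
    congr 1
    group

theorem disj_halves (hζ : IsEnd ζ) {q : FreeGroup (Fin n)} (hq : tr q ζ ≠ ζ) :
    ∃ z, ∀ w, P w z = some (ζ z) → P (q * w) z = some (ζ z) → False := by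
  set η := tr q⁻¹ ζ with hη
  have hne : η ≠ ζ := by
    intro h; apply hq
    calc tr q ζ = tr q η := by rw [h]
      _ = ζ := by rw [hη, tr_tr, mul_inv_cancel, tr_one]
  obtain ⟨z1, hz1⟩ := Function.ne_iff.1 hne
  have h0 : Cv ζ (fun t => ray ζ 1 t) := fun z => hζ.eventually 1 z
  obtain ⟨T1, hT1⟩ := h0 z1
  obtain ⟨T2, hT2⟩ := h0.tr q⁻¹ z1
  obtain ⟨T3, hT3⟩ := hζ.ray_off 1 z1
  obtain ⟨T4, hT4⟩ := hζ.ray_off 1 (q * z1)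
  set T := T1 + T2 + T3 + T4
  have hT1 := hT1 T (by omega)
  have hT2 := hT2 T (by omega)
  have hT3 := hT3 T (by omega)
  have hT4 := hT4 T (by omega)
  refine ⟨ray ζ 1 T, fun w hw hw' => hz1 ?_⟩
  set z := ray ζ 1 T
  have a1 : P w z1 = some (ζ z1) := by
    rw [← hT1]
    refine L1 ?_ ?_
    · intro h
      rw [h, P_self] at hT1; cases hT1
    · rw [hw]; exact hT3.symm
  have a2 : P w z1 = some (η z1) := by
    rw [← hT2]
    refine L1 ?_ ?_
    · intro h
      rw [h, P_self] at hT2; cases hT2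
    · rw [P_smul'] at hw' hT4
      rw [hw']; exact hT4.symm
  rw [a1] at a2
  exact (Option.some.inj a2).symm

theorem pow_good {φ : Monoid.End (FreeGroup (Fin n))} {u q q' : FreeGroup (Fin n)}
    (hq : q ∈ Per φ u) (hq' : q' ∈ Per φ u) (hne : q * q' ≠ q' * q) (hζ : IsEnd ζ)
    (h1 : ∀ y, Cv ξ (fun m => q ^ m * y)) (h2 : ∀ y, Cv ζ (fun m => q⁻¹ ^ m * y)) :
    Good φ u ξ := by
  classical
  have hst : tr q ζ = ζ := by
    refine ((h2 1).tr q).uniq ?_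
    convert h2 q using 2 with m
    rw [mul_one]
    exact ((Commute.refl q).inv_right.pow_right m).eq
  have hmv : tr q' ζ ≠ ζ := fun h => hne (stab_comm hζ hst h)
  obtain ⟨zs, hzs⟩ := disj_halves hζ hmv
  have hq1 : q ≠ 1 := by rintro rfl; simp at hne
  intro z
  obtain ⟨N1, hN1⟩ := h2 z zs
  obtain ⟨N2, hN2⟩ := h1 zs z
  have key : ∀ w, P w zs ≠ some (ζ zs) → ∀ M ≥ N1 + N2, P (q ^ M * w) z = some (ξ z) := by
    intro w hw M hM
    have a1 : P (q⁻¹ ^ M * z) zs = _ := hN1 M (by omega)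
    have a2 : P (q ^ M * zs) z = _ := hN2 M (by omega)
    rw [P_smul'] at a2 ⊢
    rw [inv_pow] at a1
    rw [← a2]
    refine L1 ?_ (by rw [a1]; exact hw)
    intro h
    rw [← h, P_self] at a1; cases a1
  set N := N1 + N2
  obtain ⟨r, hr, hqr⟩ := hq
  obtain ⟨r', hr', hqr'⟩ := hq'
  refine ⟨r * r', Nat.mul_pos hr hr', {q ^ N, q ^ (N + 1), q ^ N * q', q ^ (N + 1) * q'}, fun p hp hd => ?_⟩
  have e1 : Ps φ u p q = q := Ps_dvd φ u hqr (dvd_trans (Dvd.intro r' rfl) hd)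
  have e2 : Ps φ u p q' = q' := Ps_dvd φ u hqr' (dvd_trans (Dvd.intro_left r rfl) hd)
  have epow : ∀ k, Ps φ u p (q ^ k) = q ^ k := by
    intro k
    induction k with
    | zero => simp [Ps_map_one]
    | succ k ih => rw [pow_succ, Ps_mul, ih, e1]
  have f1 : ∀ k, uu φ u p * (φ ^ p) (q ^ k) = q ^ k * uu φ u p := by
    intro k
    have := uu_f φ u p (q ^ k) 1
    rwa [mul_one, epow, map_one, mul_one] at this
  have f2 : ∀ k, uu φ u p * (φ ^ p) (q ^ k * q') = q ^ k * (q' * uu φ u p) := by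
    intro k
    have := uu_f φ u p (q ^ k * q') 1
    rwa [mul_one, Ps_mul, e2, epow, map_one, mul_one, mul_assoc] at this
  have hpn : q ^ N ≠ q ^ (N + 1) := by
    rw [pow_succ]; intro h; exact hq1 (by simpa using h)
  by_cases hw : P (uu φ u p) zs = some (ζ zs)
  · have hw' : P (q' * uu φ u p) zs ≠ some (ζ zs) := fun h => hzs _ hw h
    refine ⟨q ^ N * q', by simp, q ^ (N + 1) * q', by simp, fun h => hpn (mul_right_cancel h), ?_, ?_⟩
    · rw [f2]; exact key _ hw' _ (by omega)
    · rw [f2]; exact key _ hw' _ (by omega)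
  · refine ⟨q ^ N, by simp, q ^ (N + 1), by simp, hpn, ?_, ?_⟩
    · rw [f1]; exact key _ hw _ (by omega)
    · rw [f1]; exact key _ hw _ (by omega)

end Legs
end IdxSum

namespace IdxSum
open Finset

section ClassL
variable {n : ℕ}

theorem rank_le_one_of_comm (H : Subgroup (FreeGroup (Fin n))) [Group.FG H]
    (hc : ∀ a ∈ H, ∀ b ∈ H, a * b = b * a) : Group.rank H ≤ 1 := by
  classical
  have hss : Subsingleton (IsFreeGroup.Generators H) := by
    refine ⟨fun x y => by_contra fun hxy => ?_⟩
    set b := IsFreeGroup.basis H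
    let f : IsFreeGroup.Generators H → Equiv.Perm (Fin 3) := fun z =>
      if z = x then Equiv.swap 0 1 else Equiv.swap 1 2
    have h1 : b x * b y = b y * b x := by
      apply Subtype.ext
      exact hc _ (b x).2 _ (b y).2
    have h2 := congrArg (b.lift f) h1
    have hl : ∀ z, b.lift f (b z) = f z := fun z => by simp
    rw [map_mul, map_mul, hl, hl] at h2
    simp only [f, if_true, if_neg (Ne.symm hxy)] at h2
    clear hl
    revert h2
    decide
  have := Fintype.ofFinite (IsFreeGroup.Generators H)
  have hg : Subgroup.closure ((Finset.univ.image (IsFreeGroup.basis H) : Finset H) : Set H) = ⊤ := by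
    rw [Finset.coe_image, Finset.coe_univ, Set.image_univ, closure_basis]
  refine (Group.rank_le hg).trans (Finset.card_image_le.trans ?_)
  exact Fintype.card_le_one_iff_subsingleton.2 hss

theorem exists_ne_one_of_rank (H : Subgroup (FreeGroup (Fin n))) [Group.FG H]
    (h : 1 ≤ Group.rank H) : ∃ f ∈ H, f ≠ 1 := by
  by_contra hc
  push Not at hc
  have hg : Subgroup.closure (((∅ : Finset H)) : Set H) = ⊤ := by
    rw [eq_top_iff]
    intro x _
    have : x = 1 := Subtype.ext (hc x.1 x.2)
    rw [this]; exact one_mem _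
  have := Group.rank_le hg
  simp at this
  omega

variable (φ : Monoid.End (FreeGroup (Fin n))) (u : FreeGroup (Fin n))

theorem Ps_mem_Per {q} (hq : q ∈ Per φ u) (k : ℕ) : Ps φ u k q ∈ Per φ u := by
  obtain ⟨r, hr, hgr⟩ := hq
  exact ⟨r, hr, by rw [← Ps_add, add_comm, Ps_add, hgr]⟩

/-- restriction of `i_u ∘ φ` to its periodic subgroup -/
noncomputable def alph (hφ : Function.Injective φ) : Per φ u ≃* Per φ u :=
  MulEquiv.ofBijective (MonoidHom.mk' (fun q => (⟨Ps φ u 1 q.1, Ps_mem_Per φ u q.2 1⟩ : Per φ u))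
    (fun a b => Subtype.ext (Ps_mul φ u 1 a.1 b.1))) (by
    constructor
    · intro a b h
      have h1 : Ps φ u 1 a.1 = Ps φ u 1 b.1 := congrArg Subtype.val h
      rw [Ps_one, Ps_one] at h1
      exact Subtype.ext (hφ (mul_left_cancel (mul_right_cancel h1)))
    · intro q
      obtain ⟨r, hr, hq⟩ := q.2
      refine ⟨⟨Ps φ u (r - 1) q.1, Ps_mem_Per φ u q.2 _⟩, Subtype.ext ?_⟩
      change Ps φ u 1 (Ps φ u (r - 1) q.1) = q.1
      rw [← Ps_add, show 1 + (r - 1) = r by omega, hq])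

theorem alph_coe (hφ : Function.Injective φ) (q : Per φ u) :
    ((alph φ u hφ q : Per φ u) : FreeGroup (Fin n)) = u * φ q * u⁻¹ := by
  rw [← Ps_one]; rfl

theorem alph_iter (hφ : Function.Injective φ) (k : ℕ) (q : Per φ u) :
    (((alph φ u hφ)^[k] q : Per φ u) : FreeGroup (Fin n)) = Ps φ u k q := by
  induction k with
  | zero => simp [Ps_zero]
  | succ k ih => rw [Function.iterate_succ_apply', alph_coe, ih, add_comm, Ps_add, Ps_one]

theorem Sg_iter (hφ : Function.Injective φ) {v : FreeGroup (Fin n)} (hv : v * u⁻¹ ∈ Per φ u) (k : ℕ)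
    (q : Per φ u) :
    (((Sg ⟨v * u⁻¹, hv⟩ (alph φ u hφ))^[k] q : Per φ u) : FreeGroup (Fin n)) =
      uu φ v k * (φ ^ k) q * (uu φ u k)⁻¹ := by
  induction k with
  | zero => simp [uu]
  | succ k ih =>
    rw [Function.iterate_succ_apply', Sg, Subgroup.coe_mul, alph_coe, ih, End_pow_succ', uu, uu]
    simp only [map_mul, map_inv]
    group

theorem alph_period (hφ : Function.Injective φ) {κ : Type*} [Fintype κ]
    (b : FreeGroupBasis κ (Per φ u)) : ∃ N, 1 ≤ N ∧ ∀ x, (alph φ u hφ)^[N] x = x := by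
  have : ∀ i, ∃ r, 1 ≤ r ∧ Ps φ u r (b i : FreeGroup (Fin n)) = b i := fun i => (b i).2
  choose r hr hb using this
  refine ⟨∏ i, r i, Nat.one_le_iff_ne_zero.2 (Finset.prod_ne_zero_iff.2 fun i _ => by have := hr i; omega), fun x => ?_⟩
  set N := ∏ i, r i
  have hx : x ∈ Subgroup.closure (Set.range b) := by rw [closure_basis]; trivial
  apply Subtype.ext
  rw [alph_iter]
  induction hx using Subgroup.closure_induction with
  | mem x hx =>
    obtain ⟨i, rfl⟩ := hx
    exact Ps_dvd φ u (hb i) (Finset.dvd_prod_of_mem r (mem_univ i))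
  | one => exact Ps_map_one φ u N
  | mul x y _ _ hx hy => rw [Subgroup.coe_mul, Ps_mul, hx, hy]
  | inv x _ hx => rw [Subgroup.coe_inv, Ps_inv, hx]

theorem class_rank (hφ : Function.Injective φ) {κ : Type*} [Fintype κ]
    (b : FreeGroupBasis κ (Per φ u)) {I : Type*} [Fintype I]
    (v : I → FreeGroup (Fin n)) (m : I → ℕ) (hm : ∀ i, 1 ≤ m i)
    (hv : ∀ i, uu φ (v i) (m i) = uu φ u (m i))
    (hdist : ∀ i j, i ≠ j → ∀ q, v i ≠ q⁻¹ * v j * φ q)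
    (Fx : I → Subgroup (FreeGroup (Fin n))) (hFx : ∀ i f, f ∈ Fx i ↔ v i * φ f * (v i)⁻¹ = f)
    (hle : ∀ i, Fx i ≤ Per φ u)
    [∀ i, Group.FG (Fx i)] : ∑ i, Group.rank (Fx i) ≤ Fintype.card κ := by
  have hw : ∀ i, v i * u⁻¹ ∈ Per φ u := fun i => w_mem_Per φ (hm i) (hv i)
  obtain ⟨N, hN, hNp⟩ := alph_period φ u hφ b
  have e : ∀ i, (Fx i).subgroupOf (Per φ u) ≃* Fx i := fun i => Subgroup.subgroupOfEquivOfLe (hle i)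
  have hfg : ∀ i, Group.FG ((Fx i).subgroupOf (Per φ u)) := fun i =>
    Group.fg_of_surjective (f := (e i).symm.toMonoidHom) (e i).symm.surjective
  have hr : ∀ i, Group.rank (Fx i) = Group.rank ((Fx i).subgroupOf (Per φ u)) := fun i =>
    Group.rank_congr (e i).symm
  simp only [hr]
  refine rankC (Per φ u) b (alph φ u hφ) ⟨N, hN, hNp⟩ (fun i => ⟨v i * u⁻¹, hw i⟩) ?_ ?_ _ ?_
  · intro i
    refine ⟨m i * N, Nat.mul_pos (hm i) hN, ?_⟩
    funext x
    apply Subtype.ext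
    rw [Sg_iter, uu_dvd_eq φ (hv i) (Dvd.intro N rfl)]
    change Ps φ u (m i * N) x = x
    refine Ps_dvd φ u (m := N) ?_ (Dvd.intro_left _ rfl)
    rw [← alph_iter φ u hφ, hNp]
  · intro i j hij q h
    have h1 := congrArg Subtype.val h
    simp only [Subgroup.coe_mul, Subgroup.coe_inv, alph_coe] at h1
    refine hdist i j hij q ?_
    apply mul_right_cancel (b := u⁻¹)
    rw [h1]; group
  · intro i f
    rw [Subgroup.mem_subgroupOf, hFx, Subtype.ext_iff]
    simp only [Subgroup.coe_mul, Subgroup.coe_inv, alph_coe]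
    have : v i * u⁻¹ * (u * φ f * u⁻¹) * (v i * u⁻¹)⁻¹ = v i * φ f * (v i)⁻¹ := by group
    rw [this]

theorem two_le_DD {Λ : Set (FreeGroup (Fin n) → Fin n × Bool)} {ξ η : FreeGroup (Fin n) → Fin n × Bool}
    (hξ : ξ ∈ Λ) (hη : η ∈ Λ) (h : ξ ≠ η) : ∃ z0, 2 ≤ #(DD Λ z0) := by
  obtain ⟨z, hz⟩ := Function.ne_iff.1 h
  exact ⟨z, Finset.one_lt_card.2 ⟨ξ z, mem_DD.2 ⟨ξ, hξ, rfl⟩, η z, mem_DD.2 ⟨η, hη, rfl⟩, hz⟩⟩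

/-- existence of the ends used for a class -/
theorem exists_Lam (X : Set (FreeGroup (Fin n) → Fin n × Bool))
    (hX : ∀ ξ ∈ X, IsEnd ξ ∧ Good φ u ξ)
    (h2 : (∃ ξ ∈ X, ∃ η ∈ X, ξ ≠ η) ∨ ∃ ξ ∈ X, ∃ q ∈ Per φ u, tr q ξ ≠ ξ) :
    ∃ Λ : Set (FreeGroup (Fin n) → Fin n × Bool), X ⊆ Λ ∧ (∀ ξ ∈ Λ, IsEnd ξ) ∧
      (∀ q ∈ Per φ u, ∀ ξ ∈ Λ, tr q ξ ∈ Λ) ∧ (∀ ξ ∈ Λ, Good φ u ξ) ∧ ∃ z0, 2 ≤ #(DD Λ z0) := by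
  have hsub : ∀ ξ ∈ X, ξ ∈ {η | ∃ q ∈ Per φ u, ∃ ξ ∈ X, tr q ξ = η} :=
    fun ξ hξ => ⟨1, one_mem _, ξ, hξ, tr_one ξ⟩
  refine ⟨{η | ∃ q ∈ Per φ u, ∃ ξ ∈ X, tr q ξ = η}, hsub, ?_, ?_, ?_, ?_⟩
  · rintro _ ⟨q, hq, ξ, hξ, rfl⟩; exact (hX ξ hξ).1.tr q
  · rintro q' hq' _ ⟨q, hq, ξ, hξ, rfl⟩
    exact ⟨q' * q, mul_mem hq' hq, ξ, hξ, (tr_tr _ _ _).symm⟩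
  · rintro _ ⟨q, hq, ξ, hξ, rfl⟩; exact (hX ξ hξ).2.tr hq
  · rcases h2 with ⟨ξ, hξ, η, hη, hne⟩ | ⟨ξ, hξ, q, hq, hne⟩
    · exact two_le_DD (hsub _ hξ) (hsub _ hη) hne
    · exact two_le_DD ⟨q, hq, ξ, hξ, rfl⟩ (hsub _ hξ) hne

theorem class_lemma (hn : 1 ≤ n) (hφ : Function.Injective φ) {I : Type*} [Fintype I] [DecidableEq I]
    [hne : Nonempty I]
    (v : I → FreeGroup (Fin n)) (m : I → ℕ) (hm : ∀ i, 1 ≤ m i)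
    (hv : ∀ i, uu φ (v i) (m i) = uu φ u (m i))
    (hdist : ∀ i j, i ≠ j → ∀ q, v i ≠ q⁻¹ * v j * φ q)
    (Fx : I → Subgroup (FreeGroup (Fin n))) (hFx : ∀ i f, f ∈ Fx i ↔ v i * φ f * (v i)⁻¹ = f)
    [∀ i, Group.FG (Fx i)] {ι : Type*} [Fintype ι] (idx : ι → I)
    (l : ι → FreeGroup (Fin n) → Fin n × Bool) (hl : ∀ a, AttE φ (v (idx a)) (l a))
    (hlne : ∀ a b, a ≠ b → idx a = idx b → ∀ g ∈ Fx (idx a), tr g (l a) ≠ l b)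
    (hpos : ∀ i, 2 < 2 * Group.rank (Fx i) + #{a | idx a = i}) :
    ∃ Λ : Set (FreeGroup (Fin n) → Fin n × Bool), (∀ ξ ∈ Λ, Good φ u ξ) ∧
      ∀ M : ℤ, (∀ Z : Finset (FreeGroup (Fin n)),
      (∀ z ∈ Z, ∀ z' ∈ Z, z ≠ z' → ∀ q ∈ Per φ u, z' ≠ q * z) →
      (∀ z ∈ Z, 2 ≤ #(DD Λ z)) → ∑ z ∈ Z, ((#(DD Λ z) : ℤ) - 2) ≤ M) →
      ∑ i, (2 * (Group.rank (Fx i) : ℤ) + #{a | idx a = i} - 2) ≤ M := by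
  classical
  have hPer : ∀ i, Per φ (v i) = Per φ u := fun i => Per_eq φ (hm i) (hv i)
  have hle : ∀ i, Fx i ≤ Per φ u := by
    intro i f hf
    rw [← hPer i]
    exact ⟨1, le_rfl, by rw [Ps_one]; exact (hFx i f).1 hf⟩
  have hvv : ∀ i j, uu φ (v j) (m i * m j) = uu φ (v i) (m i * m j) := fun i j => by
    rw [uu_dvd_eq φ (hv j) (Dvd.intro_left _ rfl), uu_dvd_eq φ (hv i) (Dvd.intro _ rfl)]
  -- legs are in distinct orbits
  have hleg : ∀ a b, a ≠ b → ∀ q ∈ Per φ u, tr q (l a) ≠ l b := by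
    intro a b hab q hq h
    have h1 := (hl a).rel (hl b) (Nat.mul_pos (hm _) (hm _)) (hvv (idx a) (idx b))
      (by rw [hPer]; exact hq) h
    by_cases hi : idx a = idx b
    · refine hlne a b hab hi q ?_ h
      rw [hFx]
      rw [← hi] at h1
      calc v (idx a) * φ q * (v (idx a))⁻¹ = q * (q⁻¹ * v (idx a) * φ q) * (v (idx a))⁻¹ := by group
        _ = q := by rw [← h1]; group
    · exact hdist _ _ hi q h1
  -- the set of ends
  obtain ⟨Λ, hlΛ, hE, hQ, hG, z0, hz0⟩ : ∃ Λ : Set (FreeGroup (Fin n) → Fin n × Bool),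
      (∀ a, l a ∈ Λ) ∧ (∀ ξ ∈ Λ, IsEnd ξ) ∧
      (∀ q ∈ Per φ u, ∀ ξ ∈ Λ, tr q ξ ∈ Λ) ∧ (∀ ξ ∈ Λ, Good φ u ξ) ∧ ∃ z0, 2 ≤ #(DD Λ z0) := by
    obtain ⟨i⟩ := hne
    by_cases hι : Nonempty ι
    · obtain ⟨a⟩ := hι
      obtain ⟨Λ, h1, h2⟩ := exists_Lam φ u (Set.range l) (by
        rintro _ ⟨a, rfl⟩
        exact ⟨(hl a).isEnd, (hl a).toGood (hm _) (hv _)⟩) (by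
        by_cases hq : ∃ q ∈ Per φ u, q ≠ 1
        · right
          obtain ⟨q, hq, hq1⟩ := hq
          refine ⟨l a, ⟨a, rfl⟩, q, hq, fun h => hq1 ?_⟩
          refine stab_one (hl a).isEnd (hl a).fr (by rw [hPer]; exact hq) h
        · left
          have hr : ¬ (1 ≤ Group.rank (Fx i)) := by
            intro h
            obtain ⟨f, hf, hf1⟩ := exists_ne_one_of_rank _ h
            exact hq ⟨f, hle i hf, hf1⟩
          have := hpos i
          obtain ⟨a, -, b, -, hab⟩ := Finset.one_lt_card.1 (show 1 < #{a | idx a = i} by omega)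
          exact ⟨_, ⟨a, rfl⟩, _, ⟨b, rfl⟩, fun h => hleg a b hab 1 (one_mem _) (by rw [tr_one, h])⟩)
      exact ⟨Λ, fun a => h1 ⟨a, rfl⟩, h2⟩
    · have hr : ¬ (Group.rank (Fx i) ≤ 1) := by
        have := hpos i
        have h0 : #{a | idx a = i} = 0 := by
          rw [Finset.card_eq_zero, Finset.eq_empty_iff_forall_notMem]
          intro a; exact absurd ⟨a⟩ hι
        omega
      obtain ⟨q, hq, q', hq', hqq⟩ : ∃ q ∈ Fx i, ∃ q' ∈ Fx i, q * q' ≠ q' * q := by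
        by_contra hc
        push Not at hc
        exact hr (rank_le_one_of_comm _ hc)
      have hqQ := hle i hq
      have hqQ' := hle i hq'
      have hq1 : q ≠ 1 := by rintro rfl; simp at hqq
      obtain ⟨h, hh⟩ := exists_axis_pt q hq1
      obtain ⟨ξ, hξ, hξc, hξh⟩ := pow_end hh
      have einv : (h⁻¹ * q * h)⁻¹ = h⁻¹ * q⁻¹ * h := by group
      obtain ⟨ζ, hζ, hζc, hζh⟩ := pow_end (g := q⁻¹) (h := h) (by
        rw [← einv, inv_inv]; exact hh.symm)
      obtain ⟨Λ, h1, h2⟩ := exists_Lam φ u {ξ, ζ} (by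
        rintro _ (rfl | rfl)
        · exact ⟨hξ, pow_good hqQ hqQ' hqq hζ hξc hζc⟩
        · refine ⟨hζ, pow_good (inv_mem hqQ) hqQ' ?_ hξ hζc (by simpa using hξc)⟩
          intro hc
          apply hqq
          calc q * q' = q * (q' * q⁻¹) * q := by group
            _ = q' * q := by rw [← hc]; group) (by
        left
        refine ⟨ξ, by simp, ζ, by simp, fun h => hh ?_⟩
        rw [← hξh, einv, ← hζh, h])
      exact ⟨Λ, fun a => absurd ⟨a⟩ hι, h2⟩
  refine ⟨Λ, hG, ?_⟩
  have hB := fun (M : ℤ) hM T => B (Per φ u) Λ hE hQ l hlΛ hleg (fun a => by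
    have := (hl a).fr; rwa [hPer] at this) M hM z0 hz0 (IsFreeGroup.basis (Per φ u)) T
  have hfin : Finite (IsFreeGroup.Generators (Per φ u)) := by
    by_contra hinf
    rw [not_finite_iff_infinite] at hinf
    obtain ⟨T, hT⟩ := Infinite.exists_subset_card_eq (IsFreeGroup.Generators (Per φ u)) (n + 1)
    have := A_comb hn φ hφ (C := Unit) (fun _ => u) (fun c c' h => absurd rfl h) (fun _ => Λ)
      (fun _ => hG) (fun _ => 2 * (#T : ℤ) - 2 + Fintype.card ι) (fun _ M hM => hB M hM T)
    simp [hT] at this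
    have h0 : (0 : ℤ) ≤ Fintype.card ι := by positivity
    omega
  have := Fintype.ofFinite (IsFreeGroup.Generators (Per φ u))
  intro M hM
  have h1 := hB M hM Finset.univ
  have h2 := class_rank φ u hφ (IsFreeGroup.basis (Per φ u)) v m hm hv hdist Fx hFx hle
  have h3 : ∑ i, #{a | idx a = i} = Fintype.card ι := by
    rw [← Finset.card_univ]
    exact (Finset.card_eq_sum_card_fiberwise (fun a _ => Finset.mem_coe.2 (mem_univ (idx a)))).symm
  have h4 : 1 ≤ Fintype.card I := Fintype.card_pos
  rw [Finset.sum_sub_distrib, Finset.sum_add_distrib, ← Finset.mul_sum]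
  rw [Finset.card_univ] at h1
  have h2' : (∑ i, (Group.rank (Fx i) : ℤ)) ≤ Fintype.card (IsFreeGroup.Generators (Per φ u)) := by
    exact_mod_cast h2
  have h3' : (∑ i, (#{a | idx a = i} : ℤ)) = Fintype.card ι := by exact_mod_cast h3
  rw [h3']
  simp only [Finset.sum_const, Finset.card_univ, nsmul_eq_mul]
  have h4' : (1 : ℤ) ≤ Fintype.card I := by exact_mod_cast h4
  linarith

end ClassL
end IdxSum

namespace IdxSum
open Finset

section Final
variable {n : ℕ}

theorem exists_legs (ψ : Monoid.End (FreeGroup (Fin n))) :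
    ∃ W : Fin (aCount ψ) → {W : InfRedWord n // IsAttractingFixPt ψ W},
      ∀ s t, s ≠ t → ¬ SameFixOrbit ψ (W s).1 (W t).1 := by
  classical
  obtain ⟨f, hf⟩ : ∃ f : Fin (aCount ψ) → Quot (fun W V : {W : InfRedWord n // IsAttractingFixPt ψ W} =>
    SameFixOrbit ψ W.1 V.1), Function.Injective f := by
    by_cases h : Finite (Quot (fun W V : {W : InfRedWord n // IsAttractingFixPt ψ W} =>
      SameFixOrbit ψ W.1 V.1))
    · exact ⟨(Finite.equivFin _).symm, (Finite.equivFin _).symm.injective⟩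
    · rw [not_finite_iff_infinite] at h
      have h0 : aCount ψ = 0 := Nat.card_eq_zero_of_infinite
      rw [h0]
      exact ⟨Fin.elim0, fun a => a.elim0⟩
  refine ⟨fun s => (f s).out, fun s t hst h => hst (hf ?_)⟩
  rw [← Quot.out_eq (f s), ← Quot.out_eq (f t)]
  exact Quot.sound h

/-- asymptotic conjugacy of the twisting elements -/
def RR (φ : Monoid.End (FreeGroup (Fin n))) (a b : FreeGroup (Fin n)) : Prop :=
  ∃ m, 1 ≤ m ∧ ∃ g, uu φ (g⁻¹ * a * φ g) m = uu φ b m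

theorem RR_refl (φ : Monoid.End (FreeGroup (Fin n))) (a) : RR φ a a := ⟨1, le_rfl, 1, by simp⟩

theorem RR_symm (φ : Monoid.End (FreeGroup (Fin n))) {a b} (h : RR φ a b) : RR φ b a := by
  obtain ⟨m, hm, g, h⟩ := h
  refine ⟨m, hm, g⁻¹, ?_⟩
  rw [uu_conj, ← h, uu_conj, map_inv]; group

theorem RR_trans (φ : Monoid.End (FreeGroup (Fin n))) {a b c} (h : RR φ a b) (h' : RR φ b c) :
    RR φ a c := by
  obtain ⟨m, hm, g, h⟩ := h
  obtain ⟨m', hm', g', h'⟩ := h'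
  refine ⟨m * m', Nat.mul_pos hm hm', g * g', ?_⟩
  have e1 := uu_dvd_eq φ h (Dvd.intro m' rfl)
  have e2 := uu_dvd_eq φ h' (Dvd.intro_left m rfl)
  rw [← e2, uu_conj, uu_conj, ← e1, uu_conj, map_mul]; group

theorem main_I (hn : 1 ≤ n) (φ : Monoid.End (FreeGroup (Fin n))) (hφ : Function.Injective φ)
    {I : Type} [Fintype I] (u : I → FreeGroup (Fin n)) (ψ : I → Monoid.End (FreeGroup (Fin n)))
    (hψ : ∀ i g, ψ i g = u i * φ g * (u i)⁻¹)
    (hdist : ∀ i j, i ≠ j → ¬ Isogredient (ψ i) (ψ j))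
    [hFG : ∀ i, Group.FG (fixSubgroup (ψ i))]
    (hpos : ∀ i, 2 < 2 * Group.rank (fixSubgroup (ψ i)) + aCount (ψ i)) :
    ∑ i, (2 * (Group.rank (fixSubgroup (ψ i)) : ℤ) + aCount (ψ i) - 2) ≤ 2 * n - 2 := by
  classical
  let sI : Setoid I := ⟨fun i j => RR φ (u i) (u j), fun i => RR_refl φ _, fun h => RR_symm φ h,
    fun h h' => RR_trans φ h h'⟩
  have hrep : ∀ i : I, RR φ (u i) (u (Quotient.mk sI i).out) := fun i =>
    Quotient.exact (s := sI) (Quotient.out_eq (Quotient.mk sI i)).symm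
  choose m hm g hg using hrep
  choose W hW using fun i => exists_legs (ψ i)
  have hcl : ∀ c : Quotient sI, ∃ Λ : Set (FreeGroup (Fin n) → Fin n × Bool),
      (∀ ξ ∈ Λ, Good φ (u c.out) ξ) ∧
      ∀ M : ℤ, (∀ Z : Finset (FreeGroup (Fin n)),
      (∀ z ∈ Z, ∀ z' ∈ Z, z ≠ z' → ∀ q ∈ Per φ (u c.out), z' ≠ q * z) →
      (∀ z ∈ Z, 2 ≤ #(DD Λ z)) → ∑ z ∈ Z, ((#(DD Λ z) : ℤ) - 2) ≤ M) →
      ∑ i : {i : I // Quotient.mk sI i = c},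
        (2 * (Group.rank (fixSubgroup (ψ i)) : ℤ) + aCount (ψ i) - 2) ≤ M := by
    intro c
    let J := {i : I // Quotient.mk sI i = c}
    have hJ : Nonempty J := ⟨⟨c.out, Quotient.out_eq c⟩⟩
    let Fx : J → Subgroup (FreeGroup (Fin n)) := fun i =>
      (fixSubgroup (ψ i)).map (MulAut.conj (g i.1)⁻¹).toMonoidHom
    let e : ∀ i : J, fixSubgroup (ψ i) ≃* Fx i := fun i =>
      (MulAut.conj (g i.1)⁻¹).subgroupMap (fixSubgroup (ψ i))
    have hfg : ∀ i, Group.FG (Fx i) := fun i =>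
      Group.fg_of_surjective (f := (e i).toMonoidHom) (e i).surjective
    have hrk : ∀ i, Group.rank (Fx i) = Group.rank (fixSubgroup (ψ i)) := fun i =>
      (Group.rank_congr (e i)).symm
    have hmem : ∀ i f, f ∈ Fx i ↔ g i.1 * f * (g i.1)⁻¹ ∈ fixSubgroup (ψ i) := by
      intro i f
      refine (Subgroup.mem_map_equiv).trans ?_
      rw [MulAut.conj_symm_apply, inv_inv]
    have hfix : ∀ i x, x ∈ fixSubgroup (ψ i) ↔ u i * φ x * (u i)⁻¹ = x := by
      intro i x
      rw [← hψ]; rfl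
    let ι := Σ i : J, Fin (aCount (ψ i))
    have hcard : ∀ i : J, #{a : ι | a.1 = i} = aCount (ψ i) := by
      intro i
      have : ({a : ι | a.1 = i} : Finset ι) = univ.map (Function.Embedding.sigmaMk i) := by
        ext ⟨j, t⟩
        simp only [mem_filter, mem_univ, true_and, mem_map, Function.Embedding.sigmaMk_apply]
        constructor
        · rintro rfl; exact ⟨t, rfl⟩
        · rintro ⟨s, hs⟩
          exact (congrArg Sigma.fst hs).symm
      rw [this, card_map, card_univ, Fintype.card_fin]
    obtain ⟨Λ, hΛ, hb⟩ := class_lemma φ (u c.out) hn hφ (I := J) (ι := ι)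
      (fun i => (g i.1)⁻¹ * u i * φ (g i.1)) (fun i => m i.1) (fun i => hm i.1)
      (fun i => by rw [hg]; rw [i.2]) (by
        rintro ⟨i, hi⟩ ⟨j, hj⟩ hij q h
        simp only at h
        refine hdist i j (fun h => hij (Subtype.ext h)) ⟨g j * q * (g i)⁻¹, fun x => ?_⟩
        have h1 : u j = g j * q * ((g i)⁻¹ * u i * φ (g i)) * (φ q)⁻¹ * (φ (g j))⁻¹ := by
          rw [h]; group
        rw [hψ, hψ, h1]
        simp only [map_mul, map_inv]
        group) Fx (by
        intro i f
        rw [hmem, hfix]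
        simp only [map_mul, map_inv]
        rw [← mul_right_inj (g i.1)⁻¹, ← mul_left_inj (g i.1)]
        have e1 : (g i.1)⁻¹ * (u i * (φ (g i.1) * φ f * (φ (g i.1))⁻¹) * (u i)⁻¹) * g i.1 =
          (g i.1)⁻¹ * u i * φ (g i.1) * φ f * ((g i.1)⁻¹ * u i * φ (g i.1))⁻¹ := by group
        have e2 : (g i.1)⁻¹ * (g i.1 * f * (g i.1)⁻¹) * g i.1 = f := by group
        rw [e1, e2]) (fun a => a.1)
      (fun a => tr (g a.1.1)⁻¹ (endOf (W a.1.1 a.2).1))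
      (fun a => (attE_of hφ (hψ a.1.1) (W a.1.1 a.2).2).conj _) (by
        rintro ⟨i, s⟩ ⟨j, t⟩ hab hij x hx h
        simp only at hij
        subst hij
        have hst : t ≠ s := by rintro rfl; exact hab rfl
        refine hW i.1 t s hst (sameFix_of_tr ((hmem i x).1 hx) ?_)
        simp only [tr_tr] at h
        have h1 := congrArg (tr (g i.1)) h
        rw [tr_tr, tr_tr, mul_inv_cancel, tr_one, ← mul_assoc] at h1
        exact h1) (by
        intro i
        rw [hrk, hcard]
        exact hpos i)
    refine ⟨Λ, hΛ, fun M hM => ?_⟩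
    have := hb M hM
    simp only [hrk, hcard] at this
    exact this
  choose Λ hΛ hb using hcl
  have hmain := A_comb hn φ hφ (C := Quotient sI) (fun c => u c.out) (by
    intro c c' hcc m hm x h
    apply hcc
    rw [← Quotient.out_eq c, ← Quotient.out_eq c']
    refine Quotient.sound (s := sI) ⟨m, hm, x, ?_⟩
    rw [uu_conj, h]; group) Λ hΛ _ hb
  refine le_trans (le_of_eq ?_) hmain
  exact (Fintype.sum_fiberwise (fun i => Quotient.mk sI i) (fun i =>
    (2 * (Group.rank (fixSubgroup (ψ i)) : ℤ) + aCount (ψ i) - 2))).symm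

end Final
end IdxSum

/-- (Gaboriau–Jaeger–Levitt–Lustig / Zhang–Zhao.) If `φ₀, …, φ_k` are endomorphisms of
`F_n` representing the same outer endomorphism as an injective endomorphism `φ`
(each `φᵢ = i_{mᵢ} ∘ φ`) and lying in pairwise distinct isogrediency classes, then
`Σᵢ max {0, ind φᵢ} ≤ n − 1`, where `ind φᵢ = rank (Fix φᵢ) + a(φᵢ)/2 − 1`. -/
theorem index_sum_le {n k : ℕ} (hn : 1 ≤ n)
    (φ : Monoid.End (FreeGroup (Fin n))) (hinj : Function.Injective φ)
    (m : Fin (k + 1) → FreeGroup (Fin n))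
    (φi : Fin (k + 1) → Monoid.End (FreeGroup (Fin n)))
    (hrep : ∀ (i : Fin (k + 1)) (g : FreeGroup (Fin n)), φi i g = m i * φ g * (m i)⁻¹)
    (hdist : ∀ i j : Fin (k + 1), i ≠ j → ¬ Isogredient (φi i) (φi j))
    (hFG : ∀ i : Fin (k + 1), Group.FG (fixSubgroup (φi i))) :
    ∑ i : Fin (k + 1), max 0 (@indEnd n (φi i) (hFG i)) ≤ (n : ℚ) - 1 := by
  classical
  have key := IdxSum.main_I hn φ hinj (I := {i : Fin (k + 1) // 0 < @indEnd n (φi i) (hFG i)})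
    (fun i => m i.1) (fun i => φi i.1) (fun i => hrep i.1)
    (fun i j hij => hdist i.1 j.1 (fun h => hij (Subtype.ext h))) (hFG := fun i => hFG i.1) (by
      rintro ⟨i, hi⟩
      unfold indEnd at hi
      have h2 : (2 : ℚ) < 2 * (@Group.rank (fixSubgroup (φi i)) _ (hFG i) : ℚ) + aCount (φi i) := by
        linarith
      exact_mod_cast h2)
  have hsum : ∑ i : Fin (k + 1), max 0 (@indEnd n (φi i) (hFG i)) =
      ∑ i : {i : Fin (k + 1) // 0 < @indEnd n (φi i) (hFG i)}, @indEnd n (φi i.1) (hFG i.1) := by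
    rw [Finset.sum_subtype (Finset.univ.filter fun i => 0 < @indEnd n (φi i) (hFG i))
      (p := fun i => 0 < @indEnd n (φi i) (hFG i)) (by simp) (fun i => @indEnd n (φi i) (hFG i)) |>.symm]
    rw [Finset.sum_filter]
    refine Finset.sum_congr rfl fun i _ => ?_
    split_ifs with h
    · exact max_eq_right h.le
    · exact max_eq_left (not_lt.1 h)
  rw [hsum]
  have key' : (∑ i : {i : Fin (k + 1) // 0 < @indEnd n (φi i) (hFG i)},
      (2 * (@Group.rank (fixSubgroup (φi i.1)) _ (hFG i.1) : ℚ) + aCount (φi i.1) - 2)) ≤ 2 * n - 2 := by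
    exact_mod_cast key
  have e : (∑ i : {i : Fin (k + 1) // 0 < @indEnd n (φi i) (hFG i)},
      (2 * (@Group.rank (fixSubgroup (φi i.1)) _ (hFG i.1) : ℚ) + aCount (φi i.1) - 2)) =
      2 * ∑ i : {i : Fin (k + 1) // 0 < @indEnd n (φi i) (hFG i)}, @indEnd n (φi i.1) (hFG i.1) := by
    rw [Finset.mul_sum]
    refine Finset.sum_congr rfl fun i _ => ?_
    unfold indEnd; ring
  linarith
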